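/- arXiv:1506.03806 — 3 statements merged into one kernel-verified Lean document; each statement's English description precedes it below -/
import Mathlib

section
/- Let (S,d) be a geodesic metric space that is homeomorphic to the 2-sphere, let x ∈ S, and let r > 0. Then every connected component U of the complement S \ cl(B(x,r)) of the closure of the open ball B(x,r) = {y : d(x,y) < r} has the property that its topological boundary ∂U, equipped with the subspace topology, is homeomorphic to the circle S¹ (i.e. ∂U is a simple closed curve in S). -/
/-- A metric space is geodesic if any two points are joined by an isometric path. -/
def IsGeodesicSpace (S : Type*) [MetricSpace S] : Prop :=
  ∀ x y : S, ∃ γ : ℝ → S, γ 0 = x ∧ γ (dist x y) = y ∧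
    ∀ s ∈ Set.Icc (0 : ℝ) (dist x y), ∀ t ∈ Set.Icc (0 : ℝ) (dist x y),
      dist (γ s) (γ t) = |s - t|

open Set Filter Topology

/-- `f` has a continuous logarithm on `s`. -/
def HasLogOn {X : Type*} [TopologicalSpace X] (f : X → ℂ) (s : Set X) : Prop :=
  ∃ g : X → ℂ, ContinuousOn g s ∧ ∀ x ∈ s, Complex.exp (g x) = f x

section HasLogOn

variable {X Y : Type*} [TopologicalSpace X] [TopologicalSpace Y]

theorem HasLogOn.mono {f : X → ℂ} {s t : Set X} (h : HasLogOn f t) (hst : s ⊆ t) :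
    HasLogOn f s := by
  obtain ⟨g, hg, hgf⟩ := h
  exact ⟨g, hg.mono hst, fun x hx => hgf x (hst hx)⟩

theorem HasLogOn.congr {f f' : X → ℂ} {s : Set X} (h : HasLogOn f s) (hf : EqOn f' f s) :
    HasLogOn f' s := by
  obtain ⟨g, hg, hgf⟩ := h
  exact ⟨g, hg, fun x hx => (hgf x hx).trans (hf hx).symm⟩

theorem HasLogOn.mul {f f' : X → ℂ} {s : Set X} (h : HasLogOn f s) (h' : HasLogOn f' s) :
    HasLogOn (fun x => f x * f' x) s := by
  obtain ⟨g, hg, hgf⟩ := h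
  obtain ⟨g', hg', hgf'⟩ := h'
  exact ⟨fun x => g x + g' x, hg.add hg', fun x hx => by
    rw [Complex.exp_add, hgf x hx, hgf' x hx]⟩

theorem HasLogOn.div {f f' : X → ℂ} {s : Set X} (h : HasLogOn f s) (h' : HasLogOn f' s) :
    HasLogOn (fun x => f x / f' x) s := by
  obtain ⟨g, hg, hgf⟩ := h
  obtain ⟨g', hg', hgf'⟩ := h'
  exact ⟨fun x => g x - g' x, hg.sub hg', fun x hx => by
    rw [Complex.exp_sub, hgf x hx, hgf' x hx]⟩

theorem hasLogOn_const {c : ℂ} (hc : c ≠ 0) (s : Set X) : HasLogOn (fun _ => c) s :=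
  ⟨fun _ => Complex.log c, continuousOn_const, fun _ _ => Complex.exp_log hc⟩

theorem HasLogOn.comp {f : X → ℂ} {s : Set X} {φ : Y → X} {t : Set Y} (h : HasLogOn f s)
    (hφ : ContinuousOn φ t) (hst : MapsTo φ t s) : HasLogOn (fun y => f (φ y)) t := by
  obtain ⟨g, hg, hgf⟩ := h
  exact ⟨fun y => g (φ y), hg.comp hφ hst, fun y hy => hgf _ (hst hy)⟩

theorem hasLogOn_of_norm_lt_one {w : X → ℂ} {s : Set X} (hw : ContinuousOn w s)
    (h1 : ∀ x ∈ s, ‖w x‖ < 1) : HasLogOn (fun x => 1 + w x) s := by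
  refine ⟨fun x => Complex.log (1 + w x), ?_, fun x hx => ?_⟩
  · exact (continuousOn_const.add hw).clog fun x hx =>
      Complex.mem_slitPlane_of_norm_lt_one (h1 x hx)
  · exact Complex.exp_log (Complex.slitPlane_ne_zero
      (Complex.mem_slitPlane_of_norm_lt_one (h1 x hx)))

/-- Moving the base point `a` to a point `b` closer to `a` than all values of `f` does not affect
the existence of a logarithm of `f - a`. -/
theorem hasLogOn_sub_iff_of_norm_lt {f : X → ℂ} {s : Set X} (hf : ContinuousOn f s) {a b : ℂ}
    (hab : ∀ x ∈ s, ‖b - a‖ < ‖f x - a‖) :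
    HasLogOn (fun x => f x - a) s ↔ HasLogOn (fun x => f x - b) s := by
  have hne : ∀ x ∈ s, f x - a ≠ 0 := fun x hx =>
    norm_pos_iff.1 ((norm_nonneg _).trans_lt (hab x hx))
  have hq : HasLogOn (fun x => 1 + -((b - a) / (f x - a))) s := by
    refine hasLogOn_of_norm_lt_one
      ((continuousOn_const.div (hf.sub continuousOn_const) hne).neg) fun x hx => ?_
    rw [norm_neg, norm_div, div_lt_one (norm_pos_iff.2 (hne x hx))]
    exact hab x hx
  have hq' : ∀ x ∈ s, 1 + -((b - a) / (f x - a)) = (f x - b) / (f x - a) := fun x hx => by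
    have := hne x hx
    field_simp
    ring
  have hne' : ∀ x ∈ s, f x - b ≠ 0 := fun x hx h0 => by
    have := hab x hx
    rw [← sub_eq_zero.1 h0] at this
    exact lt_irrefl _ this
  constructor
  · intro h
    refine (h.mul hq).congr fun x hx => ?_
    have := hne x hx
    simp only [hq' x hx]
    field_simp
  · intro h
    refine (h.div hq).congr fun x hx => ?_
    have := hne x hx
    have := hne' x hx
    simp only [hq' x hx]
    field_simp

theorem IsPreconnected.log_sub_eq {s : Set X} (hs : IsPreconnected s) {g g' : X → ℂ}
    (hg : ContinuousOn g s) (hg' : ContinuousOn g' s)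
    (h : ∀ x ∈ s, Complex.exp (g x) = Complex.exp (g' x)) {x y : X} (hx : x ∈ s) (hy : y ∈ s) :
    g x - g' x = g y - g' y := by
  have hpi : (2 * Real.pi * Complex.I : ℂ) ≠ 0 := Complex.two_pi_I_ne_zero
  have hn : ∀ z ∈ s, ∃ n : ℤ, g z - g' z = n * (2 * Real.pi * Complex.I) := fun z hz => by
    obtain ⟨n, hn⟩ := Complex.exp_eq_exp_iff_exists_int.1 (h z hz)
    exact ⟨n, by rw [hn]; ring⟩
  have hdisc : IsDiscrete (range ((↑) : ℤ → ℝ)) := by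
    rw [isDiscrete_iff_discreteTopology]
    exact (Int.isClosedEmbedding_coe_real.toIsEmbedding.toHomeomorph.symm).isEmbedding.discreteTopology
  have key := hs.constant_of_mapsTo hdisc
    (f := fun z => ((g z - g' z) / (2 * Real.pi * Complex.I)).re)
    (Complex.continuous_re.comp_continuousOn ((hg.sub hg').div_const _)) (fun z hz => by
      obtain ⟨n, hn⟩ := hn z hz
      exact ⟨n, by simp [hn]⟩) hx hy
  obtain ⟨n, hn1⟩ := hn x hx
  obtain ⟨m, hm1⟩ := hn y hy
  simp only [hn1, hm1, mul_div_cancel_right₀ _ hpi, Complex.intCast_re, Int.cast_inj] at key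
  rw [hn1, hm1, key]

theorem ContinuousOn.union_of_relatively_closed {s F G : Set X} {g : X → Y} (hF : IsClosed F)
    (hG : IsClosed G) (hs : s ⊆ F ∪ G) (hgF : ContinuousOn g (s ∩ F))
    (hgG : ContinuousOn g (s ∩ G)) : ContinuousOn g s := by
  have aux : ∀ {H : Set X}, IsClosed H → ContinuousOn g (s ∩ H) → ∀ x ∈ s,
      ContinuousWithinAt g (s ∩ H) x := by
    intro H hH hg x hx
    by_cases hxH : x ∈ H
    · exact hg x ⟨hx, hxH⟩
    · exact continuousWithinAt_of_notMem_closure fun hcl =>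
        hxH (hH.closure_subset_iff.2 inter_subset_right hcl)
  intro x hx
  have := (aux hF hgF x hx).union (aux hG hgG x hx)
  rwa [← inter_union_distrib_left, inter_eq_left.2 hs] at this

theorem HasLogOn.glue {f : X → ℂ} {s F G : Set X} (hF : IsClosed F) (hG : IsClosed G)
    (hs : s ⊆ F ∪ G) (hconn : IsPreconnected (s ∩ (F ∩ G))) (hfF : HasLogOn f (s ∩ F))
    (hfG : HasLogOn f (s ∩ G)) : HasLogOn f s := by
  classical
  obtain ⟨g, hg, hgf⟩ := hfF
  obtain ⟨g', hg', hgf'⟩ := hfG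
  obtain ⟨c, hc, hc1⟩ : ∃ c : ℂ, (∀ x ∈ s ∩ (F ∩ G), g x = g' x + c) ∧ Complex.exp c = 1 := by
    rcases (s ∩ (F ∩ G)).eq_empty_or_nonempty with h | ⟨y, hy⟩
    · exact ⟨0, by simp [h], by simp⟩
    · refine ⟨g y - g' y, fun x hx => ?_, ?_⟩
      · rw [← hconn.log_sub_eq (hg.mono fun z hz => ⟨hz.1, hz.2.1⟩)
          (hg'.mono fun z hz => ⟨hz.1, hz.2.2⟩) (fun z hz => by
            rw [hgf z ⟨hz.1, hz.2.1⟩, hgf' z ⟨hz.1, hz.2.2⟩]) hx hy]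
        ring
      · rw [Complex.exp_sub, hgf y ⟨hy.1, hy.2.1⟩, ← hgf' y ⟨hy.1, hy.2.2⟩,
          div_self (Complex.exp_ne_zero _)]
  have hGe : EqOn (fun x => if x ∈ F then g x else g' x + c) (fun x => g' x + c) (s ∩ G) := by
    intro x hx
    by_cases hxF : x ∈ F
    · simpa [hxF] using hc x ⟨hx.1, hxF, hx.2⟩
    · simp [hxF]
  refine ⟨fun x => if x ∈ F then g x else g' x + c, ?_, fun x hx => ?_⟩
  · refine ContinuousOn.union_of_relatively_closed hF hG hs (hg.congr fun x hx => ?_)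
      ((hg'.add continuousOn_const).congr hGe)
    simp [hx.2]
  · by_cases hxF : x ∈ F
    · simpa [hxF] using hgf x ⟨hx, hxF⟩
    · simpa [hxF, Complex.exp_add, hc1] using hgf' x ⟨hx, (hs hx).resolve_left hxF⟩

/-- Logarithms on compact connected sets through a base point glue to a global logarithm. -/
theorem hasLogOn_of_forall_compact_preconnected {f : X → ℂ} {s : Set X} {x₀ : X}
    (hlog : ∀ T ⊆ s, IsCompact T → IsPreconnected T → x₀ ∈ T → HasLogOn f T)
    (hnhds : ∀ y ∈ s, ∃ T ⊆ s, IsCompact T ∧ IsPreconnected T ∧ x₀ ∈ T ∧ T ∈ 𝓝[s] y) :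
    HasLogOn f s := by
  have hlog' : ∀ T ⊆ s, IsCompact T → IsPreconnected T → x₀ ∈ T →
      ∃ g : X → ℂ, ContinuousOn g T ∧ (∀ x ∈ T, Complex.exp (g x) = f x) ∧
        g x₀ = Complex.log (f x₀) := by
    intro T h1 h2 h3 h4
    obtain ⟨g, hg, hgf⟩ := hlog T h1 h2 h3 h4
    refine ⟨fun x => g x - g x₀ + Complex.log (f x₀), by fun_prop, fun x hx => ?_, by simp⟩
    have h0 : f x₀ ≠ 0 := by rw [← hgf x₀ h4]; exact Complex.exp_ne_zero _
    rw [Complex.exp_add, Complex.exp_sub, hgf x hx, hgf x₀ h4, Complex.exp_log h0,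
      div_mul_cancel₀ _ h0]
  choose! T hTs hTc hTp hT0 hTn using hnhds
  choose! g hg hgf hg0 using hlog'
  have agree : ∀ T ⊆ s, IsCompact T → IsPreconnected T → x₀ ∈ T → ∀ T' ⊆ s, IsCompact T' →
      IsPreconnected T' → x₀ ∈ T' → T ⊆ T' → EqOn (g T) (g T') T := by
    intro T h1 h2 h3 h4 T' h1' h2' h3' h4' hTT x hx
    have := h3.log_sub_eq (hg T h1 h2 h3 h4) ((hg T' h1' h2' h3' h4').mono hTT) (fun z hz => by
      rw [hgf T h1 h2 h3 h4 z hz, hgf T' h1' h2' h3' h4' z (hTT hz)]) hx h4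
    rwa [hg0 T h1 h2 h3 h4, hg0 T' h1' h2' h3' h4', sub_self, sub_eq_zero] at this
  have hmem : ∀ y ∈ s, y ∈ T y := fun y hy => mem_of_mem_nhdsWithin hy (hTn y hy)
  have key : ∀ y ∈ s, EqOn (fun z => g (T z) z) (g (T y)) (T y) := by
    intro y hy z hz
    have hzs := hTs y hy hz
    have hu1 : T y ∪ T z ⊆ s := union_subset (hTs y hy) (hTs z hzs)
    have hu2 := (hTc y hy).union (hTc z hzs)
    have hu3 := (hTp y hy).union x₀ (hT0 y hy) (hT0 z hzs) (hTp z hzs)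
    have hu4 : x₀ ∈ T y ∪ T z := Or.inl (hT0 y hy)
    exact (agree (T z) (hTs z hzs) (hTc z hzs) (hTp z hzs) (hT0 z hzs) _ hu1 hu2 hu3 hu4
      subset_union_right (hmem z hzs)).trans
      (agree (T y) (hTs y hy) (hTc y hy) (hTp y hy) (hT0 y hy) _ hu1 hu2 hu3 hu4
      subset_union_left hz).symm
  refine ⟨fun z => g (T z) z, fun y hy => ?_, fun y hy =>
    hgf _ (hTs y hy) (hTc y hy) (hTp y hy) (hT0 y hy) y (hmem y hy)⟩
  have h1 : ContinuousWithinAt (fun z => g (T z) z) (T y) y :=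
    ((hg _ (hTs y hy) (hTc y hy) (hTp y hy) (hT0 y hy)) y (hmem y hy)).congr (key y hy)
      (key y hy (hmem y hy))
  exact h1.mono_of_mem_nhdsWithin (hTn y hy)

/-- If `f` takes values off a path from `γ 0` to `γ 1`, then `(f - γ 1) / (f - γ 0)` has a
logarithm. -/
theorem hasLogOn_div_of_path {f : X → ℂ} {s : Set X} (hf : ContinuousOn f s)
    (γ : C(unitInterval, ℂ)) (hγ : ∀ x ∈ s, ∀ t, f x ≠ γ t) :
    HasLogOn (fun x => (f x - γ 1) / (f x - γ 0)) s := by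
  classical
  have hf' : Continuous (fun x : s => f x) := continuousOn_iff_continuous_domRestrict.1 hf
  let H : C(unitInterval × s, {z : ℂ // z ≠ 0}) :=
    ⟨fun p => ⟨(f p.2 - γ p.1) / (f p.2 - γ 0), div_ne_zero
        (sub_ne_zero.2 (hγ _ p.2.2 _)) (sub_ne_zero.2 (hγ _ p.2.2 _))⟩, by
      refine Continuous.subtype_mk (Continuous.div ?_ ?_ fun p =>
        sub_ne_zero.2 (hγ _ p.2.2 _)) _
      · exact (hf'.comp continuous_snd).sub (γ.continuous.comp continuous_fst)
      · exact (hf'.comp continuous_snd).sub continuous_const⟩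
  have H0 : ∀ a : s, H (0, a) = ⟨_, Complex.exp_ne_zero ((ContinuousMap.const s (0 : ℂ)) a)⟩ :=
    fun a => Subtype.ext (by
      simp [H, div_self (sub_ne_zero.2 (hγ _ a.2 0))])
  let L := Complex.isCoveringMap_exp.liftHomotopy H (ContinuousMap.const s (0 : ℂ)) H0
  have hL := Complex.isCoveringMap_exp.liftHomotopy_lifts H (ContinuousMap.const s (0 : ℂ)) H0
  refine ⟨fun x => if hx : x ∈ s then L (1, ⟨x, hx⟩) else 0, ?_, fun x hx => ?_⟩
  · rw [continuousOn_iff_continuous_domRestrict]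
    have : s.domRestrict (fun x => if hx : x ∈ s then L (1, ⟨x, hx⟩) else 0) =
        fun x : s => L (1, x) := by
      ext x
      simp
    rw [this]
    fun_prop
  · have := congrArg Subtype.val (congrFun hL (1, ⟨x, hx⟩))
    simpa [hx, H, L] using this

theorem exists_continuous_log_of_continuous {G : ℂ → ℂ} (hG : Continuous G) (h0 : ∀ z, G z ≠ 0) :
    ∃ g : ℂ → ℂ, Continuous g ∧ ∀ z, Complex.exp (g z) = G z := by
  obtain ⟨F, ⟨-, hF⟩, -⟩ := Complex.isCoveringMapOn_exp.existsUnique_continuousMap_lifts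
    (⟨G, hG⟩ : C(ℂ, ℂ)) (a₀ := 0) (e₀ := Complex.log (G 0)) (Complex.exp_log (h0 0))
    (fun a => h0 a)
  exact ⟨F, F.continuous, fun z => congrFun hF z⟩

theorem not_hasLogOn_sub_sphere (a : ℂ) {ε : ℝ} (hε : 0 < ε) :
    ¬ HasLogOn (fun z => z - a) (Metric.sphere a ε) := by
  rintro ⟨g, hg, hgf⟩
  have hmem : ∀ t : ℝ, circleMap a ε t ∈ Metric.sphere a ε := circleMap_mem_sphere a hε.le
  have h := isPreconnected_univ.log_sub_eq (X := ℝ) (g := fun t => g (circleMap a ε t))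
    (g' := fun t => Complex.log ε + t * Complex.I)
    (hg.comp (continuous_circleMap a ε).continuousOn fun t _ => hmem t) (by fun_prop)
    (fun t _ => by
      rw [hgf _ (hmem t), Complex.exp_add, Complex.exp_log (by exact_mod_cast hε.ne')]
      simp [circleMap]) (mem_univ 0) (mem_univ (2 * Real.pi))
  have hper : circleMap a ε (2 * Real.pi) = circleMap a ε 0 := by simp [circleMap]
  simp only [hper] at h
  simp at h

theorem not_hasLogOn_div_compl_pair {a b : ℂ} (hab : a ≠ b) :
    ¬ HasLogOn (fun z => (z - a) / (z - b)) {a, b}ᶜ := by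
  intro h
  have hpos : 0 < ‖a - b‖ := norm_pos_iff.2 (sub_ne_zero.2 hab)
  have hε : 0 < ‖a - b‖ / 2 := by positivity
  have hdist : ∀ z ∈ Metric.sphere a (‖a - b‖ / 2), ‖z - a‖ = ‖a - b‖ / 2 := fun z hz => by
    simpa [dist_eq_norm] using hz
  have hmem : Metric.sphere a (‖a - b‖ / 2) ⊆ ({a, b} : Set ℂ)ᶜ := by
    intro z hz hz'
    have := hdist z hz
    rcases hz' with rfl | rfl
    · rw [sub_self, norm_zero] at this; linarith
    · rw [norm_sub_rev] at this; linarith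
  have hb : HasLogOn (fun z : ℂ => z - b) (Metric.sphere a (‖a - b‖ / 2)) := by
    have h1 : HasLogOn (fun z : ℂ => 1 + (z - a) / (a - b)) (Metric.sphere a (‖a - b‖ / 2)) :=
      hasLogOn_of_norm_lt_one (by fun_prop) fun z hz => by
        rw [norm_div, hdist z hz, div_lt_one hpos]; linarith
    refine ((hasLogOn_const (sub_ne_zero.2 hab) _).mul h1).congr fun z _ => ?_
    have := sub_ne_zero.2 hab
    field_simp
    ring
  refine not_hasLogOn_sub_sphere a hε (((h.mono hmem).mul hb).congr fun z hz => ?_)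
  have : z - b ≠ 0 := fun h => hmem hz (by simp [sub_eq_zero.1 h])
  field_simp

/-- The plane is unicoherent. -/
theorem Complex.isPreconnected_inter_of_union_eq_univ {A B : Set ℂ} (hA : IsClosed A)
    (hB : IsClosed B) (hAc : IsPreconnected A) (hBc : IsPreconnected B) (hAB : A ∪ B = univ) :
    IsPreconnected (A ∩ B) := by
  classical
  rw [isPreconnected_iff_subset_of_fully_disjoint_closed (hA.inter hB)]
  intro u v hu hv huv hd
  by_contra! hcon
  obtain ⟨q, hq, hqu⟩ := not_subset.1 hcon.1
  obtain ⟨p, hp, hpv⟩ := not_subset.1 hcon.2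
  have hqv : q ∈ v := (huv hq).resolve_left hqu
  have hpu : p ∈ u := (huv hp).resolve_right hpv
  obtain ⟨f, hfu, hfv, -⟩ := exists_continuous_zero_one_of_isClosed hu hv hd
  have hc : Continuous fun z => (f z : ℂ) * (Real.pi * Complex.I) := by fun_prop
  have hval : ∀ z ∈ A ∩ B, Complex.exp ((f z : ℂ) * (Real.pi * Complex.I)) =
      Complex.exp (-((f z : ℂ) * (Real.pi * Complex.I))) := fun z hz => by
    rcases huv hz with h | h
    · simp [hfu h]
    · simp [hfv h, Complex.exp_neg]
  let G : ℂ → ℂ := fun z => if z ∈ A then Complex.exp ((f z : ℂ) * (Real.pi * Complex.I))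
    else Complex.exp (-((f z : ℂ) * (Real.pi * Complex.I)))
  have hGA : ∀ z ∈ A, G z = Complex.exp ((f z : ℂ) * (Real.pi * Complex.I)) :=
    fun z hz => if_pos hz
  have hGB : ∀ z ∈ B, G z = Complex.exp (-((f z : ℂ) * (Real.pi * Complex.I))) := fun z hz => by
    by_cases hzA : z ∈ A
    · rw [hGA z hzA, hval z ⟨hzA, hz⟩]
    · exact if_neg hzA
  have hG : Continuous G := by
    rw [← continuousOn_univ]
    refine ContinuousOn.union_of_relatively_closed hA hB hAB.ge ?_ ?_
    · exact (Complex.continuous_exp.comp hc).continuousOn.congr fun z hz => hGA z hz.2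
    · exact (Complex.continuous_exp.comp hc.neg).continuousOn.congr fun z hz => hGB z hz.2
  obtain ⟨g, hg, hgG⟩ := exists_continuous_log_of_continuous hG fun z => by
    simp only [G]; split_ifs <;> exact Complex.exp_ne_zero _
  have h1 := hAc.log_sub_eq hg.continuousOn hc.continuousOn
    (fun z hz => by rw [hgG, hGA z hz]) hp.1 hq.1
  have h2 := hBc.log_sub_eq (g' := fun z => -((f z : ℂ) * (Real.pi * Complex.I)))
    hg.continuousOn hc.neg.continuousOn
    (fun z hz => by rw [hgG, hGB z hz]) hp.2 hq.2
  simp only [hfu hpu, hfv hqv, Pi.zero_apply, Pi.one_apply, Complex.ofReal_zero,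
    Complex.ofReal_one] at h1 h2
  have h3 : (2 : ℂ) * (Real.pi * Complex.I) = 0 := by linear_combination h1 - h2
  simp [Real.pi_ne_zero] at h3

end HasLogOn

section Circle

/-- The closure of one side of a cut point of a connected space is connected. -/
theorem isPreconnected_insert_of_union_eq_compl_singleton {X : Type*} [TopologicalSpace X]
    [PreconnectedSpace X] {p : X} {M N : Set X} (hM : IsOpen M) (hN : IsOpen N)
    (hd : Disjoint M N) (hMN : M ∪ N = {p}ᶜ) : IsPreconnected (insert p M) := by
  have hpM : p ∉ M := fun h => (hMN.le (Or.inl h)) rfl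
  have hpN : p ∉ N := fun h => (hMN.le (Or.inr h)) rfl
  have hcl : ∀ {M N : Set X}, IsOpen N → Disjoint M N → M ∪ N = {p}ᶜ → p ∉ N →
      IsClosed (insert p M) := by
    intro M N hN hd hMN hpN
    have : insert p M = Nᶜ := by
      ext x
      have := Set.ext_iff.1 hMN x
      by_cases hx : x = p
      · simp [hx, hpN]
      · have h2 : x ∈ M → x ∉ N := fun h h' => hd.le_bot ⟨h, h'⟩
        simp [hx] at this ⊢
        tauto
    rw [this]
    exact hN.isClosed_compl
  have hcM := hcl hN hd hMN hpN
  have hcN := hcl hM hd.symm (by rw [union_comm, hMN]) hpM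
  rw [isPreconnected_iff_subset_of_fully_disjoint_closed hcM]
  have key : ∀ u v : Set X, IsClosed u → IsClosed v → insert p M ⊆ u ∪ v → Disjoint u v →
      p ∈ u → insert p M ⊆ u := by
    intro u v hu hv huv hduv hp
    have hclopen : IsClopen (v ∩ insert p M) := by
      refine ⟨hv.inter hcM, ?_⟩
      have : v ∩ insert p M = M ∩ uᶜ := by
        ext x
        constructor
        · rintro ⟨h1, h2⟩
          have h3 : x ∉ u := fun h => hduv.le_bot ⟨h, h1⟩
          exact ⟨h2.resolve_left (by rintro rfl; exact h3 hp), h3⟩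
        · rintro ⟨h1, h2⟩
          exact ⟨(huv (Or.inr h1)).resolve_left h2, Or.inr h1⟩
      rw [this]
      exact hM.inter hu.isOpen_compl
    rcases isClopen_iff.1 hclopen with h | h
    · intro x hx
      refine (huv hx).resolve_right fun hxv => ?_
      exact (h.le ⟨hxv, hx⟩ : x ∈ (∅ : Set X))
    · have : p ∈ v ∩ insert p M := by rw [h]; trivial
      exact (hduv.le_bot ⟨hp, this.1⟩).elim
  intro u v hu hv huv hduv
  rcases huv (mem_insert p M) with hp | hp
  · exact Or.inl (key u v hu hv huv hduv hp)
  · exact Or.inr (key v u hv hu (by rwa [union_comm]) hduv.symm hp)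

/-- A family of cuts of a connected space, where `M p` and `N p` are the two sides of `p`,
such that all the `M p` are on the side of `a`, and all the `N p` on the side of `b`. -/
structure CutSystem {X : Type*} [TopologicalSpace X] (a b : X) (M N : X → Set X) : Prop where
  isOpen_left : ∀ p, IsOpen (M p)
  isOpen_right : ∀ p, IsOpen (N p)
  disjoint : ∀ p, Disjoint (M p) (N p)
  union_eq : ∀ p, M p ∪ N p = {p}ᶜ
  mem_left : ∀ p, a ∈ insert p (M p)
  mem_right : ∀ p, b ∈ insert p (N p)

namespace CutSystem

section

variable {X : Type*} [TopologicalSpace X] {a b : X} {M N : X → Set X}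

theorem symm (h : CutSystem a b M N) : CutSystem b a N M :=
  ⟨h.isOpen_right, h.isOpen_left, fun p => (h.disjoint p).symm,
    fun p => by rw [union_comm, h.union_eq], h.mem_right, h.mem_left⟩

theorem notMem_left (h : CutSystem a b M N) (p : X) : p ∉ M p :=
  fun hp => ((h.union_eq p).le (Or.inl hp)) rfl

theorem notMem_right (h : CutSystem a b M N) (p : X) : p ∉ N p :=
  h.symm.notMem_left p

theorem trichotomy (h : CutSystem a b M N) (p q : X) : p = q ∨ p ∈ M q ∨ p ∈ N q := by
  by_cases hpq : p = q
  · exact Or.inl hpq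
  · exact Or.inr ((h.union_eq q).ge hpq)

theorem notMem_insert_left (h : CutSystem a b M N) {p q : X} (hpq : p ∈ N q) :
    p ∉ insert q (M q) := by
  rintro (rfl | h')
  · exact h.notMem_right _ hpq
  · exact (h.disjoint q).le_bot ⟨h', hpq⟩

theorem compl_right (h : CutSystem a b M N) (p : X) : (N p)ᶜ = insert p (M p) := by
  ext x
  constructor
  · intro hx
    rcases h.trichotomy x p with h' | h' | h'
    · exact Or.inl h'
    · exact Or.inr h'
    · exact (hx h').elim
  · intro hx hx'
    exact h.notMem_insert_left hx' hx

theorem isClosed_insert (h : CutSystem a b M N) (p : X) : IsClosed (insert p (M p)) := by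
  rw [← h.compl_right]
  exact (h.isOpen_right p).isClosed_compl

variable [PreconnectedSpace X]

theorem isPreconnected_insert (h : CutSystem a b M N) (p : X) :
    IsPreconnected (insert p (M p)) :=
  isPreconnected_insert_of_union_eq_compl_singleton (h.isOpen_left p) (h.isOpen_right p)
    (h.disjoint p) (h.union_eq p)

theorem mem_right_of_mem_left (h : CutSystem a b M N) {p q : X} (hpq : p ∈ M q) : q ∈ N p := by
  have hp : p ∉ insert q (N q) := h.symm.notMem_insert_left hpq
  have hsub : insert q (N q) ⊆ M p ∪ N p := by
    rw [h.union_eq]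
    intro x hx hxp
    rw [mem_singleton_iff.1 hxp] at hx
    exact hp hx
  have hb : b ∈ N p := (h.mem_right p).resolve_left fun hbp => hp (hbp ▸ h.mem_right q)
  exact (h.symm.isPreconnected_insert q).subset_right_of_subset_union (h.isOpen_left p)
    (h.isOpen_right p) (h.disjoint p) hsub ⟨b, h.mem_right q, hb⟩ (mem_insert _ _)

theorem mem_left_iff_mem_right (h : CutSystem a b M N) {p q : X} : p ∈ M q ↔ q ∈ N p :=
  ⟨h.mem_right_of_mem_left, h.symm.mem_right_of_mem_left⟩

theorem insert_subset (h : CutSystem a b M N) {p q : X} (hpq : p ∈ M q) :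
    insert p (M p) ⊆ M q := by
  have hsub : insert p (M p) ⊆ M q ∪ N q := by
    rw [h.union_eq]
    intro x hx hxq
    rw [mem_singleton_iff.1 hxq] at hx
    exact h.notMem_insert_left (h.mem_right_of_mem_left hpq) hx
  exact (h.isPreconnected_insert p).subset_left_of_subset_union (h.isOpen_left q)
    (h.isOpen_right q) (h.disjoint q) hsub ⟨p, mem_insert _ _, hpq⟩

theorem exists_between (h : CutSystem a b M N) {p q : X} (hpq : p ∈ M q) :
    ∃ v, p ∈ M v ∧ q ∈ N v := by
  by_contra! hcon
  have hcov : univ ⊆ insert p (M p) ∪ insert q (N q) := by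
    intro v _
    rw [← h.compl_right, ← h.symm.compl_right, ← compl_inter]
    rintro ⟨h1, h2⟩
    exact hcon v (h.mem_left_iff_mem_right.2 h1) (h.mem_left_iff_mem_right.1 h2)
  obtain ⟨v, -, hv1, hv2⟩ := isPreconnected_closed_iff.1 isPreconnected_univ _ _
    (h.isClosed_insert p) (h.symm.isClosed_insert q) hcov ⟨p, trivial, mem_insert _ _⟩
    ⟨q, trivial, mem_insert _ _⟩
  exact h.symm.notMem_insert_left (h.insert_subset hpq hv1) hv2

end

section Metric

variable {X : Type*} [MetricSpace X] [CompactSpace X] [PreconnectedSpace X] {a b : X}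
  {M N : X → Set X}

theorem continuous_infDist (h : CutSystem a b M N) (p : X) :
    Continuous fun c => Metric.infDist p (insert c (M c)) := by
  have hne : ∀ c, (insert c (M c)).Nonempty := fun c => insert_nonempty _ _
  refine continuous_iff_continuousAt.2 fun c => tendsto_order.2 ⟨fun t ht => ?_, fun t ht => ?_⟩
  · have hev : ∀ᶠ c' in 𝓝 c, ∀ z ∈ Metric.closedBall p t, c' ∈ M z := by
      refine (isCompact_closedBall p t).eventually_forall_of_forall_eventually fun z hz => ?_
      have hzc : z ∈ N c := by
        by_contra hz'
        have hz2 : z ∈ insert c (M c) := by rwa [← h.compl_right]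
        have := Metric.infDist_le_dist_of_mem (x := p) hz2
        rw [Metric.mem_closedBall, dist_comm] at hz
        linarith
      obtain ⟨v, hv1, hv2⟩ := h.exists_between (h.mem_left_iff_mem_right.2 hzc)
      filter_upwards [prod_mem_nhds ((h.isOpen_left v).mem_nhds hv1)
        ((h.isOpen_right v).mem_nhds hv2)] with w hw
      exact h.insert_subset (h.mem_left_iff_mem_right.2 hw.2) (Or.inr hw.1)
    filter_upwards [hev] with c' hc'
    obtain ⟨u, hu, hud⟩ := (h.isClosed_insert c').isCompact.exists_infDist_eq_dist (hne c') p
    rw [hud]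
    by_contra! hle
    have := hc' u (by rwa [Metric.mem_closedBall, dist_comm])
    exact h.notMem_insert_left (h.mem_right_of_mem_left this) hu
  · obtain ⟨u, hu, hut⟩ := (Metric.infDist_lt_iff (hne c)).1 ht
    rcases hu with rfl | hu
    · have : ∀ᶠ c' in 𝓝 u, dist p c' < t :=
        (continuous_const.dist continuous_id).continuousAt.eventually_lt_const hut
      filter_upwards [this] with c' hc'
      exact (Metric.infDist_lt_iff (hne c')).2 ⟨c', mem_insert _ _, hc'⟩
    · filter_upwards [(h.isOpen_right u).mem_nhds (h.mem_right_of_mem_left hu)] with c' hc'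
      exact (Metric.infDist_lt_iff (hne c')).2
        ⟨u, Or.inr (h.mem_left_iff_mem_right.2 hc'), hut⟩

/-- Any cut system on a compact connected metric space is given by a continuous real function. -/
theorem exists_continuous_strictMono (h : CutSystem a b M N) :
    ∃ F : X → ℝ, Continuous F ∧ ∀ p q, p ∈ M q → F p < F q := by
  have : Nonempty X := ⟨a⟩
  set d := TopologicalSpace.denseSeq X
  have hbd : ∀ n c, Metric.infDist (d n) (insert c (M c)) ≤ Metric.diam (univ : Set X) :=
    fun n c => (Metric.infDist_le_dist_of_mem (mem_insert c _)).trans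
      (Metric.dist_le_diam_of_mem isCompact_univ.isBounded trivial trivial)
  have hbd' : ∀ n c, ‖(1 / 2 : ℝ) ^ n * Metric.infDist (d n) (insert c (M c))‖ ≤
      (1 / 2 : ℝ) ^ n * Metric.diam (univ : Set X) := fun n c => by
    rw [Real.norm_of_nonneg (mul_nonneg (by positivity) Metric.infDist_nonneg)]
    gcongr
    exact hbd n c
  have hsum : Summable fun n : ℕ => (1 / 2 : ℝ) ^ n * Metric.diam (univ : Set X) :=
    summable_geometric_two.mul_right _
  have hsum' : ∀ c, Summable fun n : ℕ => (1 / 2 : ℝ) ^ n * Metric.infDist (d n) (insert c (M c)) :=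
    fun c => hsum.of_norm_bounded fun n => hbd' n c
  refine ⟨fun c => -∑' n, (1 / 2 : ℝ) ^ n * Metric.infDist (d n) (insert c (M c)),
    (continuous_tsum (fun n => continuous_const.mul (h.continuous_infDist (d n))) hsum hbd').neg,
    fun p q hpq => neg_lt_neg ?_⟩
  have hq : q ∉ insert p (M p) := h.notMem_insert_left (h.mem_right_of_mem_left hpq)
  have hpos := ((h.isClosed_insert p).notMem_iff_infDist_pos (insert_nonempty _ _)).1 hq
  obtain ⟨n, hn⟩ := (TopologicalSpace.denseRange_denseSeq X).exists_dist_lt q (half_pos hpos)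
  refine Summable.tsum_lt_tsum (i := n) (fun m => ?_) ?_ (hsum' q) (hsum' p)
  · gcongr ?_ * ?_
    exact Metric.infDist_le_infDist_of_subset
      ((h.insert_subset hpq).trans (subset_insert _ _)) (insert_nonempty _ _)
  · gcongr ?_ * ?_
    have h1 : Metric.infDist (d n) (insert q (M q)) ≤ dist (d n) q :=
      Metric.infDist_le_dist_of_mem (mem_insert _ _)
    have h2 := Metric.infDist_le_infDist_add_dist (s := insert p (M p)) (x := q) (y := d n)
    rw [dist_comm] at h1
    change dist q (d n) < _ at hn
    linarith

end Metric

end CutSystem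

/-- A compact connected metric space in which any point other than `a` and `b` separates
`a` from `b` is an arc from `a` to `b`. -/
theorem exists_arc_parametrization {X : Type*} [MetricSpace X] [CompactSpace X]
    [PreconnectedSpace X] {a b : X} (hab : a ≠ b)
    (hsep : ∀ p, p ≠ a → p ≠ b → ∃ f : X → Bool, ContinuousOn f {p}ᶜ ∧ f a ≠ f b) :
    ∃ h : X → ℝ, Continuous h ∧ Function.Injective h ∧ range h = Icc 0 1 ∧ h a = 0 ∧ h b = 1 := by
  have hMN : ∀ p : X, ∃ M N : Set X, IsOpen M ∧ IsOpen N ∧ Disjoint M N ∧ M ∪ N = {p}ᶜ ∧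
      a ∈ insert p M ∧ b ∈ insert p N := by
    intro p
    by_cases hpa : p = a
    · exact ⟨∅, {p}ᶜ, isOpen_empty, isOpen_compl_singleton, by simp, by simp, by simp [hpa],
        by simp [em]⟩
    by_cases hpb : p = b
    · exact ⟨{p}ᶜ, ∅, isOpen_compl_singleton, isOpen_empty, by simp, by simp, by simp [em],
        by simp [hpb]⟩
    obtain ⟨f, hf, hfab⟩ := hsep p hpa hpb
    have hop : ∀ c, IsOpen ({p}ᶜ ∩ f ⁻¹' {c}) := fun c =>
      hf.isOpen_inter_preimage isOpen_compl_singleton (isOpen_discrete _)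
    refine ⟨_, _, hop (f a), hop (f b), ?_, ?_, Or.inr ⟨Ne.symm hpa, rfl⟩,
      Or.inr ⟨Ne.symm hpb, rfl⟩⟩
    · rw [Set.disjoint_left]
      rintro x ⟨-, h1⟩ ⟨-, h2⟩
      exact hfab (h1.symm.trans h2)
    · rw [← inter_union_distrib_left, inter_eq_left]
      intro x _
      simp only [mem_union, mem_preimage, mem_singleton_iff]
      revert hfab
      cases f x <;> cases f a <;> cases f b <;> simp
  choose M N h1 h2 h3 h4 h5 h6 using hMN
  have hcut : CutSystem a b M N := ⟨h1, h2, h3, h4, h5, h6⟩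
  obtain ⟨F, hF, hmono⟩ := hcut.exists_continuous_strictMono
  have hle_a : ∀ p, F a ≤ F p := fun p => by
    rcases hcut.mem_left p with rfl | h
    · exact le_rfl
    · exact (hmono _ _ h).le
  have hle_b : ∀ p, F p ≤ F b := fun p => by
    rcases hcut.mem_right p with rfl | h
    · exact le_rfl
    · exact (hmono _ _ (hcut.mem_left_iff_mem_right.2 h)).le
  have hinj : Function.Injective F := fun p q hpq => by
    rcases hcut.trichotomy p q with h | h | h
    · exact h
    · exact ((hmono _ _ h).ne hpq).elim
    · exact ((hmono _ _ (hcut.mem_left_iff_mem_right.2 h)).ne hpq.symm).elim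
  have hlt : 0 < F b - F a := sub_pos.2 ((hle_a b).lt_of_ne fun h => hab (hinj h))
  have hcont : Continuous fun p => (F p - F a) / (F b - F a) := by fun_prop
  refine ⟨fun p => (F p - F a) / (F b - F a), hcont,
    fun p q hpq => hinj ?_, subset_antisymm ?_ ?_, by simp, div_self hlt.ne'⟩
  · have := (div_left_inj' hlt.ne').1 hpq
    linarith
  · rintro _ ⟨p, rfl⟩
    have := hle_a p
    have := hle_b p
    exact ⟨div_nonneg (by linarith) hlt.le, (div_le_one hlt).2 (by linarith)⟩
  · have := isPreconnected_univ.intermediate_value (mem_univ a) (mem_univ b) hcont.continuousOn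
    simpa [div_self hlt.ne'] using this

end Circle

section Circle

variable {X : Type*}

/-- A locally constant function on part of a connected set which is constant along the cut can be
extended by a constant, hence is constant. -/
theorem IsPreconnected.eq_const_of_cut [TopologicalSpace X] {s F G : Set X} (hs : IsPreconnected s)
    (hF : IsClosed F) (hG : IsClosed G) (hFG : s ⊆ F ∪ G) {f : X → Bool}
    (hf : ContinuousOn f (s ∩ F)) {c : Bool} (hc : ∀ x ∈ s ∩ (F ∩ G), f x = c)
    (hne : (s ∩ G).Nonempty) : ∀ x ∈ s ∩ F, f x = c := by
  classical
  have hG' : EqOn (fun x => if x ∈ F then f x else c) (fun _ => c) (s ∩ G) := by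
    intro x hx
    by_cases hxF : x ∈ F
    · simpa [hxF] using hc x ⟨hx.1, hxF, hx.2⟩
    · simp [hxF]
  have hcont : ContinuousOn (fun x => if x ∈ F then f x else c) s :=
    ContinuousOn.union_of_relatively_closed hF hG hFG
      (hf.congr fun x hx => if_pos hx.2) (continuousOn_const.congr hG')
  obtain ⟨y, hy⟩ := hne
  intro x hx
  have h1 := hs.constant hcont hx.1 hy.1
  rw [show (if y ∈ F then f y else c) = c from hG' hy] at h1
  simpa [hx.2] using h1

theorem exists_ne_of_not_isPreconnected [TopologicalSpace X] {s : Set X}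
    (hs : ¬ IsPreconnected s) :
    ∃ f : X → Bool, ContinuousOn f s ∧ ∃ x ∈ s, ∃ y ∈ s, f x ≠ f y := by
  by_contra! h
  exact hs (isPreconnected_of_forall_constant fun f hf x hx y hy => h f hf x hx y hy)

/-- In a continuum which is separated by any pair of points, but not by a single point, the
two pieces cut out by a pair of points are arcs. -/
theorem exists_arc_parametrization_of_cut_pairs [MetricSpace X] [CompactSpace X]
    [PreconnectedSpace X] (h1 : ∀ p : X, IsPreconnected ({p}ᶜ : Set X))
    (h2 : ∀ p q : X, p ≠ q → ¬ IsPreconnected ({p, q}ᶜ : Set X)) {a b : X} (hab : a ≠ b)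
    {I J : Set X} (hI : IsClosed I) (hJ : IsClosed J) (hIJ : I ∪ J = univ) (hcap : I ∩ J = {a, b})
    (hIne : (I \ J).Nonempty) (hJne : (J \ I).Nonempty) :
    ∃ h : X → ℝ, ContinuousOn h I ∧ InjOn h I ∧ h '' I = Icc 0 1 ∧ h a = 0 ∧ h b = 1 := by
  have haI : a ∈ I := (hcap.ge (Or.inl rfl)).1
  have hbI : b ∈ I := (hcap.ge (Or.inr rfl)).1
  have haJ : a ∈ J := (hcap.ge (Or.inl rfl)).2
  have hbJ : b ∈ J := (hcap.ge (Or.inr rfl)).2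
  have hcov : ∀ s : Set X, s ⊆ I ∪ J := fun s => by rw [hIJ]; exact subset_univ s
  have hcov' : ∀ s : Set X, s ⊆ J ∪ I := fun s => by rw [union_comm]; exact hcov s
  obtain ⟨p₀, hp₀I, hp₀J⟩ := hIne
  obtain ⟨q, hqJ, hqI⟩ := hJne
  have hIc : IsPreconnected I := by
    refine isPreconnected_of_forall_constant fun f hf => ?_
    have hfab : f a = f b := by
      have ha : f p₀ = f a := by
        refine (h1 b).eq_const_of_cut hI hJ (hcov _) (c := f a) (hf.mono inter_subset_right) ?_
          ⟨a, hab, haJ⟩ p₀ ⟨fun h => hp₀J (h ▸ hbJ), hp₀I⟩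
        rintro x ⟨hxb, hx⟩
        rcases hcap.le hx with rfl | rfl
        · rfl
        · exact (hxb rfl).elim
      have hb : f p₀ = f b := by
        refine (h1 a).eq_const_of_cut hI hJ (hcov _) (c := f b) (hf.mono inter_subset_right) ?_
          ⟨b, hab.symm, hbJ⟩ p₀ ⟨fun h => hp₀J (h ▸ haJ), hp₀I⟩
        rintro x ⟨hxa, hx⟩
        rcases hcap.le hx with rfl | rfl
        · exact (hxa rfl).elim
        · rfl
      exact ha.symm.trans hb
    have key : ∀ x ∈ univ ∩ I, f x = f a := by
      refine isPreconnected_univ.eq_const_of_cut hI hJ (hcov _) (hf.mono inter_subset_right) ?_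
        ⟨a, trivial, haJ⟩
      rintro x ⟨-, hx⟩
      rcases hcap.le hx with rfl | rfl
      · rfl
      · exact hfab.symm
    intro x hx y hy
    rw [key x ⟨trivial, hx⟩, key y ⟨trivial, hy⟩]
  have hsep : ∀ p ∈ I, p ≠ a → p ≠ b →
      ∃ f : X → Bool, ContinuousOn f (I \ {p}) ∧ f a ≠ f b := by
    intro p hpI hpa hpb
    have hpJ : p ∉ J := fun h => by
      rcases hcap.le ⟨hpI, h⟩ with rfl | rfl
      · exact hpa rfl
      · exact hpb rfl
    have hpq : p ≠ q := fun h => hqI (h ▸ hpI)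
    have hnot : ¬ IsPreconnected (I \ {p}) := by
      intro hpre
      refine h2 p q hpq (isPreconnected_of_forall_constant fun f hf => ?_)
      have hfI : ∀ x ∈ I \ {p}, f x = f a := fun x hx =>
        hpre.constant (hf.mono (by
          rintro y ⟨hyI, hyp⟩ (rfl | rfl)
          · exact hyp rfl
          · exact hqI hyI)) hx ⟨haI, Ne.symm hpa⟩
      have hfJ : ∀ x ∈ {q}ᶜ ∩ J, f x = f a := by
        refine (h1 q).eq_const_of_cut hJ hI (hcov' _) (hf.mono ?_) ?_
          ⟨a, fun h => hqI (h ▸ haI), haI⟩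
        · rintro x ⟨hxq, hxJ⟩ (rfl | rfl)
          · exact hpJ hxJ
          · exact hxq rfl
        · rintro x ⟨-, hxJ, hxI⟩
          exact hfI x ⟨hxI, fun h => hpJ (h ▸ hxJ)⟩
      have hf' : ∀ x ∈ ({p, q}ᶜ : Set X), f x = f a := by
        intro x hx
        rcases hcov univ (mem_univ x) with h | h
        · exact hfI x ⟨h, fun h' => hx (Or.inl h')⟩
        · exact hfJ x ⟨fun h' => hx (Or.inr h'), h⟩
      intro x hx y hy
      rw [hf' x hx, hf' y hy]
    obtain ⟨f, hf, x, hx, y, hy, hxy⟩ := exists_ne_of_not_isPreconnected hnot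
    refine ⟨f, hf, fun hfab => hxy ?_⟩
    have key : ∀ z ∈ {p}ᶜ ∩ I, f z = f a := by
      refine (h1 p).eq_const_of_cut hI hJ (hcov _) (hf.mono fun z hz => ⟨hz.2, hz.1⟩) ?_
        ⟨a, Ne.symm hpa, haJ⟩
      rintro z ⟨-, hz⟩
      rcases hcap.le hz with rfl | rfl
      · rfl
      · exact hfab.symm
    rw [key x ⟨hx.2, hx.1⟩, key y ⟨hy.2, hy.1⟩]
  have : PreconnectedSpace I := Subtype.preconnectedSpace hIc
  have : CompactSpace I := isCompact_iff_compactSpace.1 hI.isCompact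
  obtain ⟨h, hc, hinj, hrange, h0, h1'⟩ := exists_arc_parametrization (X := I)
    (a := ⟨a, haI⟩) (b := ⟨b, hbI⟩) (fun h => hab (congrArg Subtype.val h)) (fun p hpa hpb => by
      obtain ⟨f, hf, hfab⟩ := hsep p p.2 (fun h => hpa (Subtype.ext h))
        (fun h => hpb (Subtype.ext h))
      exact ⟨fun x => f x, hf.comp continuous_subtype_val.continuousOn
        fun x hx => ⟨x.2, fun h => hx (Subtype.ext h)⟩, hfab⟩)
  classical
  have hext : ∀ x : I, (fun x => if hx : x ∈ I then h ⟨x, hx⟩ else 0) (x : X) = h x := fun x => by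
    simp
  refine ⟨fun x => if hx : x ∈ I then h ⟨x, hx⟩ else 0, ?_, ?_, ?_, ?_, ?_⟩
  · rw [continuousOn_iff_continuous_domRestrict]
    convert! hc using 1
    ext x
    exact hext x
  · intro x hx y hy hxy
    have := (hext ⟨x, hx⟩).symm.trans (hxy.trans (hext ⟨y, hy⟩))
    exact congrArg Subtype.val (hinj this)
  · rw [← hrange]
    ext t
    constructor
    · rintro ⟨x, hx, rfl⟩
      exact ⟨⟨x, hx⟩, (hext ⟨x, hx⟩).symm⟩
    · rintro ⟨x, rfl⟩
      exact ⟨x, x.2, hext x⟩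
  · simpa [haI] using h0
  · simpa [hbI] using h1'

theorem Complex.exp_pi_mul_I_injOn {s t : ℝ} (hs : s ∈ Ioc (-1 : ℝ) 1) (ht : t ∈ Ioc (-1 : ℝ) 1)
    (h : Complex.exp ((s * Real.pi : ℝ) * Complex.I) = Complex.exp ((t * Real.pi : ℝ) * Complex.I)) :
    s = t := by
  have hpi := Real.pi_pos
  have key : ∀ u ∈ Ioc (-1 : ℝ) 1,
      Complex.arg (Complex.exp ((u * Real.pi : ℝ) * Complex.I)) = u * Real.pi := fun u hu => by
    rw [Complex.arg_exp_mul_I, toIocMod_eq_self]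
    exact ⟨by nlinarith [hu.1], by nlinarith [hu.2]⟩
  have := congrArg Complex.arg h
  rw [key s hs, key t ht] at this
  exact mul_right_cancel₀ hpi.ne' this

/-- R. L. Moore's characterization of the circle: a continuum which is separated by any pair of
points, but not by a single point, is homeomorphic to the circle. -/
theorem nonempty_homeomorph_circle_of_cut_pairs [MetricSpace X] [CompactSpace X]
    [PreconnectedSpace X] [Nontrivial X] (h1 : ∀ p : X, IsPreconnected ({p}ᶜ : Set X))
    (h2 : ∀ p q : X, p ≠ q → ¬ IsPreconnected ({p, q}ᶜ : Set X)) :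
    Nonempty (X ≃ₜ Metric.sphere (0 : ℂ) 1) := by
  classical
  obtain ⟨a, b, hab⟩ := exists_pair_ne X
  obtain ⟨f, hf, x, hx, y, hy, hxy⟩ := exists_ne_of_not_isPreconnected (h2 a b hab)
  have hclosed : ∀ c : Bool, IsClosed ({a, b} ∪ {z | f z = c}) := by
    intro c
    have hop : IsOpen ({a, b}ᶜ ∩ f ⁻¹' {!c}) :=
      hf.isOpen_inter_preimage (Set.toFinite _).isClosed.isOpen_compl (isOpen_discrete _)
    convert! hop.isClosed_compl using 1
    ext z
    simp only [mem_union, mem_ofPred_eq, mem_compl_iff, mem_inter_iff, mem_preimage,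
      mem_singleton_iff, not_and]
    cases f z <;> cases c <;> simp <;> tauto
  set I := {a, b} ∪ {z | f z = f x} with hIdef
  set J := {a, b} ∪ {z | f z = f y} with hJdef
  have hIJ : I ∪ J = univ := by
    refine eq_univ_of_forall fun z => ?_
    have : f z = f x ∨ f z = f y := by
      revert hxy
      cases f x <;> cases f y <;> cases f z <;> simp
    rcases this with h | h
    · exact Or.inl (Or.inr h)
    · exact Or.inr (Or.inr h)
  have hcap : I ∩ J = {a, b} := by
    rw [hIdef, hJdef, ← union_inter_distrib_left, union_eq_left]
    rintro z ⟨hz, hz'⟩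
    exact (hxy (hz.symm.trans hz')).elim
  have hxI : x ∈ I \ J := ⟨Or.inr rfl, by rintro (h | h); exacts [hx h, hxy h]⟩
  have hyJ : y ∈ J \ I := ⟨Or.inr rfl, by rintro (h | h); exacts [hy h, hxy h.symm]⟩
  obtain ⟨h, hc, hinj, himg, ha, hb⟩ := exists_arc_parametrization_of_cut_pairs h1 h2 hab
    (hclosed _) (hclosed _) hIJ hcap ⟨x, hxI⟩ ⟨y, hyJ⟩
  obtain ⟨k, kc, kinj, kimg, ka, kb⟩ := exists_arc_parametrization_of_cut_pairs h1 h2 hab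
    (hclosed _) (hclosed _) (by rwa [union_comm]) (by rwa [inter_comm]) ⟨y, hyJ⟩ ⟨x, hxI⟩
  let E : ℝ → ℂ := fun t => Complex.exp ((t * Real.pi : ℝ) * Complex.I)
  have hE : Continuous E := by fun_prop
  let Φ : X → ℂ := fun z => if z ∈ I then E (h z) else E (-k z)
  have hΦI : ∀ z ∈ I, Φ z = E (h z) := fun z hz => if_pos hz
  have hΦJ : ∀ z ∈ J, Φ z = E (-k z) := fun z hz => by
    by_cases hzI : z ∈ I
    · rw [hΦI z hzI]
      rcases hcap.le ⟨hzI, hz⟩ with rfl | rfl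
      · rw [ha, ka, neg_zero]
      · rw [hb, kb]
        simp [E, Complex.exp_neg]
    · exact if_neg hzI
  have hΦc : Continuous Φ := by
    rw [← continuousOn_univ]
    refine ContinuousOn.union_of_relatively_closed (hclosed (f x)) (hclosed (f y)) hIJ.ge ?_ ?_
    · exact (hE.comp_continuousOn (hc.mono inter_subset_right)).congr fun z hz => hΦI z hz.2
    · exact (hE.comp_continuousOn (kc.mono inter_subset_right).neg).congr fun z hz => hΦJ z hz.2
  have hhI : ∀ z ∈ I, h z ∈ Icc (0 : ℝ) 1 := fun z hz => himg.le (mem_image_of_mem h hz)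
  have hkJ : ∀ z ∈ J, k z ∈ Icc (0 : ℝ) 1 := fun z hz => kimg.le (mem_image_of_mem k hz)
  have hkJ' : ∀ z ∈ J \ I, k z ∈ Ioo (0 : ℝ) 1 := fun z hz => by
    have haJ : a ∈ J := Or.inl (Or.inl rfl)
    have hbJ : b ∈ J := Or.inl (Or.inr rfl)
    have h3 := hkJ z hz.1
    refine ⟨h3.1.lt_of_ne fun h0 => hz.2 ?_, h3.2.lt_of_ne fun h0 => hz.2 ?_⟩
    · rw [kinj hz.1 haJ (h0.symm.trans ka.symm)]
      exact Or.inl (Or.inl rfl)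
    · rw [kinj hz.1 hbJ (h0.trans kb.symm)]
      exact Or.inl (Or.inr rfl)
  have hJ_of : ∀ z, z ∉ I → z ∈ J \ I := fun z hz => ⟨(hIJ.ge (mem_univ z)).resolve_left hz, hz⟩
  have hmixed : ∀ z ∈ I, ∀ w ∉ I, Φ z ≠ Φ w := by
    intro z hz w hw hzw
    rw [hΦI z hz, hΦJ w (hJ_of w hw).1] at hzw
    have h3 := hhI z hz
    have h4 := hkJ' w (hJ_of w hw)
    have := Complex.exp_pi_mul_I_injOn ⟨by linarith [h3.1], h3.2⟩
      ⟨by linarith [h4.2], by linarith [h4.1]⟩ hzw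
    linarith [h3.1, h4.1]
  have hΦinj : Function.Injective Φ := by
    intro z w hzw
    by_cases hz : z ∈ I <;> by_cases hw : w ∈ I
    · rw [hΦI z hz, hΦI w hw] at hzw
      have h3 := hhI z hz
      have h4 := hhI w hw
      exact hinj hz hw (Complex.exp_pi_mul_I_injOn ⟨by linarith [h3.1], h3.2⟩
        ⟨by linarith [h4.1], h4.2⟩ hzw)
    · exact (hmixed z hz w hw hzw).elim
    · exact (hmixed w hw z hz hzw.symm).elim
    · rw [hΦJ z (hJ_of z hz).1, hΦJ w (hJ_of w hw).1] at hzw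
      have h3 := hkJ' z (hJ_of z hz)
      have h4 := hkJ' w (hJ_of w hw)
      have := Complex.exp_pi_mul_I_injOn ⟨by linarith [h3.2], by linarith [h3.1]⟩
        ⟨by linarith [h4.2], by linarith [h4.1]⟩ hzw
      exact kinj (hJ_of z hz).1 (hJ_of w hw).1 (neg_inj.1 this)
  have hΦs : ∀ z, Φ z ∈ Metric.sphere (0 : ℂ) 1 := fun z => by
    rw [mem_sphere_zero_iff_norm]
    simp only [Φ, E]
    split_ifs <;> exact Complex.norm_exp_ofReal_mul_I _
  have hsurj : ∀ w ∈ Metric.sphere (0 : ℂ) 1, ∃ z, Φ z = w := by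
    intro w hw
    have hw1 : ‖w‖ = 1 := by simpa using hw
    have hw2 : E (w.arg / Real.pi) = w := by
      have := Complex.norm_mul_exp_arg_mul_I w
      rw [hw1, Complex.ofReal_one, one_mul] at this
      simp only [E]
      rwa [div_mul_cancel₀ _ Real.pi_ne_zero]
    have hle : w.arg / Real.pi ≤ 1 := (div_le_one Real.pi_pos).2 (Complex.arg_le_pi w)
    have hge : -1 ≤ w.arg / Real.pi := by
      rw [le_div_iff₀ Real.pi_pos]
      linarith [Complex.neg_pi_lt_arg w]
    rcases le_total 0 (w.arg / Real.pi) with h0 | h0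
    · obtain ⟨z, hz, hzw⟩ := himg.ge ⟨h0, hle⟩
      exact ⟨z, by rw [hΦI z hz, hzw, hw2]⟩
    · obtain ⟨z, hz, hzw⟩ := kimg.ge (show -(w.arg / Real.pi) ∈ Icc (0 : ℝ) 1 from
        ⟨by linarith, by linarith⟩)
      exact ⟨z, by rw [hΦJ z hz, hzw, neg_neg, hw2]⟩
  let e : X ≃ Metric.sphere (0 : ℂ) 1 := Equiv.ofBijective (fun z => ⟨Φ z, hΦs z⟩)
    ⟨fun z w hzw => hΦinj (congrArg Subtype.val hzw), fun w => by
      obtain ⟨z, hz⟩ := hsurj w w.2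
      exact ⟨z, Subtype.ext hz⟩⟩
  exact ⟨Continuous.homeoOfEquivCompactToT2 (f := e) (hΦc.subtype_mk _)⟩

theorem nonempty_homeomorph_complex_circle_euclidean_circle :
    Nonempty (Metric.sphere (0 : ℂ) 1 ≃ₜ Metric.sphere (0 : EuclideanSpace ℝ (Fin 2)) 1) :=
  ⟨Complex.orthonormalBasisOneI.repr.toHomeomorph.subtype fun z => by simp⟩

end Circle

section PlaneChart

variable {S : Type*} [TopologicalSpace S]

/-- Planar coordinates on the complement of a point. -/
structure PlaneChart (q : S) where
  /-- The coordinate, meaningful away from `q`. -/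
  coord : S → ℂ
  /-- The point with given coordinate. -/
  point : ℂ → S
  point_ne : ∀ w, point w ≠ q
  point_coord : ∀ z, z ≠ q → point (coord z) = z
  coord_point : ∀ w, coord (point w) = w
  continuousOn_coord : ContinuousOn coord {q}ᶜ
  continuous_point : Continuous point

theorem Topology.IsOpenEmbedding.nonempty_planeChart {q : S} {ψ : ℂ → S} (hψ : IsOpenEmbedding ψ)
    (hr : range ψ = {q}ᶜ) : Nonempty (PlaneChart q) := by
  let e := hψ.toOpenPartialHomeomorph ψ
  have ht : e.target = {q}ᶜ := by simp [e, hr]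
  refine ⟨⟨e.symm, ψ, fun w => ?_, fun z hz => ?_, fun w => ?_, ?_, hψ.continuous⟩⟩
  · have : ψ w ∈ ({q}ᶜ : Set S) := hr ▸ mem_range_self w
    exact this
  · exact e.right_inv (by rw [ht]; exact hz)
  · exact e.left_inv (by simp [e])
  · rw [← ht]; exact e.continuousOn_symm

theorem nonempty_planeChart (h : S ≃ₜ Metric.sphere (0 : EuclideanSpace ℝ (Fin 3)) 1) (q : S) :
    Nonempty (PlaneChart q) := by
  have hv : ‖(h q : EuclideanSpace ℝ (Fin 3))‖ = 1 := by simp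
  have hv₀ : (h q : EuclideanSpace ℝ (Fin 3)) ≠ 0 := fun h0 => by simp [h0] at hv
  have : Fact (Module.finrank ℝ (EuclideanSpace ℝ (Fin 3)) = 2 + 1) := ⟨by simp⟩
  have hV : Module.finrank ℝ ℂ =
      Module.finrank ℝ (ℝ ∙ (h q : EuclideanSpace ℝ (Fin 3)))ᗮ := by
    rw [Complex.finrank_real_complex]
    exact (Submodule.finrank_orthogonal_span_singleton hv₀).symm
  obtain ⟨e⟩ := FiniteDimensional.nonempty_continuousLinearEquiv_of_finrank_eq hV
  refine IsOpenEmbedding.nonempty_planeChart (ψ := h.symm ∘ (stereographic hv).symm ∘ e)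
    (h.symm.isOpenEmbedding.comp
      ((isOpenEmbedding_stereographic_symm hv).comp e.toHomeomorph.isOpenEmbedding)) ?_
  rw [range_comp, range_comp, e.surjective.range_eq, image_univ, range_stereographic_symm hv,
    image_compl_eq h.symm.bijective, image_singleton]
  simp

namespace PlaneChart

variable {q : S} (c : PlaneChart q)

theorem range_point : range c.point = {q}ᶜ :=
  Subset.antisymm (range_subset_iff.2 c.point_ne) fun z hz => ⟨c.coord z, c.point_coord z hz⟩

theorem injOn_coord : InjOn c.coord {q}ᶜ := fun z hz w hw h => by
  rw [← c.point_coord z hz, h, c.point_coord w hw]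

theorem isPreconnected_compl_singleton (c : PlaneChart q) : IsPreconnected ({q}ᶜ : Set S) := by
  rw [← c.range_point]; exact isPreconnected_range c.continuous_point

theorem eventually_lt_norm [T2Space S] (R : ℝ) : ∀ᶠ z in 𝓝 q, z ≠ q → R < ‖c.coord z‖ := by
  have hK : IsCompact (c.point '' Metric.closedBall 0 R) :=
    (isCompact_closedBall 0 R).image c.continuous_point
  have hq : q ∉ c.point '' Metric.closedBall 0 R := by
    rintro ⟨w, -, hw⟩; exact c.point_ne w hw
  filter_upwards [hK.isClosed.isOpen_compl.mem_nhds hq] with z hz hzq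
  by_contra! hR
  exact hz ⟨c.coord z, by simp [hR], c.point_coord z hzq⟩

theorem isPreconnected_preimage {s : Set S} (hq : q ∉ s) (hs : IsPreconnected s) :
    IsPreconnected (c.point ⁻¹' s) := by
  have : c.point ⁻¹' s = c.coord '' s := by
    ext w
    constructor
    · exact fun hw => ⟨_, hw, c.coord_point w⟩
    · rintro ⟨z, hz, rfl⟩
      rw [mem_preimage, c.point_coord z fun h => hq (h ▸ hz)]; exact hz
  rw [this]
  exact hs.image _ (c.continuousOn_coord.mono fun z hz hzq => hq (hzq ▸ hz))

end PlaneChart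

end PlaneChart

section Geodesic

variable {S : Type*} [MetricSpace S]

theorem IsGeodesicSpace.exists_segment (hgeo : IsGeodesicSpace S) (z x : S) :
    ∃ γ : C(unitInterval, S), γ 0 = z ∧ γ 1 = x ∧
      ∀ t : unitInterval, dist z (γ t) = t * dist z x ∧ dist z (γ t) + dist (γ t) x = dist z x := by
  obtain ⟨γ, h0, h1, hγ⟩ := hgeo z x
  have hd : (0 : ℝ) ≤ dist z x := dist_nonneg
  have hm : ∀ t : unitInterval, (t : ℝ) * dist z x ∈ Icc (0 : ℝ) (dist z x) := fun t =>
    ⟨mul_nonneg t.2.1 hd, mul_le_of_le_one_left hd t.2.2⟩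
  have hl : ∀ t : unitInterval, dist z (γ (t * dist z x)) = t * dist z x := fun t => by
    rw [← congrArg (fun p => dist p (γ (t * dist z x))) h0]
    rw [hγ 0 (left_mem_Icc.2 hd) _ (hm t), zero_sub, abs_neg, abs_of_nonneg (hm t).1]
  have hr : ∀ t : unitInterval, dist (γ (t * dist z x)) x = dist z x - t * dist z x := fun t => by
    rw [← congrArg (fun p => dist (γ (t * dist z x)) p) h1]
    rw [hγ _ (hm t) _ (right_mem_Icc.2 hd), abs_sub_comm, abs_of_nonneg (sub_nonneg.2 (hm t).2)]
  have hc : ContinuousOn γ (Icc 0 (dist z x)) := by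
    refine LipschitzOnWith.continuousOn (K := 1) (LipschitzOnWith.of_dist_le_mul ?_)
    intro s hs t ht
    rw [hγ s hs t ht, NNReal.coe_one, one_mul, Real.dist_eq]
  refine ⟨⟨fun t => γ (t * dist z x), hc.comp_continuous (by fun_prop) hm⟩, by simp [h0],
    by simp [h1], fun t => ⟨hl t, ?_⟩⟩
  simp only [ContinuousMap.coe_mk]
  rw [hl, hr]; ring

theorem IsGeodesicSpace.exists_isPreconnected_segment (hgeo : IsGeodesicSpace S) (z x : S) :
    ∃ T : Set S, IsCompact T ∧ IsPreconnected T ∧ z ∈ T ∧ x ∈ T ∧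
      ∀ w ∈ T, dist z w + dist w x = dist z x := by
  obtain ⟨γ, h0, h1, hγ⟩ := hgeo.exists_segment z x
  refine ⟨range γ, isCompact_range γ.continuous, isPreconnected_range γ.continuous, ⟨0, h0⟩,
    ⟨1, h1⟩, ?_⟩
  rintro _ ⟨t, rfl⟩
  exact (hγ t).2

theorem IsGeodesicSpace.closure_ball (hgeo : IsGeodesicSpace S) (x : S) {r : ℝ} (hr : 0 < r) :
    closure (Metric.ball x r) = Metric.closedBall x r := by
  refine Metric.closure_ball_subset_closedBall.antisymm fun z hz => ?_
  rw [Metric.mem_closedBall] at hz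
  refine Metric.mem_closure_iff.2 fun ε hε => ?_
  obtain ⟨γ, -, -, hγ⟩ := hgeo.exists_segment z x
  rcases hz.lt_or_eq with h | h
  · exact ⟨z, h, by simpa using hε⟩
  have ht : min 1 (ε / (2 * r)) ∈ unitInterval := ⟨by positivity, min_le_left _ _⟩
  obtain ⟨h1, h2⟩ := hγ ⟨_, ht⟩
  have hpos : 0 < min 1 (ε / (2 * r)) * r := by positivity
  have hle : min 1 (ε / (2 * r)) * r ≤ ε / (2 * r) * r :=
    mul_le_mul_of_nonneg_right (min_le_right _ _) hr.le
  have : ε / (2 * r) * r = ε / 2 := by field_simp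
  rw [h] at h1 h2
  refine ⟨γ ⟨_, ht⟩, ?_, ?_⟩
  · rw [Metric.mem_ball]; linarith
  · rw [h1]; linarith

theorem IsGeodesicSpace.isPathConnected_ball (hgeo : IsGeodesicSpace S) (x : S) {r : ℝ}
    (hr : 0 < r) : IsPathConnected (Metric.ball x r) := by
  refine ⟨x, Metric.mem_ball_self hr, fun {z} hz => ?_⟩
  obtain ⟨γ, h0, h1, hγ⟩ := hgeo.exists_segment x z
  refine ⟨⟨γ, h0, h1⟩, fun t => ?_⟩
  have := (hγ t).2
  have h : dist (γ t) z ≥ 0 := dist_nonneg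
  rw [Metric.mem_ball, dist_comm] at hz ⊢
  exact lt_of_le_of_lt (by simp; linarith) hz

theorem IsGeodesicSpace.locallyPathConnectedSpace (hgeo : IsGeodesicSpace S) :
    LocallyPathConnectedSpace S :=
  LocallyPathConnectedSpace.of_bases (fun _ => Metric.nhds_basis_ball) fun x _ hr =>
    hgeo.isPathConnected_ball x hr

theorem IsGeodesicSpace.isPreconnected_closedBall (hgeo : IsGeodesicSpace S) (x : S) (r : ℝ) :
    IsPreconnected (Metric.closedBall x r) := by
  refine isPreconnected_of_forall x fun z hz => ?_
  obtain ⟨T, -, hT, hzT, hxT, h⟩ := hgeo.exists_isPreconnected_segment z x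
  refine ⟨T, fun w hw => ?_, hxT, hzT, hT⟩
  rw [Metric.mem_closedBall] at hz ⊢
  linarith [h w hw, dist_nonneg (x := z) (y := w)]

/-- `U` is a connected component of the complement of the closed ball of radius `r` at `x`. -/
structure IsOuterComponent (x : S) (r : ℝ) (U : Set S) : Prop where
  isOpen : IsOpen U
  isPreconnected : IsPreconnected U
  nonempty : U.Nonempty
  lt_dist : ∀ z ∈ U, r < dist z x
  subset_of_meets : ∀ T : Set S, IsPreconnected T → (∀ z ∈ T, r < dist z x) →
    (T ∩ U).Nonempty → T ⊆ U

theorem IsGeodesicSpace.isOuterComponent (hgeo : IsGeodesicSpace S) {x y : S} {r : ℝ}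
    (hy : r < dist y x) :
    IsOuterComponent x r (connectedComponentIn {z | r < dist z x} y) where
  isOpen := by
    have := hgeo.locallyPathConnectedSpace
    exact (isOpen_lt continuous_const (by fun_prop)).connectedComponentIn
  isPreconnected := isPreconnected_connectedComponentIn
  nonempty := ⟨y, mem_connectedComponentIn hy⟩
  lt_dist := fun _ hz => (connectedComponentIn_subset {z | r < dist z x} y) hz
  subset_of_meets := by
    rintro T hT hD ⟨z, hzT, hz⟩
    rw [connectedComponentIn_eq hz]
    exact hT.subset_connectedComponentIn hzT hD

namespace IsOuterComponent

variable {x : S} {r : ℝ} {U : Set S}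

theorem frontier_eq (hU : IsOuterComponent x r U) : frontier U = closure U \ U :=
  hU.isOpen.frontier_eq

theorem le_dist (hU : IsOuterComponent x r U) {z : S} (hz : z ∈ closure U) : r ≤ dist z x := by
  have : closure U ⊆ {z | r ≤ dist z x} :=
    closure_minimal (fun z hz => (hU.lt_dist z hz).le)
      (isClosed_le continuous_const (by fun_prop))
  exact this hz

theorem dist_eq (hU : IsOuterComponent x r U) (hgeo : IsGeodesicSpace S) {c : S}
    (hc : c ∈ frontier U) : dist c x = r := by
  rw [hU.frontier_eq] at hc
  have h1 : r ≤ dist c x := hU.le_dist hc.1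
  refine (h1.lt_or_eq.resolve_left fun h => hc.2 ?_).symm
  have hpos : 0 < dist c x - r := sub_pos.2 h
  refine hU.subset_of_meets (Metric.ball c (dist c x - r))
    (hgeo.isPathConnected_ball c hpos).isConnected.isPreconnected (fun z hz => ?_) ?_
    (Metric.mem_ball_self hpos)
  · rw [Metric.mem_ball, dist_comm] at hz
    linarith [dist_triangle c z x]
  · obtain ⟨z, hz, hcz⟩ := Metric.mem_closure_iff.1 hc.1 _ hpos
    exact ⟨z, by rwa [Metric.mem_ball, dist_comm], hz⟩

theorem notMem_of_between (hU : IsOuterComponent x r U) (hgeo : IsGeodesicSpace S) {z' z : S}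
    (hz' : z' ∉ U) (h : dist z' z + dist z x = dist z' x) : z ∉ U := fun hz => by
  obtain ⟨T, -, hT, hz'T, hzT, hw⟩ := hgeo.exists_isPreconnected_segment z' z
  refine hz' (hU.subset_of_meets T hT (fun w hwT => ?_) ⟨z, hzT, hz⟩ hz'T)
  linarith [hU.lt_dist z hz, hw w hwT, dist_triangle z' w x, dist_nonneg (x := w) (y := z)]

theorem center_notMem (hU : IsOuterComponent x r U) (hr : 0 ≤ r) : x ∉ U := fun h => by
  have := hU.lt_dist x h
  rw [dist_self] at this
  linarith

end IsOuterComponent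

theorem exists_ne_mem_frontier {W : Set S} {a x : S} (ha : IsPreconnected ({a}ᶜ : Set S))
    (hW : IsOpen W) (hne : W.Nonempty) (haW : a ∉ W) (hxW : x ∉ W) (hxa : x ≠ a) :
    ∃ w ∈ frontier W, w ≠ a := by
  by_contra! h
  have hsub : ({a}ᶜ : Set S) ⊆ W := by
    refine ha.subset_of_closure_inter_subset hW ?_ ?_
    · obtain ⟨w, hw⟩ := hne
      exact ⟨w, fun hwa => haW (hwa ▸ hw), hw⟩
    · rintro w ⟨hw, hwa⟩
      by_contra hwW
      exact hwa (h w (by rw [hW.frontier_eq]; exact ⟨hw, hwW⟩))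
  exact hxW (hsub hxa)

/-- Away from a boundary point `a` of `U`, each point of the complement of `U` has a neighborhood
in this complement that extends to a compact connected set reaching the center and avoiding `a`. -/
theorem IsOuterComponent.exists_isCompact_isPreconnected_mem_nhdsWithin [CompactSpace S]
    {x : S} {r : ℝ} {U : Set S} (hU : IsOuterComponent x r U) (hgeo : IsGeodesicSpace S)
    (hr : 0 < r) {a c : S} (hpre : IsPreconnected ({a}ᶜ : Set S)) (ha : a ∈ frontier U)
    (hc : c ∉ U) (hca : c ≠ a) :
    ∃ T ⊆ Uᶜ \ {a}, IsCompact T ∧ IsPreconnected T ∧ x ∈ T ∧ T ∈ 𝓝[Uᶜ \ {a}] c := by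
  have har : dist a x = r := hU.dist_eq hgeo ha
  have hca' : 0 < dist c a := dist_pos.2 hca
  rcases le_or_gt (dist c x) r with hcr | hcr
  · set K : Set S := Metric.closedBall c (dist c a / 3) \ U with hK
    have hKc : IsCompact K := (Metric.isClosed_closedBall.isCompact).diff hU.isOpen
    have hcK : c ∈ K := ⟨Metric.mem_closedBall_self (by positivity), hc⟩
    have hPc : IsCompact {p : S × S | p.1 ∈ K ∧ dist p.1 p.2 + dist p.2 x = dist p.1 x} :=
      ((hKc.isClosed.preimage continuous_fst).inter
        (isClosed_eq (f := fun p : S × S => dist p.1 p.2 + dist p.2 x)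
          (g := fun p : S × S => dist p.1 x) (by fun_prop) (by fun_prop))).isCompact
    have hTeq : Prod.snd '' {p : S × S | p.1 ∈ K ∧ dist p.1 p.2 + dist p.2 x = dist p.1 x} =
        {z | ∃ y ∈ K, dist y z + dist z x = dist y x} := by
      ext z
      constructor
      · rintro ⟨p, ⟨h1, h2⟩, rfl⟩
        exact ⟨p.1, h1, h2⟩
      · rintro ⟨y, h1, h2⟩
        exact ⟨(y, z), ⟨h1, h2⟩, rfl⟩
    have hxT : x ∈ {z | ∃ y ∈ K, dist y z + dist z x = dist y x} := ⟨c, hcK, by simp⟩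
    refine ⟨{z | ∃ y ∈ K, dist y z + dist z x = dist y x}, ?_, hTeq ▸ hPc.image continuous_snd,
      ?_, hxT, ?_⟩
    · rintro z ⟨y, hy, hyz⟩
      refine ⟨hU.notMem_of_between hgeo hy.2 hyz, ?_⟩
      rintro rfl
      have h1 : dist y c ≤ dist c z / 3 := hy.1
      linarith [dist_triangle y c x, dist_triangle c y z, dist_comm c y]
    · refine isPreconnected_of_forall x fun z hz => ?_
      obtain ⟨y, hy, hyz⟩ := hz
      obtain ⟨T, -, hT, hzT, hxT', hw⟩ := hgeo.exists_isPreconnected_segment z x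
      refine ⟨T, fun w hwT => ⟨y, hy, ?_⟩, hxT', hzT, hT⟩
      linarith [hw w hwT, dist_triangle y z w, dist_triangle y w x]
    · have : Metric.closedBall c (dist c a / 3) ∩ Uᶜ ∈ 𝓝[Uᶜ \ {a}] c :=
        inter_mem (mem_nhdsWithin_of_mem_nhds (Metric.closedBall_mem_nhds c (by positivity)))
          (mem_of_superset self_mem_nhdsWithin sdiff_subset)
      exact mem_of_superset this fun z hz => ⟨z, hz, by simp⟩
  · have hW := hgeo.isOuterComponent hcr
    have hcW : c ∈ connectedComponentIn {z | r < dist z x} c := mem_connectedComponentIn hcr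
    set W := connectedComponentIn {z | r < dist z x} c
    have hWU : ∀ z ∈ W, z ∉ U := fun z hzW hzU =>
      hc (hU.subset_of_meets W hW.isPreconnected hW.lt_dist ⟨z, hzW, hzU⟩ hcW)
    have haW : a ∉ W := fun h => by linarith [hW.lt_dist a h]
    have hxa : x ≠ a := by rintro rfl; rw [dist_self] at har; linarith
    obtain ⟨w, hw, hwa⟩ := exists_ne_mem_frontier hpre hW.isOpen hW.nonempty haW
      (hW.center_notMem hr.le) hxa
    have hwr := hW.dist_eq hgeo hw
    have hwcl : w ∈ closure W := frontier_subset_closure hw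
    have hwa' : 0 < dist w a / 2 := half_pos (dist_pos.2 hwa)
    obtain ⟨c', hc'W, hc'w⟩ := Metric.mem_closure_iff.1 hwcl _ hwa'
    have := hgeo.locallyPathConnectedSpace
    have hWpath : IsPathConnected W :=
      hW.isOpen.isConnected_iff_isPathConnected.1 ⟨hW.nonempty, hW.isPreconnected⟩
    obtain ⟨γ, hγ⟩ := hWpath.joinedIn c hcW c' hc'W
    obtain ⟨T, hTc, hT, hc'T, hxT, hTw⟩ := hgeo.exists_isPreconnected_segment c' x
    obtain ⟨ε, hε, hεW⟩ := Metric.nhds_basis_closedBall.mem_iff.1 (hW.isOpen.mem_nhds hcW)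
    have hcγ : c ∈ range γ := ⟨0, γ.source⟩
    have hc'γ : c' ∈ range γ := ⟨1, γ.target⟩
    have hBW : Metric.closedBall c ε ∪ range γ ⊆ W :=
      union_subset hεW (range_subset_iff.2 hγ)
    refine ⟨Metric.closedBall c ε ∪ range γ ∪ T, ?_, ?_, ?_, Or.inr hxT, ?_⟩
    · refine union_subset (fun z hz => ⟨hWU z (hBW hz), ?_⟩) fun z hz =>
        ⟨hU.notMem_of_between hgeo (hWU c' hc'W) (hTw z hz), ?_⟩
      · rintro rfl; exact haW (hBW hz)
      · rintro rfl
        linarith [hTw z hz, dist_triangle c' w x, dist_triangle w c' z, dist_comm w c']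
    · exact ((Metric.isClosed_closedBall.isCompact).union (isCompact_range γ.continuous)).union hTc
    · exact ((hgeo.isPreconnected_closedBall c ε).union c (Metric.mem_closedBall_self hε.le) hcγ
        (isPreconnected_range γ.continuous)).union c' (Or.inr hc'γ) hc'T hT
    · exact mem_of_superset (mem_nhdsWithin_of_mem_nhds (Metric.closedBall_mem_nhds c hε))
        fun z hz => Or.inl (Or.inl hz)

theorem IsOuterComponent.isPreconnected_compl_diff_singleton [CompactSpace S]
    {x : S} {r : ℝ} {U : Set S} (hU : IsOuterComponent x r U) (hgeo : IsGeodesicSpace S)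
    (hr : 0 < r) {a : S} (hpre : IsPreconnected ({a}ᶜ : Set S)) (ha : a ∈ frontier U) :
    IsPreconnected (Uᶜ \ {a}) := by
  refine isPreconnected_of_forall x fun c hc => ?_
  obtain ⟨T, hTs, -, hT, hxT, hTc⟩ :=
    hU.exists_isCompact_isPreconnected_mem_nhdsWithin hgeo hr hpre ha hc.1 hc.2
  exact ⟨T, hTs, hxT, mem_of_mem_nhdsWithin hc hTc, hT⟩

end Geodesic

section Frontier

variable {S : Type*} [MetricSpace S] {q : S}

namespace PlaneChart

theorem eventually_hasLogOn_iff (c : PlaneChart q) {T : Set S} (hT : IsCompact T) (hq : q ∉ T)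
    {a : S} (haq : a ≠ q) (haT : a ∉ T) :
    ∀ᶠ u in 𝓝 a, u ≠ q ∧ (HasLogOn (fun z => c.coord z - c.coord a) T ↔
      HasLogOn (fun z => c.coord z - c.coord u) T) := by
  have hTq : T ⊆ {q}ᶜ := fun z hz hzq => hq (hzq ▸ hz)
  have hf : ContinuousOn c.coord T := c.continuousOn_coord.mono hTq
  have hclosed : IsClosed (c.coord '' T) := (hT.image_of_continuousOn hf).isClosed
  have ha : c.coord a ∉ c.coord '' T := by
    rintro ⟨z, hz, hza⟩
    exact haT (c.injOn_coord (hTq hz) haq hza ▸ hz)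
  obtain ⟨δ, hδ, hball⟩ := Metric.nhds_basis_ball.mem_iff.1 (hclosed.isOpen_compl.mem_nhds ha)
  have hca : ContinuousAt c.coord a :=
    c.continuousOn_coord.continuousAt (isOpen_compl_singleton.mem_nhds haq)
  filter_upwards [isOpen_compl_singleton.mem_nhds haq, hca (Metric.ball_mem_nhds _ hδ)]
    with u hu hua
  refine ⟨hu, hasLogOn_sub_iff_of_norm_lt hf fun z hz => ?_⟩
  have hδz : δ ≤ ‖c.coord z - c.coord a‖ := by
    by_contra! h
    exact hball (show c.coord z ∈ Metric.ball (c.coord a) δ by rwa [Metric.mem_ball, dist_eq_norm])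
      ⟨z, hz, rfl⟩
  rw [mem_preimage, Metric.mem_ball, dist_eq_norm] at hua
  exact hua.trans_le hδz

theorem eventually_hasLogOn (c : PlaneChart q) {T : Set S} (hT : IsCompact T) (hq : q ∉ T) :
    ∀ᶠ u in 𝓝 q, u ≠ q → HasLogOn (fun z => c.coord z - c.coord u) T := by
  have hf : ContinuousOn c.coord T :=
    c.continuousOn_coord.mono fun z hz hzq => hq (hzq ▸ hz)
  obtain ⟨M, hM⟩ := hT.exists_bound_of_continuousOn hf
  filter_upwards [c.eventually_lt_norm (max M 0)] with u hu huq
  have hMu : M < ‖c.coord u‖ := (le_max_left _ _).trans_lt (hu huq)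
  have hpos : 0 < ‖c.coord u‖ := (le_max_right _ _).trans_lt (hu huq)
  have hne : c.coord u ≠ 0 := norm_pos_iff.1 hpos
  refine ((hasLogOn_const (neg_ne_zero.2 hne) T).mul (hasLogOn_of_norm_lt_one
    (w := fun z => -(c.coord z / c.coord u)) (hf.div_const _).neg fun z hz => ?_)).congr ?_
  · rw [norm_neg, norm_div, div_lt_one hpos]
    exact (hM z hz).trans_lt hMu
  · intro z _
    simp only
    field_simp
    ring

/-- A connected open set containing the point at infinity of a chart does not wind around its own
points. -/
theorem hasLogOn_compl (c : PlaneChart q) [CompactSpace S] {U : Set S} (hUo : IsOpen U)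
    (hUc : IsPreconnected U) (hq : q ∈ U) {u : S} (hu : u ∈ U) (huq : u ≠ q) :
    HasLogOn (fun z => c.coord z - c.coord u) Uᶜ := by
  have hT : IsCompact Uᶜ := hUo.isClosed_compl.isCompact
  have hqT : q ∉ Uᶜ := fun h => h hq
  refine (hUc.induction₂ (fun u v =>
    (u ≠ q → HasLogOn (fun z => c.coord z - c.coord u) Uᶜ) ↔
      (v ≠ q → HasLogOn (fun z => c.coord z - c.coord v) Uᶜ)) (fun a ha => ?_)
    (fun _ _ _ _ _ _ h h' => h.trans h') (fun _ _ _ _ h => h.symm) hq hu).1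
    (fun h => (h rfl).elim) huq
  refine eventually_nhdsWithin_of_eventually_nhds ?_
  rcases eq_or_ne a q with rfl | haq
  · filter_upwards [c.eventually_hasLogOn hT hqT] with v hv
    exact ⟨fun _ => hv, fun _ h => (h rfl).elim⟩
  · filter_upwards [c.eventually_hasLogOn_iff hT hqT haq fun h => h ha] with v hv
    exact ⟨fun h _ => hv.2.1 (h haq), fun h _ => hv.2.2 (h hv.1)⟩

end PlaneChart

namespace IsOuterComponent

variable {x : S} {r : ℝ} {U : Set S}

theorem hasLogOn_compl_diff_singleton [CompactSpace S] (hU : IsOuterComponent x r U)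
    (hgeo : IsGeodesicSpace S) (hr : 0 < r) (c : PlaneChart q) (hq : q ∈ U) {a : S}
    (hpre : IsPreconnected ({a}ᶜ : Set S)) (ha : a ∈ frontier U) :
    HasLogOn (fun z => c.coord z - c.coord a) (Uᶜ \ {a}) := by
  have ha' := ha
  rw [hU.frontier_eq] at ha'
  have haq : a ≠ q := fun h => ha'.2 (h ▸ hq)
  refine hasLogOn_of_forall_compact_preconnected (x₀ := x) (fun T hTs hT _ _ => ?_) fun z hz =>
    hU.exists_isCompact_isPreconnected_mem_nhdsWithin hgeo hr hpre ha hz.1 hz.2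
  obtain ⟨u, ⟨huq, hiff⟩, hu⟩ := mem_closure_iff_nhds.1 ha'.1 _
    (c.eventually_hasLogOn_iff hT (fun h => (hTs h).1 hq) haq fun h => (hTs h).2 rfl)
  exact hiff.2 ((c.hasLogOn_compl hU.isOpen hU.isPreconnected hq hu huq).mono
    fun z hz => (hTs hz).1)

theorem hasLogOn_div_center (hU : IsOuterComponent x r U)
    (hgeo : IsGeodesicSpace S) (c : PlaneChart q) (hq : q ∈ U) {a : S}
    (ha : a ∈ frontier U) :
    HasLogOn (fun z => (c.coord z - c.coord x) / (c.coord z - c.coord a))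
      (closure U \ {a, q}) := by
  have har := hU.dist_eq hgeo ha
  obtain ⟨γ, h0, h1, hγ⟩ := hgeo.exists_segment a x
  have hle : ∀ t, dist (γ t) x ≤ r := fun t => by
    linarith [(hγ t).2, dist_nonneg (x := a) (y := γ t)]
  have hγq : ∀ t, γ t ≠ q := fun t h => by linarith [hU.lt_dist q hq, h ▸ hle t]
  have hcont : Continuous fun t => c.coord (γ t) :=
    c.continuousOn_coord.comp_continuous γ.continuous hγq
  have key := hasLogOn_div_of_path (f := c.coord) (s := closure U \ {a, q})
    (c.continuousOn_coord.mono fun z hz hzq => hz.2 (Or.inr hzq))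
    ⟨fun t => c.coord (γ t), hcont⟩ fun z hz t h => ?_
  · simpa [h0, h1] using key
  · have hzγ : z = γ t := c.injOn_coord (fun hzq => hz.2 (Or.inr hzq)) (hγq t) h
    have hrz : r ≤ dist z x := hU.le_dist hz.1
    have h3 := hγ t
    rw [← hzγ, har] at h3
    have h4 : dist a z = 0 :=
      le_antisymm (by linarith [h3.2]) dist_nonneg
    exact hz.2 (Or.inl (dist_eq_zero.1 h4).symm)

theorem hasLogOn_div_closure (hU : IsOuterComponent x r U)
    (hgeo : IsGeodesicSpace S) (hr : 0 < r) (c : PlaneChart q) (hq : q ∈ U) {a b : S}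
    (ha : a ∈ frontier U) (hb : b ∈ frontier U) :
    HasLogOn (fun z => (c.coord z - c.coord a) / (c.coord z - c.coord b))
      (closure U \ {a, b, q}) := by
  refine (((hU.hasLogOn_div_center hgeo c hq hb).mono ?_).div
    ((hU.hasLogOn_div_center hgeo c hq ha).mono ?_)).congr ?_
  · exact sdiff_subset_sdiff_right (by simp)
  · exact sdiff_subset_sdiff_right (by simp [insert_subset_iff])
  · rintro z ⟨hz, hzn⟩
    simp only [mem_insert_iff, mem_singleton_iff, not_or] at hzn
    have hxq : x ≠ q := by
      rintro rfl; exact hU.center_notMem hr.le hq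
    have hzx : z ≠ x := by
      rintro rfl
      have := hU.le_dist hz
      rw [dist_self] at this
      linarith
    have hne : c.coord z - c.coord x ≠ 0 :=
      sub_ne_zero.2 fun h => hzx (c.injOn_coord hzn.2.2 hxq h)
    simp only
    rw [div_div_div_cancel_left' _ _ hne]

/-- Removing two points disconnects the boundary of a component. -/
theorem not_isPreconnected_frontier_diff_pair [CompactSpace S] (hU : IsOuterComponent x r U)
    (hgeo : IsGeodesicSpace S) (hr : 0 < r) (hchart : ∀ q : S, Nonempty (PlaneChart q)) {a b : S}
    (ha : a ∈ frontier U) (hb : b ∈ frontier U) (hab : a ≠ b) :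
    ¬ IsPreconnected (frontier U \ {a, b}) := by
  intro hconn
  obtain ⟨q, hq⟩ := hU.nonempty
  obtain ⟨c⟩ := hchart q
  have hpre : ∀ p : S, IsPreconnected ({p}ᶜ : Set S) := fun p =>
    (hchart p).some.isPreconnected_compl_singleton
  have hfr : frontier U = closure U \ U := hU.frontier_eq
  have haq : a ≠ q := fun h => (hfr ▸ ha).2 (h ▸ hq)
  have hbq : b ≠ q := fun h => (hfr ▸ hb).2 (h ▸ hq)
  have hlog : HasLogOn (fun z => (c.coord z - c.coord a) / (c.coord z - c.coord b))
      ({a, b, q}ᶜ : Set S) := by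
    refine HasLogOn.glue hU.isOpen.isClosed_compl (isClosed_closure (s := U)) ?_ ?_ ?_ ?_
    · intro z _
      by_cases hz : z ∈ U
      · exact Or.inr (subset_closure hz)
      · exact Or.inl hz
    · convert! hconn using 1
      ext z
      simp only [hfr, mem_inter_iff, mem_compl_iff, mem_insert_iff, mem_singleton_iff, Set.mem_sdiff]
      constructor
      · tauto
      · rintro ⟨⟨h1, h2⟩, h3⟩
        have : z ≠ q := fun h => h2 (h ▸ hq)
        tauto
    · refine ((hU.hasLogOn_compl_diff_singleton hgeo hr c hq (hpre a) ha).mono ?_).div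
        ((hU.hasLogOn_compl_diff_singleton hgeo hr c hq (hpre b) hb).mono ?_)
      · exact fun z hz => ⟨hz.2, fun h => hz.1 (Or.inl h)⟩
      · exact fun z hz => ⟨hz.2, fun h => hz.1 (Or.inr (Or.inl h))⟩
    · exact (hU.hasLogOn_div_closure hgeo hr c hq ha hb).mono fun z hz => ⟨hz.2, hz.1⟩
  refine not_hasLogOn_div_compl_pair (fun h => hab (c.injOn_coord haq hbq h))
    ((hlog.comp (φ := c.point) c.continuous_point.continuousOn fun w hw => ?_).congr fun w _ => ?_)
  · have hwq : c.point w ≠ q := c.point_ne w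
    simp only [mem_compl_iff, mem_insert_iff, mem_singleton_iff, not_or] at hw ⊢
    refine ⟨fun h => hw.1 ?_, fun h => hw.2 ?_, hwq⟩
    · rw [← h, c.coord_point]
    · rw [← h, c.coord_point]
  · simp only [c.coord_point]

theorem isPreconnected_frontier_diff_singleton [CompactSpace S] (hU : IsOuterComponent x r U)
    (hgeo : IsGeodesicSpace S) (hr : 0 < r) (hchart : ∀ q : S, Nonempty (PlaneChart q)) {p : S}
    (hp : p ∈ frontier U) : IsPreconnected (frontier U \ {p}) := by
  obtain ⟨c⟩ := hchart p
  have hfr : frontier U = closure U \ U := hU.frontier_eq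
  have hpU : p ∉ U := (hfr ▸ hp).2
  have key := Complex.isPreconnected_inter_of_union_eq_univ
    (hU.isOpen.isClosed_compl.preimage c.continuous_point)
    ((isClosed_closure (s := U)).preimage c.continuous_point) ?_ ?_ ?_
  · convert! key.image c.point c.continuous_point.continuousOn using 1
    rw [← preimage_inter, image_preimage_eq_inter_range, c.range_point, hfr]
    ext z
    simp only [Set.mem_sdiff, mem_inter_iff, mem_compl_iff]
    tauto
  · have := c.isPreconnected_preimage (fun h => h.2 rfl)
      (hU.isPreconnected_compl_diff_singleton hgeo hr c.isPreconnected_compl_singleton hp)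
    convert! this using 1
    ext w
    have := c.point_ne w
    simp [this]
  · have := c.isPreconnected_preimage (s := closure U \ {p}) (fun h => h.2 rfl)
      (hU.isPreconnected.subset_closure (fun z hz => ⟨subset_closure hz, fun h => hpU (h ▸ hz)⟩)
        sdiff_subset)
    convert! this using 1
    ext w
    have := c.point_ne w
    simp [this]
  · rw [← preimage_union]
    refine eq_univ_of_forall fun w => ?_
    by_cases hw : c.point w ∈ U
    · exact Or.inr (subset_closure hw)
    · exact Or.inl hw

theorem frontier_nontrivial (hU : IsOuterComponent x r U) (hgeo : IsGeodesicSpace S) (hr : 0 < r)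
    (hpre : ∀ p : S, IsPreconnected ({p}ᶜ : Set S)) : (frontier U).Nontrivial := by
  have hxU := hU.center_notMem hr.le
  have hx : ∀ a ∈ frontier U, x ≠ a := by
    rintro a ha rfl
    have := hU.dist_eq hgeo ha
    rw [dist_self] at this
    linarith
  obtain ⟨q, hq⟩ := hU.nonempty
  obtain ⟨a, ha⟩ : (frontier U).Nonempty := by
    by_contra! h
    obtain ⟨T, -, hT, hqT, hxT, -⟩ := hgeo.exists_isPreconnected_segment q x
    exact hxU (hT.subset_isClopen (isClopen_iff_frontier_eq_empty.2 h) ⟨q, hqT, hq⟩ hxT)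
  obtain ⟨b, hb, hba⟩ := exists_ne_mem_frontier (hpre a) hU.isOpen hU.nonempty
    (fun h => (hU.frontier_eq ▸ ha).2 h) hxU (hx a ha)
  exact ⟨a, ha, b, hb, hba.symm⟩

theorem nonempty_frontier_homeomorph_circle [CompactSpace S] (hU : IsOuterComponent x r U)
    (hgeo : IsGeodesicSpace S) (hr : 0 < r) (hchart : ∀ q : S, Nonempty (PlaneChart q)) :
    Nonempty (frontier U ≃ₜ Metric.sphere (0 : ℂ) 1) := by
  have hpre : ∀ p : S, IsPreconnected ({p}ᶜ : Set S) := fun p =>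
    (hchart p).some.isPreconnected_compl_singleton
  have hnt := hU.frontier_nontrivial hgeo hr hpre
  have h1 : ∀ p ∈ frontier U, IsPreconnected (frontier U \ {p}) := fun p hp =>
    hU.isPreconnected_frontier_diff_singleton hgeo hr hchart hp
  have h2 : ∀ a ∈ frontier U, ∀ b ∈ frontier U, a ≠ b → ¬ IsPreconnected (frontier U \ {a, b}) :=
    fun a ha b hb hab => hU.not_isPreconnected_frontier_diff_pair hgeo hr hchart ha hb hab
  have hconn : IsPreconnected (frontier U) := by
    obtain ⟨a, ha, b, hb, hab⟩ := hnt
    obtain ⟨z, hz, hzn⟩ : (frontier U \ {a, b}).Nonempty := by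
      rw [nonempty_iff_ne_empty]
      intro h
      exact h2 a ha b hb hab (h ▸ isPreconnected_empty)
    simp only [mem_insert_iff, mem_singleton_iff, not_or] at hzn
    have key := (h1 a ha).union z (mem_sdiff_singleton.2 ⟨hz, hzn.1⟩)
      (mem_sdiff_singleton.2 ⟨hz, hzn.2⟩) (h1 b hb)
    rwa [← sdiff_inter, (disjoint_singleton.2 hab).inter_eq, sdiff_empty] at key
  have : CompactSpace (frontier U) := isCompact_iff_compactSpace.1 isClosed_frontier.isCompact
  have : PreconnectedSpace (frontier U) := Subtype.preconnectedSpace hconn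
  have : Nontrivial (frontier U) := hnt.coe_sort
  refine nonempty_homeomorph_circle_of_cut_pairs (fun p => ?_) fun p p' hpp' => ?_
  · rw [← IsInducing.subtypeVal.isPreconnected_image]
    convert! h1 p p.2 using 1
    ext z; simp
  · rw [← IsInducing.subtypeVal.isPreconnected_image]
    convert! h2 p p.2 p' p'.2 (Subtype.coe_ne_coe.2 hpp') using 2
    ext z; simp [Subtype.ext_iff, eq_comm]

end IsOuterComponent

end Frontier

/-- Proposition 2.1: in a geodesic metric sphere, the boundary of any connected
component of the complement of the closure of a metric ball is a simple closed
curve, i.e. homeomorphic to the circle. -/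
theorem boundary_of_ball_complement_component_homeomorphic_circle
    {S : Type*} [MetricSpace S]
    (hgeo : IsGeodesicSpace S)
    (hsph : Nonempty (S ≃ₜ Metric.sphere (0 : EuclideanSpace ℝ (Fin 3)) 1))
    (x : S) (r : ℝ) (hr : 0 < r)
    (U : Set S) (y : S)
    (hy : y ∈ (closure (Metric.ball x r))ᶜ)
    (hU : U = connectedComponentIn ((closure (Metric.ball x r))ᶜ) y) :
    Nonempty ((frontier U) ≃ₜ Metric.sphere (0 : EuclideanSpace ℝ (Fin 2)) 1) := by
  have hcl : (closure (Metric.ball x r))ᶜ = {z | r < dist z x} := by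
    ext z
    simp [hgeo.closure_ball x hr]
  rw [hcl] at hy hU
  obtain ⟨h⟩ := hsph
  have : CompactSpace S := h.symm.compactSpace
  obtain ⟨e⟩ := nonempty_homeomorph_complex_circle_euclidean_circle
  obtain ⟨e'⟩ := (hU ▸ hgeo.isOuterComponent hy :
    IsOuterComponent x r U).nonempty_frontier_homeomorph_circle hgeo hr (nonempty_planeChart h)
  exact ⟨e'.trans e⟩
end

section
/- Let (S,d) be a geodesic metric space that is homeomorphic to the 2-sphere, let x ∈ S, let r > 0, and let U be a connected component of the complement S \ cl(B(x,r)) of the closure of the open ball B(x,r). Then the topological boundary ∂U of U, equipped with the subspace topology, is a locally connected topological space. -/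
open Set Topology Complex in
theorem sub_eq_sub_of_exp_eqOn {X : Type*} [TopologicalSpace X] {L L' : X → ℂ} {T : Set X}
    (hT : IsPreconnected T) (hL : ContinuousOn L T) (hL' : ContinuousOn L' T)
    (h : ∀ s ∈ T, exp (L s) = exp (L' s)) {s t : X} (hs : s ∈ T) (ht : t ∈ T) :
    L s - L' s = L t - L' t := by
  have hpi : (2 * Real.pi * I : ℂ) ≠ 0 := two_pi_I_ne_zero
  have hdisc : IsDiscrete (range ((↑) : ℤ → ℂ)) := by
    have : IsEmbedding ((↑) : ℤ → ℂ) := by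
      simpa [Function.comp_def] using
        isometry_ofReal.isEmbedding.comp Int.isClosedEmbedding_coe_real.isEmbedding
    exact this.isDiscrete_range
  have key := hT.constant_of_mapsTo (f := fun x => (L x - L' x) / (2 * Real.pi * I)) hdisc
    (by fun_prop) (fun x hx => by
      obtain ⟨n, hn⟩ := exp_eq_exp_iff_exists_int.1 (h x hx)
      exact ⟨n, by rw [eq_div_iff hpi, hn]; ring⟩) hs ht
  simpa [div_left_inj' hpi] using key

/-- The function `f` has a continuous logarithm on `T`. -/
def HasContinuousLogOn {X : Type*} [TopologicalSpace X] (f : X → ℂ) (T : Set X) : Prop :=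
  ∃ L : X → ℂ, ContinuousOn L T ∧ ∀ s ∈ T, Complex.exp (L s) = f s

namespace HasContinuousLogOn

open Set Topology Complex

variable {X : Type*} [TopologicalSpace X] {f g : X → ℂ} {T T' : Set X}

theorem mono (h : HasContinuousLogOn f T) (hT : T' ⊆ T) : HasContinuousLogOn f T' := by
  obtain ⟨L, hL, hf⟩ := h
  exact ⟨L, hL.mono hT, fun s hs => hf s (hT hs)⟩

theorem congr_mul (hf : HasContinuousLogOn f T) (hg : HasContinuousLogOn g T) {k : X → ℂ}
    (h : ∀ s ∈ T, k s = f s * g s) : HasContinuousLogOn k T := by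
  obtain ⟨L, hL, hf⟩ := hf
  obtain ⟨M, hM, hg⟩ := hg
  exact ⟨fun s => L s + M s, hL.add hM, fun s hs => by rw [exp_add, hf s hs, hg s hs, h s hs]⟩

theorem of_mem_slitPlane (hf : ContinuousOn f T) (h : ∀ s ∈ T, f s ∈ slitPlane) :
    HasContinuousLogOn f T :=
  ⟨fun s => log (f s), hf.clog h, fun s hs => exp_log (slitPlane_ne_zero (h s hs))⟩

theorem const {c : ℂ} (hc : c ≠ 0) : HasContinuousLogOn (fun _ => c) T :=
  ⟨fun _ => log c, continuousOn_const, fun _ _ => exp_log hc⟩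

theorem union (hf : HasContinuousLogOn f T) (hf' : HasContinuousLogOn f T') (hT : IsClosed T)
    (hT' : IsClosed T') (hconn : IsConnected (T ∩ T')) : HasContinuousLogOn f (T ∪ T') := by
  classical
  obtain ⟨L, hL, hf⟩ := hf
  obtain ⟨M, hM, hf'⟩ := hf'
  obtain ⟨⟨c, hc⟩, hpre⟩ := hconn
  have hdiff : ∀ s ∈ T ∩ T', L s = M s + (L c - M c) := fun s hs => by
    rw [← sub_eq_sub_of_exp_eqOn hpre (hL.mono inter_subset_left) (hM.mono inter_subset_right)
      (fun s hs => (hf s hs.1).trans (hf' s hs.2).symm) hs hc]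
    ring
  have hexp : exp (L c - M c) = 1 := by
    rw [exp_sub, hf c hc.1, hf' c hc.2, div_self]
    exact hf c hc.1 ▸ exp_ne_zero _
  have hleft : EqOn (T.piecewise L fun s => M s + (L c - M c)) L T := piecewise_eqOn _ _ _
  have hright : EqOn (T.piecewise L fun s => M s + (L c - M c)) (fun s => M s + (L c - M c)) T' := by
    intro s hs
    by_cases h : s ∈ T
    · rw [hleft h, hdiff s ⟨h, hs⟩]
    · exact piecewise_eq_of_notMem _ _ _ h
  refine ⟨T.piecewise L fun s => M s + (L c - M c), ?_, ?_⟩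
  · exact (hL.congr hleft).union_of_isClosed ((hM.add continuousOn_const).congr hright) hT hT'
  · rintro s (hs | hs)
    · rw [hleft hs, hf s hs]
    · rw [hright hs, exp_add, hexp, mul_one, hf' s hs]

end HasContinuousLogOn

open Set Topology Complex in
theorem not_hasContinuousLogOn_sub_sphere (a : ℂ) {R : ℝ} (hR : 0 < R) :
    ¬ HasContinuousLogOn (fun z => z - a) (Metric.sphere a R) := by
  rintro ⟨L, hL, h⟩
  have hmem : ∀ t : ℝ, circleMap a R t ∈ Metric.sphere a R := circleMap_mem_sphere a hR.le
  have key := sub_eq_sub_of_exp_eqOn (T := (univ : Set ℝ)) (L := fun t => L (circleMap a R t))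
    (L' := fun t => Real.log R + t * I) isPreconnected_univ
    (continuousOn_univ.2 (hL.comp_continuous (continuous_circleMap a R) hmem))
    (by fun_prop) (fun t _ => by
      rw [h _ (hmem t), exp_add, ← ofReal_exp, Real.exp_log hR]
      simp [circleMap]) (mem_univ 0) (mem_univ (2 * Real.pi))
  have hper : circleMap a R (2 * Real.pi) = circleMap a R 0 := by
    simpa using periodic_circleMap a R 0
  rw [hper] at key
  have : (2 * Real.pi * I : ℂ) = 0 := by
    push_cast at key
    linear_combination key
  exact two_pi_I_ne_zero this

open Set Topology Complex in
theorem hasContinuousLogOn_univ {G : ℂ → ℂ} (hG : Continuous G) (h0 : ∀ z, G z ≠ 0) :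
    HasContinuousLogOn G univ := by
  obtain ⟨L, hL, h⟩ := exists_continuousOn_eqOn_exp_comp (X := ℂ) (U := univ)
    (by
      have := (convex_univ (𝕜 := ℝ) (E := ℂ)).contractibleSpace univ_nonempty
      exact SimplyConnectedSpace.ofContractible _) isOpen_univ hG.continuousOn
    (by simpa using h0)
  exact ⟨L, hL, h⟩

section Puncture

open Set Topology Complex Filter

theorem HasContinuousLogOn.sub_const_of_norm_lt {X : Type*} [TopologicalSpace X] {f : X → ℂ}
    {T : Set X} {a b : ℂ} (hf : ContinuousOn f T) (h : HasContinuousLogOn (fun s => f s - a) T)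
    (hab : ∀ s ∈ T, ‖a - b‖ < ‖f s - a‖) : HasContinuousLogOn (fun s => f s - b) T := by
  have hne : ∀ s ∈ T, f s - a ≠ 0 := fun s hs =>
    norm_pos_iff.1 ((norm_nonneg _).trans_lt (hab s hs))
  refine h.congr_mul (g := fun s => 1 + (a - b) / (f s - a)) (of_mem_slitPlane ?_ ?_) ?_
  · exact continuousOn_const.add (continuousOn_const.div (hf.sub continuousOn_const) hne)
  · intro s hs
    refine mem_slitPlane_of_norm_lt_one ?_
    rw [norm_div, div_lt_one ((norm_nonneg _).trans_lt (hab s hs))]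
    exact hab s hs
  · intro s hs
    have := hne s hs
    field_simp
    ring

variable {S : Type*} [TopologicalSpace S] {u : S}
  {h : OpenPartialHomeomorph S ℂ}

theorem eventually_lt_norm_of_puncture [T2Space S] (hs : h.source = {u}ᶜ) (ht : h.target = univ) (R : ℝ) :
    ∀ᶠ s in 𝓝 u, s ≠ u → R < ‖h s‖ := by
  have hK : IsCompact (h.symm '' Metric.closedBall 0 R) :=
    (isCompact_closedBall 0 R).image_of_continuousOn (h.continuousOn_symm.mono (by simp [ht]))
  have hu : u ∉ h.symm '' Metric.closedBall 0 R := by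
    rintro ⟨z, -, hz⟩
    have : h.symm z ∈ h.source := h.map_target (by simp [ht])
    simp [hs, hz] at this
  filter_upwards [hK.isClosed.isOpen_compl.mem_nhds hu] with s hsK hsu
  by_contra! hle
  exact hsK ⟨h s, by simpa using hle, h.left_inv (by simpa [hs] using hsu)⟩

theorem isCompact_image_of_puncture [CompactSpace S] (hs : h.source = {u}ᶜ) {T : Set S} (hT : IsClosed T)
    (hu : u ∉ T) : IsCompact (h '' T) :=
  hT.isCompact.image_of_continuousOn
    (h.continuousOn.mono (by rw [hs]; exact fun s hsT hsu => hu (hsu ▸ hsT)))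

variable [CompactSpace S] [T2Space S]

/-- If a closed set `T` does not separate `a` from the puncture `u`, then `h - h a` has a
continuous logarithm on `T`. -/
theorem hasContinuousLogOn_of_isPreconnected (hs : h.source = {u}ᶜ) (ht : h.target = univ)
    {T Z : Set S} (hT : IsClosed T) (hZ : IsPreconnected Z) (hZT : Disjoint Z T) (hu : u ∈ Z)
    {a : S} (ha : a ∈ Z) (hau : a ≠ u) : HasContinuousLogOn (fun s => h s - h a) T := by
  have huT : u ∉ T := disjoint_left.1 hZT hu
  have hTs : T ⊆ h.source := by rw [hs]; exact fun s hsT hsu => huT (hsu ▸ hsT)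
  have hcont : ContinuousOn h T := h.continuousOn.mono hTs
  have hcomp : IsCompact (h '' T) := isCompact_image_of_puncture hs hT huT
  have hinf : ∀ᶠ s in 𝓝 u, s = u ∨ HasContinuousLogOn (fun x => h x - h s) T := by
    obtain ⟨R, hR⟩ := hcomp.isBounded.exists_norm_le
    filter_upwards [eventually_lt_norm_of_puncture hs ht R] with s hsR
    refine or_iff_not_imp_left.2 fun hsu => ?_
    have hlt : ∀ x ∈ T, ‖h x‖ < ‖h s‖ := fun x hx => (hR _ ⟨x, hx, rfl⟩).trans_lt (hsR hsu)
    by_cases hs0 : h s = 0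
    · exact ⟨0, continuousOn_const, fun x hx => by
        have := (norm_nonneg _).trans_lt (hlt x hx)
        simp [hs0] at this⟩
    refine (HasContinuousLogOn.const (neg_ne_zero.2 hs0)).congr_mul (g := fun x => 1 + -(h x / h s))
      (.of_mem_slitPlane (by fun_prop) fun x hx => mem_slitPlane_of_norm_lt_one ?_) ?_
    · rw [norm_neg, norm_div, div_lt_one (norm_pos_iff.2 hs0)]
      exact hlt x hx
    · intro x hx
      field_simp
      ring
  have hfin : ∀ s ∉ T, s ≠ u → ∀ᶠ t in 𝓝 s, t ≠ u ∧
      (HasContinuousLogOn (fun x => h x - h s) T ↔ HasContinuousLogOn (fun x => h x - h t) T) := by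
    intro s hsT hsu
    have hss : s ∈ h.source := by simpa [hs] using hsu
    have hn : h s ∉ h '' T := by
      rintro ⟨x, hx, hxs⟩
      exact hsT (h.injOn (hTs hx) hss hxs ▸ hx)
    obtain ⟨ε, hε, hball⟩ := Metric.isOpen_iff.1 hcomp.isClosed.isOpen_compl _ hn
    have hfar : ∀ x ∈ T, ε ≤ ‖h x - h s‖ := fun x hx => by
      by_contra! hlt
      exact hball (by simpa [dist_eq_norm] using hlt) ⟨x, hx, rfl⟩
    filter_upwards [isOpen_ne.mem_nhds hsu,
      (h.continuousAt hss).eventually (Metric.ball_mem_nhds _ (half_pos hε))] with t htu htb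
    have htb : ‖h t - h s‖ < ε / 2 := by simpa [dist_eq_norm] using htb
    refine ⟨htu, fun H => H.sub_const_of_norm_lt hcont fun x hx => ?_,
      fun H => H.sub_const_of_norm_lt hcont fun x hx => ?_⟩
    · rw [norm_sub_rev]
      linarith [hfar x hx]
    · have := norm_sub_le_norm_sub_add_norm_sub (h x) (h t) (h s)
      linarith [hfar x hx]
  set H : Set S := {s | s = u ∨ HasContinuousLogOn (fun x => h x - h s) T}
  have hO₁ : IsOpen (Tᶜ ∩ H) := by
    refine isOpen_iff_mem_nhds.2 fun s hsH => inter_mem (hT.isOpen_compl.mem_nhds hsH.1) ?_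
    by_cases hsu : s = u
    · exact hsu ▸ hinf
    · filter_upwards [hfin s hsH.1 hsu] with t ht
      exact Or.inr (ht.2.1 (hsH.2.resolve_left hsu))
  have hO₂ : IsOpen (Tᶜ ∩ Hᶜ) := by
    refine isOpen_iff_mem_nhds.2 fun s hsH => inter_mem (hT.isOpen_compl.mem_nhds hsH.1) ?_
    have hsu : s ≠ u := fun e => hsH.2 (Or.inl e)
    filter_upwards [hfin s hsH.1 hsu] with t ht
    exact fun htH => hsH.2 (Or.inr (ht.2.2 (htH.resolve_left ht.1)))
  have hsub : Z ⊆ Tᶜ ∩ H :=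
    hZ.subset_left_of_subset_union hO₁ hO₂
      (disjoint_left.2 fun s h₁ h₂ => h₂.2 h₁.2)
      (fun s hsZ => by
        have := disjoint_left.1 hZT hsZ
        by_cases hsH : s ∈ H
        · exact Or.inl ⟨this, hsH⟩
        · exact Or.inr ⟨this, hsH⟩)
      ⟨u, hu, disjoint_left.1 hZT hu, Or.inl rfl⟩
  exact (hsub ha).2.resolve_left hau

/-- If `frontier V` separates `a ∈ V` from the puncture `u`, then `h - h a` has no continuous
logarithm on `frontier V`. -/
theorem not_hasContinuousLogOn_frontier (hs : h.source = {u}ᶜ) (ht : h.target = univ)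
    {V : Set S} (hu : u ∉ closure V) {a : S} (ha : a ∈ V) :
    ¬ HasContinuousLogOn (fun s => h s - h a) (frontier V) := by
  classical
  rintro ⟨L, hL, hexp⟩
  obtain ⟨M, hM⟩ := ContinuousMap.exists_restrict_eq isClosed_frontier
    (⟨(frontier V).domRestrict L, continuousOn_iff_continuous_domRestrict.1 hL⟩ : C(frontier V, ℂ))
  have hML : ∀ s ∈ frontier V, M s = L s := fun s hsV => DFunLike.congr_fun hM ⟨s, hsV⟩
  set G : S → ℂ := V.piecewise (fun s => exp (M s)) (fun s => h s - h a)
  have hGc : ContinuousOn G {u}ᶜ := by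
    refine ContinuousOn.piecewise (fun s hsV => ?_) (by fun_prop) ?_
    · rw [hML s hsV.2, hexp s hsV.2]
    · exact ((h.continuousOn.mono (by rw [hs])).sub continuousOn_const).mono inter_subset_left
  have hau : a ≠ u := fun e => hu (e ▸ subset_closure ha)
  have hG0 : ∀ s ≠ u, G s ≠ 0 := by
    intro s hsu
    by_cases hsV : s ∈ V
    · simp [G, hsV, exp_ne_zero]
    · simp only [G, piecewise_eq_of_notMem _ _ _ hsV]
      intro h0
      exact hsV (h.injOn (by simpa [hs] using hsu) (by simpa [hs] using hau)
        (sub_eq_zero.1 h0) ▸ ha)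
  have hsymm : ∀ z, h.symm z ≠ u := fun z => by
    have : h.symm z ∈ h.source := h.map_target (by simp [ht])
    simpa [hs] using this
  have hcs : Continuous h.symm := by
    rw [← continuousOn_univ, ← ht]
    exact h.continuousOn_symm
  obtain ⟨N, hN, hNG⟩ := hasContinuousLogOn_univ (G := fun z => G (h.symm z))
    (hGc.comp_continuous hcs hsymm) (fun z => hG0 _ (hsymm z))
  obtain ⟨R, hR⟩ := (isCompact_image_of_puncture hs isClosed_closure hu).isBounded.exists_norm_le
  have hbig : ∀ z, R < ‖z‖ → G (h.symm z) = z - h a := by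
    intro z hz
    have hzV : h.symm z ∉ V := fun hzV => by
      have := hR _ ⟨_, subset_closure hzV, rfl⟩
      rw [h.right_inv (by simp [ht])] at this
      exact this.not_gt hz
    simp only [G, piecewise_eq_of_notMem _ _ _ hzV]
    rw [h.right_inv (by simp [ht])]
  refine not_hasContinuousLogOn_sub_sphere (h a) (R := |R| + ‖h a‖ + 1) (by positivity)
    ⟨N, hN.mono (subset_univ _), fun z hz => ?_⟩
  refine (hNG z (mem_univ _)).trans (hbig z ?_)
  rw [mem_sphere_iff_norm] at hz
  have := norm_sub_le z (h a)
  linarith [le_abs_self R]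

/-- Janiszewski's theorem: if two closed sets with connected intersection do not separate `a`
from `u`, then neither does their union. -/
theorem false_of_frontier_subset_union (hs : h.source = {u}ᶜ) (ht : h.target = univ)
    {V T₁ T₂ Z₁ Z₂ : Set S} (hu : u ∉ closure V) {a : S} (ha : a ∈ V)
    (hVT : frontier V ⊆ T₁ ∪ T₂) (hT₁ : IsClosed T₁) (hT₂ : IsClosed T₂)
    (hT : IsConnected (T₁ ∩ T₂)) (hZ₁ : IsPreconnected Z₁) (hZ₂ : IsPreconnected Z₂)
    (ha₁ : a ∈ Z₁) (ha₂ : a ∈ Z₂) (hu₁ : u ∈ Z₁) (hu₂ : u ∈ Z₂)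
    (hd₁ : Disjoint Z₁ T₁) (hd₂ : Disjoint Z₂ T₂) : False := by
  have hau : a ≠ u := fun e => hu (e ▸ subset_closure ha)
  exact not_hasContinuousLogOn_frontier hs ht hu ha
    (((hasContinuousLogOn_of_isPreconnected hs ht hT₁ hZ₁ hd₁ hu₁ ha₁ hau).union
      (hasContinuousLogOn_of_isPreconnected hs ht hT₂ hZ₂ hd₂ hu₂ ha₂ hau) hT₁ hT₂ hT).mono hVT)

end Puncture

section Geodesic

open Set Topology Metric Filter

theorem exists_openPartialHomeomorph_complex_of_homeomorph_sphere {S : Type*} [TopologicalSpace S]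
    (φ : S ≃ₜ sphere (0 : EuclideanSpace ℝ (Fin 3)) 1) (u : S) :
    ∃ h : OpenPartialHomeomorph S ℂ, h.source = {u}ᶜ ∧ h.target = univ := by
  have : Fact (Module.finrank ℝ (EuclideanSpace ℝ (Fin 3)) = 2 + 1) := ⟨by simp⟩
  refine ⟨φ.toOpenPartialHomeomorph.trans ((stereographic' 2 (φ u)).trans
    Complex.orthonormalBasisOneI.repr.symm.toHomeomorph.toOpenPartialHomeomorph), ?_, ?_⟩
  · ext s
    simp
  · simp

variable {S : Type*} [MetricSpace S]

namespace IsGeodesicSpace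

theorem exists_dist_eq (hgeo : IsGeodesicSpace S) (x y : S) {t : ℝ} (ht : t ∈ Icc 0 (dist x y)) :
    ∃ z, dist x z = t ∧ dist z y = dist x y - t := by
  obtain ⟨γ, h0, h1, hγ⟩ := hgeo x y
  refine ⟨γ t, ?_, ?_⟩
  · rw [← h0, hγ 0 ⟨le_rfl, dist_nonneg⟩ t ht, zero_sub, abs_neg, abs_of_nonneg ht.1]
  · nth_rw 1 [← h1]
    rw [hγ t ht _ ⟨dist_nonneg, le_rfl⟩, abs_sub_comm, abs_of_nonneg (sub_nonneg.2 ht.2)]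

theorem exists_isPreconnected (hgeo : IsGeodesicSpace S) (x y : S) :
    ∃ C : Set S, IsPreconnected C ∧ x ∈ C ∧ y ∈ C ∧
      ∀ z ∈ C, dist x z + dist z y = dist x y := by
  obtain ⟨γ, h0, h1, hγ⟩ := hgeo x y
  have hl : (0 : ℝ) ∈ Icc 0 (dist x y) := ⟨le_rfl, dist_nonneg⟩
  have hr : dist x y ∈ Icc 0 (dist x y) := ⟨dist_nonneg, le_rfl⟩
  refine ⟨γ '' Icc 0 (dist x y), isPreconnected_Icc.image _ ?_, ⟨0, hl, h0⟩, ⟨_, hr, h1⟩, ?_⟩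
  · refine LipschitzOnWith.continuousOn (K := 1) (LipschitzOnWith.of_dist_le_mul ?_)
    intro s hs t ht
    simp [hγ s hs t ht, Real.dist_eq]
  · rintro _ ⟨t, ht, rfl⟩
    have e1 := hγ 0 hl t ht
    have e2 := hγ t ht _ hr
    rw [h0, zero_sub, abs_neg, abs_of_nonneg ht.1] at e1
    rw [h1, abs_sub_comm, abs_of_nonneg (sub_nonneg.2 ht.2)] at e2
    linarith

theorem closedBall_subset_closure_ball (hgeo : IsGeodesicSpace S) (x : S) {r : ℝ} (hr : 0 < r) :
    closedBall x r ⊆ closure (ball x r) := by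
  intro z hz
  rw [mem_closedBall'] at hz
  refine Metric.mem_closure_iff.2 fun ε hε => ?_
  by_cases hzε : dist x z < ε
  · exact ⟨x, mem_ball_self hr, by rwa [dist_comm]⟩
  · obtain ⟨w, h₁, h₂⟩ := hgeo.exists_dist_eq x z (t := dist x z - ε / 2)
      ⟨by linarith, by linarith⟩
    exact ⟨w, by rw [mem_ball']; linarith, by rw [dist_comm, h₂]; linarith⟩

/-- Nearby points of a metric sphere are endpoints of radial geodesics whose starting points are
close to each other. -/
theorem exists_radial_points [CompactSpace S] (hgeo : IsGeodesicSpace S) {x p : S} {r ε : ℝ}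
    (hε : 0 < ε) (hεr : ε ≤ r) :
    ∃ δ > 0, ∀ q, dist x q = r → dist p q < δ → ∃ p' q', dist x p' = r - ε ∧ dist p' p = ε ∧
      dist x q' = r - ε ∧ dist q' q = ε ∧ dist p' q' < ε := by
  by_contra! H
  choose q hq hpq hfar using fun n : ℕ => H (1 / (n + 1)) Nat.one_div_pos_of_nat
  have hrad : ∀ n, ∃ z, dist x z = r - ε ∧ dist z (q n) = ε := fun n => by
    obtain ⟨z, h₁, h₂⟩ := hgeo.exists_dist_eq x (q n) (t := r - ε)
      ⟨by linarith, by linarith [hq n]⟩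
    exact ⟨z, h₁, by rw [h₂, hq n]; ring⟩
  choose z hxz hzq using hrad
  obtain ⟨p', φ, hφ, hlim⟩ := CompactSpace.tendsto_subseq z
  have hqlim : Tendsto q atTop (𝓝 p) := by
    rw [tendsto_iff_dist_tendsto_zero]
    exact squeeze_zero (fun _ => dist_nonneg) (fun n => by rw [dist_comm]; exact (hpq n).le)
      tendsto_one_div_add_atTop_nhds_zero_nat
  have hxp' : dist x p' = r - ε :=
    tendsto_nhds_unique (tendsto_const_nhds.dist hlim) (by simp [hxz])
  have hp'p : dist p' p = ε :=
    tendsto_nhds_unique (hlim.dist (hqlim.comp hφ.tendsto_atTop)) (by simp [hzq])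
  obtain ⟨n, hn⟩ := (hlim.eventually (ball_mem_nhds p' hε)).exists
  exact (hfar (φ n) p' (z (φ n)) hxp' hp'p (hxz _) (hzq _)).not_gt (by rwa [dist_comm])

end IsGeodesicSpace

theorem exists_isClosed_separation_of_notMem_connectedComponentIn {X : Type*} [TopologicalSpace X]
    [T2Space X] {N : Set X} (hN : IsCompact N) {p q : X} (hp : p ∈ N) (hq : q ∈ N)
    (h : q ∉ connectedComponentIn N p) :
    ∃ P Q : Set X, IsClosed P ∧ IsClosed Q ∧ Disjoint P Q ∧ P ∪ Q = N ∧ p ∈ P ∧ q ∈ Q := by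
  have := isCompact_iff_compactSpace.1 hN
  have hq' : (⟨q, hq⟩ : N) ∉ connectedComponent (⟨p, hp⟩ : N) := fun hc => h <| by
    rw [connectedComponentIn_eq_image hp]
    exact ⟨_, hc, rfl⟩
  rw [connectedComponent_eq_iInter_isClopen, mem_iInter] at hq'
  push Not at hq'
  obtain ⟨⟨Z, hZ, hpZ⟩, hqZ⟩ := hq'
  have hemb : IsClosedEmbedding ((↑) : N → X) := hN.isClosed.isClosedEmbedding_subtypeVal
  refine ⟨(↑) '' Z, (↑) '' Zᶜ, hemb.isClosedMap _ hZ.1, hemb.isClosedMap _ hZ.compl.1,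
    (disjoint_image_iff Subtype.val_injective).2 disjoint_compl_right, ?_, ⟨_, hpZ, rfl⟩,
    ⟨_, hqZ, rfl⟩⟩
  rw [← image_union, union_compl_self, image_univ, Subtype.range_coe]

/-- Let `p, q` be nearby boundary points of a domain `U` that lies outside a metric ball and has
its boundary on the sphere of that ball. If `P` and `Q` separated `p` from `q` in the part of
`frontier U` near `p`, adding to each of them the geodesics from the centre to the rest of
`frontier U` would produce two sets that do not separate the ball from `U`, while their union
does. -/
theorem mem_connectedComponentIn_frontier [CompactSpace S] (hgeo : IsGeodesicSpace S) {u : S}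
    {h : OpenPartialHomeomorph S ℂ} (hs : h.source = {u}ᶜ) (ht : h.target = univ)
    {U : Set S} (hUo : IsOpen U) (hU : IsPreconnected U) (hu : u ∈ U) {x : S} {r : ℝ} (hr : 0 < r)
    (hUr : ∀ z ∈ U, r < dist x z) (hFr : ∀ z ∈ frontier U, dist x z = r)
    {p : S} (hp : p ∈ frontier U) {ρ : ℝ} (hρ : 0 < ρ) :
    ∃ δ > 0, ∀ q ∈ frontier U, dist p q < δ →
      q ∈ connectedComponentIn (frontier U ∩ closedBall p ρ) p := by
  obtain ⟨ε, hε, hεr, hερ⟩ : ∃ ε > 0, 4 * ε ≤ r ∧ 8 * ε ≤ ρ :=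
    ⟨min (r / 4) (ρ / 8), by positivity, by linarith [min_le_left (r / 4) (ρ / 8)],
      by linarith [min_le_right (r / 4) (ρ / 8)]⟩
  obtain ⟨δ, hδ, H⟩ := hgeo.exists_radial_points (x := x) (p := p) (r := r) hε (by linarith)
  refine ⟨min δ ρ, lt_min hδ hρ, fun q hq hpq => ?_⟩
  obtain ⟨p', q', hxp', hpp', hxq', hqq', hpq'⟩ := H q (hFr q hq) (hpq.trans_le (min_le_left _ _))
  by_contra hcon
  obtain ⟨P, Q, hPc, hQc, hPQ, hPQN, hpP, hqQ⟩ :=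
    exists_isClosed_separation_of_notMem_connectedComponentIn
      (isClosed_frontier.inter isClosed_closedBall).isCompact
      ⟨hp, mem_closedBall_self hρ.le⟩
      ⟨hq, by rw [mem_closedBall']; exact (hpq.trans_le (min_le_right _ _)).le⟩ hcon
  have hPF : P ⊆ frontier U := subset_union_left.trans (hPQN.subset.trans inter_subset_left)
  have hQF : Q ⊆ frontier U := subset_union_right.trans (hPQN.subset.trans inter_subset_left)
  choose C hCconn hxC hyC hC using fun y => hgeo.exists_isPreconnected x y
  set M : Set S := {x} ∪ ⋃ y ∈ frontier U \ closedBall p ρ, C y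
  have hMconn : IsPreconnected M := by
    refine isPreconnected_of_forall x fun z hz => ?_
    rcases hz with rfl | hz
    · exact ⟨{z}, by simp [M], rfl, rfl, isPreconnected_singleton⟩
    · simp only [mem_iUnion] at hz
      obtain ⟨y, hy, hzy⟩ := hz
      exact ⟨C y, (subset_biUnion_of_mem (u := C) hy).trans subset_union_right, hxC y, hzy,
        hCconn y⟩
  have hMfar : closure M ⊆ {z | 4 * ε ≤ dist p z} ∩ {z | dist x z ≤ r} := by
    refine closure_minimal ?_ ((isClosed_le (by fun_prop) (by fun_prop)).inter
      (isClosed_le (by fun_prop) (by fun_prop)))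
    rintro z (rfl | hz)
    · have := hFr p hp
      rw [dist_comm] at this
      simp only [mem_inter_iff, mem_ofPred_eq, dist_self, this]
      exact ⟨hεr, hr.le⟩
    · simp only [mem_iUnion] at hz
      obtain ⟨y, hy, hzy⟩ := hz
      have e1 := hC y z hzy
      rw [hFr y hy.1] at e1
      have e2 : ρ < dist p y := by simpa [dist_comm] using hy.2
      refine ⟨?_, by simp only [mem_ofPred_eq]; linarith [dist_nonneg (x := z) (y := y)]⟩
      have e3 := dist_triangle p z y
      have e4 := dist_triangle x z p
      rw [hFr p hp, dist_comm z p] at e4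
      simp only [mem_ofPred_eq]
      linarith
  have hMU : Disjoint U (closure M) := by
    refine disjoint_left.2 fun z hzU hzM => ?_
    exact (hUr z hzU).not_ge (hMfar hzM).2
  have hcM : IsConnected (closure M) := ⟨⟨x, subset_closure (by simp [M])⟩, hMconn.closure⟩
  have arm : ∀ (E P' : Set S) (e : S), e ∈ E → e ∈ frontier U → IsPreconnected E → P' ⊆ frontier U →
      e ∉ P' → (∀ z ∈ E, dist p z ≤ 3 * ε) → (∀ z ∈ E, z = e ∨ dist x z < r) →
      IsPreconnected (E ∪ insert e U) ∧ Disjoint (E ∪ insert e U) (P' ∪ closure M) := by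
    intro E P' e heE heF hE hP' heP' hEp hEx
    refine ⟨hE.union e heE (mem_insert _ _) (hU.subset_closure (subset_insert _ _)
      (insert_subset (frontier_subset_closure heF) subset_closure)), ?_⟩
    have hEd : Disjoint E (P' ∪ closure M) := by
      refine disjoint_left.2 fun z hzE hz => ?_
      rcases hz with hz | hz
      · rcases hEx z hzE with rfl | hlt
        · exact heP' hz
        · exact hlt.ne (hFr z (hP' hz))
      · have : 4 * ε ≤ dist p z := (hMfar hz).1
        linarith [hEp z hzE]
    have hUd : Disjoint U (P' ∪ closure M) := by
      refine disjoint_union_right.2 ⟨?_, hMU⟩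
      refine disjoint_left.2 fun z hzU hz => ?_
      have := hP' hz
      rw [hUo.frontier_eq] at this
      exact this.2 hzU
    rw [← singleton_union, disjoint_union_left, disjoint_union_left]
    exact ⟨hEd, hEd.mono_left (singleton_subset_iff.2 heE), hUd⟩
  obtain ⟨Ep, hEp, hpE, hpE', hEpd⟩ := hgeo.exists_isPreconnected p' p
  obtain ⟨Eq, hEq, hqE, hqE', hEqd⟩ := hgeo.exists_isPreconnected q' q
  obtain ⟨Em, hEm, hmE, hmE', hEmd⟩ := hgeo.exists_isPreconnected p' q'
  have radial : ∀ e e' z : S, dist x e' = r - ε → dist e' e = ε →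
      dist e' z + dist z e = dist e' e → z = e ∨ dist x z < r := by
    intro e e' z h1 h2 h3
    refine or_iff_not_imp_left.2 fun hze => ?_
    linarith [dist_triangle x e' z, dist_pos.2 hze]
  have hp'p := dist_comm p p'
  obtain ⟨hc₁, hd₁⟩ := arm (Em ∪ Eq) P q (Or.inr hqE') hq (hEm.union q' hmE' hqE hEq) hPF
    (disjoint_right.1 hPQ hqQ)
    (by
      rintro z (hz | hz)
      · linarith [dist_triangle p p' z, hEmd z hz, dist_nonneg (x := z) (y := q')]
      · linarith [dist_triangle4 p p' q' z, hEqd z hz, dist_nonneg (x := z) (y := q)])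
    (by
      rintro z (hz | hz)
      · right
        have := hEmd z hz
        linarith [dist_triangle x p' z, dist_nonneg (x := z) (y := q')]
      · exact radial q q' z hxq' hqq' (hEqd z hz))
  obtain ⟨hc₂, hd₂⟩ := arm Ep Q p hpE' hp hEp hQF (disjoint_left.1 hPQ hpP)
    (fun z hz => by
      linarith [dist_triangle p p' z, hEpd z hz, dist_nonneg (x := z) (y := p)])
    (fun z hz => radial p p' z hxp' hpp' (hEpd z hz))
  refine false_of_frontier_subset_union hs ht (V := (closure U)ᶜ) (a := p')
    (T₁ := P ∪ closure M) (T₂ := Q ∪ closure M) ?_ ?_ ?_ (hPc.union isClosed_closure)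
    (hQc.union isClosed_closure) ?_ hc₁ hc₂ (Or.inl (Or.inl hmE)) (Or.inl hpE)
    (Or.inr (Or.inr hu)) (Or.inr (Or.inr hu)) hd₁ hd₂
  · rw [closure_compl, notMem_compl_iff]
    exact interior_mono subset_closure (hUo.interior_eq.symm ▸ hu)
  · intro hmem
    have : r ≤ dist x p' := closure_minimal (t := {z | r ≤ dist x z}) (fun z hz => (hUr z hz).le)
      (isClosed_le (by fun_prop) (by fun_prop)) hmem
    linarith
  · rw [frontier_compl]
    refine (frontier_closure_subset).trans fun z hz => ?_
    by_cases hzp : z ∈ closedBall p ρ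
    · rcases hPQN.symm.subset ⟨hz, hzp⟩ with hz | hz
      · exact Or.inl (Or.inl hz)
      · exact Or.inr (Or.inl hz)
    · exact Or.inl (Or.inr (subset_closure (Or.inr (mem_biUnion ⟨hz, hzp⟩ (hyC z)))))
  · rwa [← inter_union_distrib_right, hPQ.inter_eq, empty_union]

end Geodesic

open Set Topology Metric in
theorem frontier_connectedComponentIn_subset {X : Type*} [TopologicalSpace X] {O : Set X} {y : X}
    (hU : IsOpen (connectedComponentIn O y)) :
    frontier (connectedComponentIn O y) ⊆ Oᶜ := by
  intro z hz hzO
  rw [hU.frontier_eq] at hz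
  have hy : y ∈ O := by
    by_contra hy
    simp [connectedComponentIn_eq_empty hy] at hz
  refine hz.2 ?_
  have hsub : insert z (connectedComponentIn O y) ⊆ connectedComponentIn O y :=
    (isPreconnected_connectedComponentIn.subset_closure (subset_insert _ _)
      (insert_subset hz.1 subset_closure)).subset_connectedComponentIn
      (mem_insert_of_mem _ (mem_connectedComponentIn hy))
      (insert_subset hzO (connectedComponentIn_subset _ _))
  exact hsub (mem_insert _ _)

/-- Key step in the proof of Proposition 2.1: in a geodesic metric sphere, the
boundary of any connected component of the complement of the closure of a
metric ball is locally connected (in the subspace topology). -/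
theorem boundary_of_ball_complement_component_locallyConnected
    {S : Type*} [MetricSpace S]
    (hgeo : IsGeodesicSpace S)
    (hsph : Nonempty (S ≃ₜ Metric.sphere (0 : EuclideanSpace ℝ (Fin 3)) 1))
    (x : S) (r : ℝ) (hr : 0 < r)
    (U : Set S) (y : S)
    (hy : y ∈ (closure (Metric.ball x r))ᶜ)
    (hU : U = connectedComponentIn ((closure (Metric.ball x r))ᶜ) y) :
    LocallyConnectedSpace (frontier U) := by
  obtain ⟨φ⟩ := hsph
  have : CompactSpace S := φ.symm.compactSpace
  have : LocallyConnectedSpace (Metric.sphere (0 : EuclideanSpace ℝ (Fin 3)) 1) :=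
    ChartedSpace.locallyConnectedSpace (EuclideanSpace ℝ (Fin 2)) _
  have : LocallyConnectedSpace S := φ.isOpenEmbedding.locallyConnectedSpace
  have hUo : IsOpen U := hU ▸ isClosed_closure.isOpen_compl.connectedComponentIn
  have hUr : ∀ z ∈ U, r < dist x z := fun z hz => by
    rw [hU] at hz
    by_contra! hle
    exact connectedComponentIn_subset _ _ hz
      (hgeo.closedBall_subset_closure_ball x hr (Metric.mem_closedBall'.2 hle))
  have hFr : ∀ z ∈ frontier U, dist x z = r := fun z hz => by
    refine le_antisymm ?_ ?_
    · rw [hU] at hz hUo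
      have hzB := not_not.1 (frontier_connectedComponentIn_subset hUo hz)
      exact Metric.mem_closedBall'.1 (Metric.closure_ball_subset_closedBall hzB)
    · exact closure_minimal (t := {z | r ≤ dist x z}) (fun z hz => (hUr z hz).le)
        (isClosed_le (by fun_prop) (by fun_prop)) (frontier_subset_closure hz)
  obtain ⟨h, hs, ht⟩ := exists_openPartialHomeomorph_complex_of_homeomorph_sphere φ y
  rw [locallyConnectedSpace_iff_connected_subsets]
  intro p W hW
  obtain ⟨ρ, hρ, hρW⟩ := Metric.nhds_basis_closedBall.mem_iff.1 hW
  obtain ⟨δ, hδ, hconn⟩ := mem_connectedComponentIn_frontier hgeo hs ht hUo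
    (hU ▸ isPreconnected_connectedComponentIn) (hU ▸ mem_connectedComponentIn hy) hr hUr hFr
    p.2 hρ
  have hsub := connectedComponentIn_subset (frontier U ∩ Metric.closedBall (p : S) ρ) p
  refine ⟨(↑) ⁻¹' connectedComponentIn (frontier U ∩ Metric.closedBall (p : S) ρ) p,
    Filter.mem_of_superset (Metric.ball_mem_nhds p hδ) fun q hq => ?_, ?_,
    fun q hq => hρW (hsub hq).2⟩
  · exact hconn q q.2 (by rwa [Metric.mem_ball'] at hq)
  · rw [← Topology.IsInducing.subtypeVal.isPreconnected_image, Set.image_preimage_eq_of_subset]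
    · exact isPreconnected_connectedComponentIn
    · rw [Subtype.range_coe]
      exact fun z hz => (hsub hz).1
end

section
/- Let (S,d) be a geodesic metric space and suppose φ : D̄ → S is a homeomorphism from the closed unit disk D̄ ⊆ ℝ² onto S. If ψ : S → S is a bijective isometry that fixes every point of φ(∂D̄) (the image of the unit circle under φ), then ψ(z) = z for all z ∈ S. -/
section

open Filter Topology Set

/-- A continuous nowhere vanishing complex function on a real normed space has a continuous
logarithm. -/
theorem exists_continuous_log {E : Type*} [NormedAddCommGroup E] [NormedSpace ℝ E]
    {f : E → ℂ} (hf : Continuous f) (h0 : ∀ x, f x ≠ 0) :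
    ∃ l : E → ℂ, Continuous l ∧ ∀ x, Complex.exp (l x) = f x := by
  obtain ⟨F, ⟨-, hF⟩, -⟩ := Complex.isCoveringMap_exp.existsUnique_continuousMap_lifts
    (⟨fun x => (⟨f x, h0 x⟩ : {z : ℂ // z ≠ 0}), by fun_prop⟩ : C(E, {z : ℂ // z ≠ 0})) 0
    (Complex.log (f 0)) (by ext; simp [Complex.exp_log (h0 0)])
  exact ⟨F, F.continuous, fun x => congrArg Subtype.val (congrFun hF x)⟩

/-- On a preconnected set where `exp ∘ F` stays in the closed right half-plane, the imaginary
part of `F` cannot leave `[-π / 2, π / 2]`. -/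
theorem abs_im_le_of_isPreconnected {X : Type*} [TopologicalSpace X] {S : Set X}
    (hS : IsPreconnected S) {F : X → ℂ} (hF : ContinuousOn F S)
    (hre : ∀ x ∈ S, 0 ≤ (Complex.exp (F x)).re) {x₀ x : X} (hx₀ : x₀ ∈ S) (hx : x ∈ S)
    (h₀ : |(F x₀).im| ≤ Real.pi / 2) : |(F x).im| ≤ Real.pi / 2 := by
  have hpi := Real.pi_pos
  have hcos : ∀ y ∈ S, 0 ≤ Real.cos (F y).im := by
    intro y hy
    have := hre y hy
    rw [Complex.exp_re] at this
    exact nonneg_of_mul_nonneg_right this (Real.exp_pos _)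
  have him : ContinuousOn (fun y => (F y).im) S := Complex.continuous_im.comp_continuousOn hF
  by_contra! hlt
  have key : ∃ y ∈ S, (Real.pi / 2 < (F y).im ∧ (F y).im ≤ Real.pi) ∨
      (-Real.pi ≤ (F y).im ∧ (F y).im < -(Real.pi / 2)) := by
    rw [abs_le] at h₀
    rcases lt_abs.1 hlt with h | h
    · obtain ⟨y, hy, hyv⟩ := hS.intermediate_value hx₀ hx him
        (show min (F x).im Real.pi ∈ Icc (F x₀).im (F x).im from
          ⟨le_min (by linarith) (by linarith), min_le_left _ _⟩)
      refine ⟨y, hy, Or.inl ?_⟩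
      simp only [] at hyv
      rw [hyv]
      exact ⟨lt_min h (by linarith), min_le_right _ _⟩
    · obtain ⟨y, hy, hyv⟩ := hS.intermediate_value hx hx₀ him
        (show max (F x).im (-Real.pi) ∈ Icc (F x).im (F x₀).im from
          ⟨le_max_left _ _, max_le (by linarith) (by linarith)⟩)
      refine ⟨y, hy, Or.inr ?_⟩
      simp only [] at hyv
      rw [hyv]
      exact ⟨le_max_right _ _, max_lt (by linarith) (by linarith)⟩
  obtain ⟨y, hy, h | h⟩ := key
  · exact absurd (hcos y hy)
      (not_le.2 (Real.cos_neg_of_pi_div_two_lt_of_lt h.1 (by linarith)))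
  · have := hcos y hy
    rw [← Real.cos_neg] at this
    exact absurd this
      (not_le.2 (Real.cos_neg_of_pi_div_two_lt_of_lt (by linarith) (by linarith)))

theorem abs_im_lt_of_exp_re_pos {z : ℂ} (hz : |z.im| ≤ Real.pi / 2)
    (hre : 0 < (Complex.exp z).re) : |z.im| < Real.pi / 2 := by
  refine lt_of_le_of_ne hz fun h => ?_
  rw [Complex.exp_re, ← Real.cos_abs, h, Real.cos_pi_div_two, mul_zero] at hre
  exact lt_irrefl _ hre

theorem log_exp_of_abs_im_lt {z : ℂ} (hz : |z.im| < Real.pi / 2) :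
    Complex.log (Complex.exp z) = z := by
  have := Real.pi_pos
  rw [abs_lt] at hz
  exact Complex.log_exp (by linarith) (by linarith)

theorem abs_im_log_lt {z : ℂ} (hz : 0 < z.re) : |(Complex.log z).im| < Real.pi / 2 := by
  rw [Complex.log_im, Complex.abs_arg_lt_pi_div_two_iff]
  exact Or.inl hz

/-- Two continuous logarithms of the same function on a preconnected set agree as soon as
they agree at one point. -/
theorem eq_of_exp_eq_of_isPreconnected {X : Type*} [TopologicalSpace X] {S : Set X}
    (hS : IsPreconnected S) {F G : X → ℂ} (hF : ContinuousOn F S) (hG : ContinuousOn G S)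
    (hexp : ∀ x ∈ S, Complex.exp (F x) = Complex.exp (G x)) {x₀ x : X} (hx₀ : x₀ ∈ S)
    (hx : x ∈ S) (h₀ : F x₀ = G x₀) : F x = G x := by
  have h1 : ∀ y ∈ S, Complex.exp (F y - G y) = 1 := fun y hy => by
    rw [Complex.exp_sub, hexp y hy, div_self (Complex.exp_ne_zero _)]
  have h2 := abs_im_le_of_isPreconnected hS (hF.sub hG)
    (fun y hy => by rw [Pi.sub_apply, h1 y hy]; simp) hx₀ hx
    (by simp only [Pi.sub_apply, h₀, sub_self, Complex.zero_im, abs_zero]; positivity)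
  have h3 := abs_im_lt_of_exp_re_pos h2 (by rw [Pi.sub_apply, h1 x hx]; simp)
  have h4 := log_exp_of_abs_im_lt h3
  rw [Pi.sub_apply, h1 x hx, Complex.log_one] at h4
  exact sub_eq_zero.1 h4.symm

/-- The curve `β` lies above the curve `α`, both of them running off to real part `-∞` at `-∞`:
some continuous argument of `β t - α s` is near `0` when `α s` is far left
and near `π` when `β t` is far left. -/
def CurveAbove (α β : ℝ → ℂ) : Prop :=
  ∃ L : ℝ × ℝ → ℂ, Continuous L ∧ (∀ s t, Complex.exp (L (s, t)) = β t - α s) ∧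
    (∀ t, ∀ᶠ s in atBot, |(L (s, t)).im| < Real.pi / 2) ∧
    ∀ s, ∀ᶠ t in atBot, |(L (s, t)).im - Real.pi| < Real.pi / 2

theorem CurveAbove.not_swap {α β : ℝ → ℂ} (h : CurveAbove α β) : ¬ CurveAbove β α := by
  rintro ⟨K, hK, hKe, hK1, hK2⟩
  obtain ⟨L, hL, hLe, hL1, hL2⟩ := h
  have hconst : ∀ s t, K (t, s) - L (s, t) = K (0, 0) - L (0, 0) := by
    intro s t
    have := eq_of_exp_eq_of_isPreconnected (X := ℝ × ℝ) isPreconnected_univ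
      (F := fun q => K (q.2, q.1)) (G := fun q => L q + (K (0, 0) - L (0, 0)))
      (by fun_prop) (by fun_prop) (x₀ := (0, 0)) (x := (s, t))
      (by
        rintro ⟨a, b⟩ -
        simp only [Complex.exp_add, Complex.exp_sub, hKe, hLe]
        have : β 0 - α 0 ≠ 0 := by rw [← hLe]; exact Complex.exp_ne_zero _
        field_simp
        ring) (mem_univ _) (mem_univ _) (by simp)
    simp only [] at this
    rw [this]; ring
  obtain ⟨s, hs1, hs2⟩ := ((hL1 0).and (hK2 0)).exists
  obtain ⟨t, ht1, ht2⟩ := ((hL2 0).and (hK1 0)).exists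
  have e1 := congrArg Complex.im (hconst s 0)
  have e2 := congrArg Complex.im (hconst 0 t)
  simp only [Complex.sub_im] at e1 e2
  rw [abs_lt] at *
  linarith [hs1.1, hs1.2, hs2.1, hs2.2, ht1.1, ht1.2, ht2.1, ht2.2, Real.pi_pos]

theorem eventually_abs_im_lt {a b : ℝ → ℂ} (hb : Continuous b)
    (hainf : Tendsto (fun s => (a s).re) atBot atBot) {L : ℝ × ℝ → ℂ} (hL : Continuous L)
    (hLe : ∀ s t, Complex.exp (L (s, t)) = b t - a s) {c s₀ t₀ : ℝ}
    (has : ∀ s ≤ s₀, (a s).re ≤ c) (hbt : (b t₀).re = c)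
    (h₀ : |(L (s₀, t₀)).im| ≤ Real.pi / 2) (t : ℝ) :
    ∀ᶠ s in atBot, |(L (s, t)).im| < Real.pi / 2 := by
  obtain ⟨m, hm⟩ := (isCompact_uIcc (a := t) (b := t₀)).bddBelow_image
    (f := fun t => (b t).re) (by fun_prop)
  filter_upwards [hainf.eventually_lt_atBot m, eventually_le_atBot s₀] with s hs hss
  have h1 : |(L (s, t₀)).im| ≤ Real.pi / 2 :=
    abs_im_le_of_isPreconnected (F := fun s => L (s, t₀)) isPreconnected_Iic
      (by fun_prop) (fun x hx => by
        rw [hLe, Complex.sub_re, hbt]; linarith [has x hx]) (mem_Iic.2 le_rfl) hss h₀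
  have hpos : ∀ y ∈ uIcc t t₀, 0 < (Complex.exp (L (s, y))).re := fun y hy => by
    rw [hLe, Complex.sub_re]
    have : m ≤ (b y).re := hm (mem_image_of_mem _ hy)
    linarith
  exact abs_im_lt_of_exp_re_pos
    (abs_im_le_of_isPreconnected (F := fun t => L (s, t)) isPreconnected_uIcc
      (by fun_prop) (fun x hx => (hpos x hx).le) right_mem_uIcc left_mem_uIcc h1)
    (hpos t left_mem_uIcc)

/-- If two disjoint curves stay left of a vertical line until they hit it, their order is
the order of the hitting points. -/
theorem curveAbove_of_hit {α β : ℝ → ℂ} (hα : Continuous α) (hβ : Continuous β)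
    (hαinf : Tendsto (fun s => (α s).re) atBot atBot)
    (hβinf : Tendsto (fun s => (β s).re) atBot atBot) (hdis : ∀ s t, α s ≠ β t)
    {c s₀ t₀ : ℝ} (hαs : ∀ s ≤ s₀, (α s).re ≤ c) (hα0 : (α s₀).re = c)
    (hβt : ∀ t ≤ t₀, (β t).re ≤ c) (hβ0 : (β t₀).re = c)
    (him : (α s₀).im < (β t₀).im) : CurveAbove α β := by
  obtain ⟨K, hK, hKe⟩ := exists_continuous_log (E := ℝ × ℝ) (f := fun q => β q.2 - α q.1)
    (by fun_prop) (fun q => sub_ne_zero.2 (hdis _ _).symm)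
  set d := β t₀ - α s₀ with hd
  have hd0 : d ≠ 0 := sub_ne_zero.2 (hdis _ _).symm
  have hLim : (Complex.log d).im = Real.pi / 2 := by
    rw [Complex.log_im, Complex.arg_eq_pi_div_two_iff]
    simp [hd, hα0, hβ0, him]
  let L : ℝ × ℝ → ℂ := fun q => K q - K (s₀, t₀) + Complex.log d
  have hL : Continuous L := by fun_prop
  have hLe : ∀ s t, Complex.exp (L (s, t)) = β t - α s := fun s t => by
    simp only [L, Complex.exp_add, Complex.exp_sub, hKe, Complex.exp_log hd0]
    rw [← hd]
    field_simp
  have hL0 : (L (s₀, t₀)).im = Real.pi / 2 := by simp [L, hLim]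
  refine ⟨L, hL, hLe, fun t => eventually_abs_im_lt hβ hαinf hL hLe hαs hβ0
    (by rw [hL0, abs_of_pos (by positivity)]) t, fun s => ?_⟩
  have := eventually_abs_im_lt (L := fun q => L (q.2, q.1) - Real.pi * Complex.I) hα hβinf
    (by fun_prop) (fun t s => by
      simp only [Complex.exp_sub, hLe, Complex.exp_pi_mul_I]
      ring) hβt hα0 (by
        simp [hL0]
        rw [abs_of_neg] <;> linarith [Real.pi_pos]) s
  simpa using this

/-- A continuous injective self-map of the plane, equal to the identity on a right half-plane
and sending the left end to itself. -/
structure IsLeftEndMap (C : ℝ) (H : ℂ → ℂ) : Prop where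
  continuous : Continuous H
  injective : Function.Injective H
  map_eq : ∀ w : ℂ, C ≤ w.re → H w = w
  map_left : ∀ M : ℝ, ∃ N : ℝ, ∀ w : ℂ, w.re ≤ N → (H w).re ≤ M

namespace IsLeftEndMap

variable {C : ℝ} {H : ℂ → ℂ}

theorem tendsto_re (h : IsLeftEndMap C H) {α : ℝ → ℂ}
    (hα : Tendsto (fun s => (α s).re) atBot atBot) :
    Tendsto (fun s => (H (α s)).re) atBot atBot := by
  refine tendsto_atBot.2 fun M => ?_
  obtain ⟨N, hN⟩ := h.map_left M
  filter_upwards [hα.eventually_le_atBot N] with s hs using hN _ hs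

theorem re_lt (h : IsLeftEndMap C H) {w : ℂ} (hw : w.re < C) : (H w).re < C := by
  by_contra! hc
  have := h.injective (h.map_eq _ hc)
  rw [this] at hc
  linarith

/-- A normalized continuous logarithm of the difference quotient of `H` has an imaginary part
close to that of the argument when one point is far to the left of the other. -/
theorem exists_abs_im_lt (h : IsLeftEndMap C H) {F : ℂ × ℂ → ℂ}
    (hF : ContinuousOn F {q | q.2.re < q.1.re})
    (hFe : ∀ a b : ℂ, b.re < a.re → Complex.exp (F (a, b)) = (H a - H b) / (a - b))
    {a₀ b₀ : ℂ} (hb₀ : b₀.re < a₀.re) (ha₀ : C ≤ a₀.re) (hF0 : F (a₀, b₀) = 0) (a : ℂ) :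
    ∃ M : ℝ, ∀ b : ℂ, b.re ≤ M →
      b.re < a.re ∧ |(Complex.log (a - b) + F (a, b)).im| < Real.pi / 2 := by
  obtain ⟨m, hm⟩ := (isCompact_Icc (a := (0 : ℝ)) (b := C - a.re)).bddBelow_image
    (f := fun τ : ℝ => (H (a + τ)).re)
    (by have := h.continuous; fun_prop)
  have hm' : ∀ τ : ℝ, 0 ≤ τ → min m C ≤ (H (a + τ)).re := by
    intro τ hτ
    rcases le_total τ (C - a.re) with h1 | h1
    · exact (min_le_left _ _).trans (hm (mem_image_of_mem _ ⟨hτ, h1⟩))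
    · have : C ≤ (a + τ).re := by simp; linarith
      rw [h.map_eq _ this]
      exact (min_le_right _ _).trans this
  obtain ⟨N, hN⟩ := h.map_left (min m C - 1)
  let G : ℂ × ℂ → ℂ := fun q => Complex.log (q.1 - q.2) + F q
  have hG : ContinuousOn G {q | q.2.re < q.1.re} := by
    refine ContinuousOn.add (ContinuousOn.clog (by fun_prop) fun q hq => ?_) hF
    exact Complex.mem_slitPlane_iff.2 (Or.inl (by simpa using hq))
  have hGe : ∀ a b : ℂ, b.re < a.re → Complex.exp (G (a, b)) = H a - H b := by
    intro a b hab
    have : a - b ≠ 0 := sub_ne_zero.2 fun e => by rw [e] at hab; exact lt_irrefl _ hab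
    simp only [G, Complex.exp_add, Complex.exp_log this, hFe a b hab]
    field_simp
  -- the pairs whose right-hand point lies in the identity region
  have hE : ∀ a b : ℂ, b.re < a.re → C ≤ a.re → |(G (a, b)).im| < Real.pi / 2 := by
    have hconv : Convex ℝ {q : ℂ × ℂ | q.2.re < q.1.re ∧ C ≤ q.1.re} := by
      rintro ⟨a, b⟩ ⟨h1, h2⟩ ⟨a', b'⟩ ⟨h1', h2'⟩ x y hx hy hxy
      simp at h1 h2 h1' h2' ⊢
      obtain rfl : y = 1 - x := by linarith
      constructor
      · rcases hx.eq_or_lt with rfl | hx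
        · simpa using h1'
        · nlinarith
      · nlinarith
    have hpos : ∀ q : ℂ × ℂ, q ∈ {q : ℂ × ℂ | q.2.re < q.1.re ∧ C ≤ q.1.re} →
        0 < (Complex.exp (G q)).re := by
      rintro ⟨a, b⟩ ⟨h1, h2⟩
      rw [hGe a b h1, h.map_eq a h2, Complex.sub_re]
      rcases lt_or_ge b.re C with hb | hb
      · have := h.re_lt hb
        simp only [] at h2
        linarith
      · rw [h.map_eq b hb]
        simpa using h1
    intro a b hab ha
    refine abs_im_lt_of_exp_re_pos (abs_im_le_of_isPreconnected hconv.isPreconnected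
      (hG.mono fun q hq => hq.1) (fun q hq => (hpos q hq).le) (x₀ := (a₀, b₀)) ⟨hb₀, ha₀⟩
      (x := (a, b)) ⟨hab, ha⟩ ?_) (hpos _ ⟨hab, ha⟩)
    simp only [G, hF0, add_zero]
    exact (abs_im_log_lt (by simpa using hb₀)).le
  refine ⟨min N (a.re - 1), fun b hb => ?_⟩
  have hba : b.re < a.re := by linarith [min_le_right N (a.re - 1)]
  have hHb := hN b (hb.trans (min_le_left _ _))
  refine ⟨hba, ?_⟩
  have hpos : ∀ τ : ℝ, τ ∈ Ici (0 : ℝ) → 0 < (Complex.exp (G (a + τ, b))).re := by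
    intro τ hτ
    have hτ' : (0 : ℝ) ≤ τ := hτ
    rw [hGe _ _ (by simp; linarith), Complex.sub_re]
    linarith [hm' τ hτ]
  have hmem : max 0 (C - a.re) ∈ Ici (0 : ℝ) := mem_Ici.2 (le_max_left _ _)
  have := abs_im_le_of_isPreconnected (F := fun τ : ℝ => G (a + τ, b)) isPreconnected_Ici
    (hG.comp (by fun_prop) fun τ hτ => by
      have hτ' : (0 : ℝ) ≤ τ := hτ
      simp; linarith) (fun τ hτ => (hpos τ hτ).le) hmem
    (mem_Ici.2 le_rfl) (hE _ _ (by
      simp only [Complex.add_re, Complex.ofReal_re]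
      linarith [le_max_left 0 (C - a.re)]) (by
      simp only [Complex.add_re, Complex.ofReal_re]
      linarith [le_max_right 0 (C - a.re)])).le
  have h2 := abs_im_lt_of_exp_re_pos this (hpos 0 (mem_Ici.2 le_rfl))
  simpa [G] using h2

/-- A left end map preserves the vertical order of curves. -/
theorem curveAbove (h : IsLeftEndMap C H) {α β : ℝ → ℂ} (hα : Continuous α)
    (hαinf : Tendsto (fun s => (α s).re) atBot atBot)
    (hβinf : Tendsto (fun s => (β s).re) atBot atBot) (hab : CurveAbove α β) :
    CurveAbove (H ∘ α) (H ∘ β) := by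
  have hHc := h.continuous
  obtain ⟨K, hK, hKe⟩ := exists_continuous_log (E := ℂ × ℂ)
    (f := fun q => (H (q.1 + Complex.exp q.2) - H q.1) / Complex.exp q.2)
    (Continuous.div (by fun_prop) (by fun_prop) fun q => Complex.exp_ne_zero _)
    (fun q => div_ne_zero (sub_ne_zero.2 (h.injective.ne (by simp))) (Complex.exp_ne_zero _))
  have hZconv : Convex ℝ {q : ℂ × ℂ | C + Real.exp q.2.re ≤ q.1.re} := by
    rintro ⟨a, u⟩ h1 ⟨a', u'⟩ h2 x y hx hy hxy
    have := convexOn_exp.2 (mem_univ u.re) (mem_univ u'.re) hx hy hxy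
    simp at h1 h2 this ⊢
    have e : C = x * C + y * C := by rw [← add_mul, hxy, one_mul]
    nlinarith
  have hKZ : ∀ q ∈ {q : ℂ × ℂ | C + Real.exp q.2.re ≤ q.1.re}, Complex.exp (K q) = 1 := by
    rintro ⟨w, u⟩ hq
    replace hq : C + Real.exp u.re ≤ w.re := hq
    have h1 : C ≤ w.re := by linarith [Real.exp_pos u.re]
    have h2 : C ≤ (w + Complex.exp u).re := by
      have := (abs_le.1 (Complex.abs_re_le_norm (Complex.exp u))).1
      rw [Complex.norm_exp] at this
      rw [Complex.add_re]
      linarith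
    rw [hKe]
    simp only []
    rw [h.map_eq _ h1, h.map_eq _ h2, add_sub_cancel_left, div_self (Complex.exp_ne_zero _)]
  have hbase : (((C + 1 : ℝ) : ℂ), (0 : ℂ)) ∈ {q : ℂ × ℂ | C + Real.exp q.2.re ≤ q.1.re} := by
    simp
  let N : ℂ × ℂ → ℂ := fun q => K q - K (((C + 1 : ℝ) : ℂ), 0)
  have hN : Continuous N := by fun_prop
  have hNe : ∀ w u, Complex.exp (N (w, u)) =
      (H (w + Complex.exp u) - H w) / Complex.exp u := fun w u => by
    simp only [N, Complex.exp_sub, hKZ _ hbase, hKe, div_one]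
  have hNZ : ∀ q ∈ {q : ℂ × ℂ | C + Real.exp q.2.re ≤ q.1.re}, N q = 0 := fun q hq =>
    eq_of_exp_eq_of_isPreconnected (G := fun _ => 0) hZconv.isPreconnected hN.continuousOn
      continuousOn_const (fun q hq => by
        simp only [N, Complex.exp_sub, hKZ q hq, hKZ _ hbase, div_one, Complex.exp_zero])
      hbase hq (by simp [N])
  have hlog : ContinuousOn (fun q : ℂ × ℂ => Complex.log (q.1 - q.2)) {q | q.2.re < q.1.re} :=
    ContinuousOn.clog (by fun_prop) fun q hq =>
      Complex.mem_slitPlane_iff.2 (Or.inl (by simpa using hq))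
  have hne : ∀ a b : ℂ, b.re < a.re → a - b ≠ 0 := fun a b hab =>
    sub_ne_zero.2 fun e => by rw [e] at hab; exact lt_irrefl _ hab
  have right := h.exists_abs_im_lt (F := fun q => N (q.2, Complex.log (q.1 - q.2)))
    (hN.comp_continuousOn (by fun_prop))
    (fun a b hab => by rw [hNe, Complex.exp_log (hne a b hab)]; simp)
    (a₀ := ((C + 1 : ℝ) : ℂ) + 1) (b₀ := ((C + 1 : ℝ) : ℂ)) (by simp) (by simp; linarith)
    (by simpa using hNZ _ hbase)
  have left := h.exists_abs_im_lt
    (F := fun q => N (q.1, Complex.log (q.1 - q.2) + Real.pi * Complex.I))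
    (hN.comp_continuousOn (by fun_prop))
    (fun a b hab => by
      rw [hNe, Complex.exp_add, Complex.exp_log (hne a b hab), Complex.exp_pi_mul_I,
        ← neg_div_neg_eq]
      simp)
    (a₀ := ((C + 1 : ℝ) : ℂ)) (b₀ := (C : ℂ)) (by simp) (by simp)
    (hNZ _ (by simp))
  obtain ⟨L, hL, hLe, hL1, hL2⟩ := hab
  refine ⟨fun q => L q + N (α q.1, L q), by fun_prop, fun s t => ?_, fun t => ?_, fun s => ?_⟩
  · rw [Complex.exp_add, hNe, mul_div_cancel₀ _ (Complex.exp_ne_zero _), hLe]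
    simp
  · obtain ⟨M, hM⟩ := right (β t)
    filter_upwards [hL1 t, hαinf.eventually_le_atBot M] with s hs hsM
    have := (hM _ hsM).2
    rwa [← hLe s t, log_exp_of_abs_im_lt hs] at this
  · obtain ⟨M, hM⟩ := left (α s)
    filter_upwards [hL2 s, hβinf.eventually_le_atBot M] with t ht htM
    have := (hM _ htM).2
    have e : Complex.log (α s - β t) = L (s, t) - Real.pi * Complex.I := by
      rw [← log_exp_of_abs_im_lt (z := L (s, t) - Real.pi * Complex.I) (by simpa using ht),
        Complex.exp_sub, hLe, Complex.exp_pi_mul_I]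
      congr 1
      ring
    simp only [e, sub_add_cancel] at this
    convert this using 2
    simp
    ring

end IsLeftEndMap

/-- The first time at which the real part of a curve reaches `c`, truncated at time `0`. -/
noncomputable def hitTime (a : ℝ → ℂ) (c : ℝ) : ℝ := sInf {t | c ≤ (a t).re ∨ 0 ≤ t}

section hitTime

variable {a : ℝ → ℂ}

theorem bddBelow_hitTime (hainf : Tendsto (fun s => (a s).re) atBot atBot) (c : ℝ) :
    BddBelow {t | c ≤ (a t).re ∨ 0 ≤ t} := by
  obtain ⟨b, hb⟩ := eventually_atBot.1 (hainf.eventually_lt_atBot c)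
  refine ⟨min b 0, fun t ht => ?_⟩
  by_contra! hlt
  rcases ht with ht | ht
  · exact absurd (hb t (hlt.le.trans (min_le_left _ _))) (not_lt.2 ht)
  · exact absurd (hlt.trans_le (min_le_right _ _)) (not_lt.2 ht)

theorem hitTime_le (hainf : Tendsto (fun s => (a s).re) atBot atBot) {c t : ℝ}
    (ht : c ≤ (a t).re) : hitTime a c ≤ t :=
  csInf_le (bddBelow_hitTime hainf c) (Or.inl ht)

theorem re_lt_of_lt_hitTime (hainf : Tendsto (fun s => (a s).re) atBot atBot) {c t : ℝ}
    (ht : t < hitTime a c) : (a t).re < c := by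
  by_contra! h
  exact absurd (hitTime_le hainf h) (not_le.2 ht)

theorem re_hitTime (ha : Continuous a) (hainf : Tendsto (fun s => (a s).re) atBot atBot)
    {c : ℝ} (hc : c ≤ (a 0).re) : (a (hitTime a c)).re = c := by
  have hclosed : IsClosed {t | c ≤ (a t).re ∨ 0 ≤ t} :=
    (isClosed_le (f := fun _ => c) (g := fun t => (a t).re) (by fun_prop) (by fun_prop)).union
      isClosed_Ici
  have hmem := hclosed.csInf_mem ⟨0, Or.inr le_rfl⟩ (bddBelow_hitTime hainf c)
  refine le_antisymm ?_ ?_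
  · have : Tendsto (fun t => (a t).re) (𝓝[<] hitTime a c) (𝓝 (a (hitTime a c)).re) :=
      ((by fun_prop : Continuous fun t => (a t).re).tendsto _).mono_left nhdsWithin_le_nhds
    refine le_of_tendsto this ?_
    filter_upwards [self_mem_nhdsWithin] with t ht
    exact (re_lt_of_lt_hitTime hainf ht).le
  · rcases hmem with h | h
    · exact h
    · have h0 : hitTime a c = 0 := le_antisymm (hitTime_le hainf hc) h
      rwa [h0]

theorem re_le_of_le_hitTime (ha : Continuous a)
    (hainf : Tendsto (fun s => (a s).re) atBot atBot) {c t : ℝ} (hc : c ≤ (a 0).re)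
    (ht : t ≤ hitTime a c) : (a t).re ≤ c := by
  rcases ht.eq_or_lt with rfl | h
  · exact (re_hitTime ha hainf hc).le
  · exact (re_lt_of_lt_hitTime hainf h).le

theorem monotone_hitTime (hainf : Tendsto (fun s => (a s).re) atBot atBot) :
    Monotone (hitTime a) := fun c _ hcd =>
  csInf_le_csInf (bddBelow_hitTime hainf c) ⟨0, Or.inr le_rfl⟩
    fun _ ht => ht.imp_left hcd.trans

end hitTime

namespace IsLeftEndMap

variable {C : ℝ} {H : ℂ → ℂ}

theorem tendsto_re_iterate (h : IsLeftEndMap C H) {α : ℝ → ℂ}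
    (hα : Tendsto (fun s => (α s).re) atBot atBot) (n : ℕ) :
    Tendsto (fun s => (H^[n] (α s)).re) atBot atBot := by
  induction n with
  | zero => exact hα
  | succ n ih => simpa only [Function.iterate_succ_apply'] using h.tendsto_re ih

theorem curveAbove_iterate (h : IsLeftEndMap C H) {α β : ℝ → ℂ} (hα : Continuous α)
    (hαinf : Tendsto (fun s => (α s).re) atBot atBot)
    (hβinf : Tendsto (fun s => (β s).re) atBot atBot) (hab : CurveAbove α β) (n : ℕ) :
    CurveAbove (H^[n] ∘ α) (H^[n] ∘ β) := by
  induction n with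
  | zero => exact hab
  | succ n ih =>
    rw [Function.iterate_succ', Function.comp_assoc, Function.comp_assoc]
    exact h.curveAbove ((h.continuous.iterate n).comp hα) (h.tendsto_re_iterate hαinf n)
      (h.tendsto_re_iterate hβinf n) ih

/-- The heights at which the iterates of a curve disjoint from its image first hit a vertical
line form a strictly monotone or antitone sequence. -/
theorem exists_le_abs_im_sub (h : IsLeftEndMap C H) {α : ℝ → ℂ} (hα : Continuous α)
    (hαinf : Tendsto (fun s => (α s).re) atBot atBot) (hdis : ∀ s t, α s ≠ H (α t))
    {c : ℝ} (hc : ∀ n, c ≤ (H^[n] (α 0)).re) :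
    ∃ ε > 0, ∀ n, 1 ≤ n →
      ε ≤ |(H^[n] (α (hitTime (H^[n] ∘ α) c))).im - (α (hitTime α c)).im| := by
  let y : ℕ → ℝ := fun n => (H^[n] (α (hitTime (H^[n] ∘ α) c))).im
  have hcont : ∀ n, Continuous (H^[n] ∘ α) := fun n => (h.continuous.iterate n).comp hα
  have hinf := h.tendsto_re_iterate hαinf
  have hdis' : ∀ n s t, (H^[n] ∘ α) s ≠ (H^[n + 1] ∘ α) t := fun n s t e =>
    hdis s t (h.injective.iterate n (by simpa [Function.iterate_succ_apply] using e))
  have hne : ∀ n, y n ≠ y (n + 1) := fun n e =>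
    hdis' n _ _ (Complex.ext ((re_hitTime (hcont n) (hinf n) (hc n)).trans
      (re_hitTime (hcont _) (hinf _) (hc _)).symm) e)
  have hup : ∀ n, y n < y (n + 1) → CurveAbove (H^[n] ∘ α) (H^[n + 1] ∘ α) := fun n hn =>
    curveAbove_of_hit (hcont _) (hcont _) (hinf _) (hinf _) (hdis' n)
      (fun s hs => re_le_of_le_hitTime (hcont n) (hinf n) (hc n) hs)
      (re_hitTime (hcont n) (hinf n) (hc n))
      (fun s hs => re_le_of_le_hitTime (hcont _) (hinf _) (hc _) hs)
      (re_hitTime (hcont _) (hinf _) (hc _)) hn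
  have hdown : ∀ n, y (n + 1) < y n → CurveAbove (H^[n + 1] ∘ α) (H^[n] ∘ α) := fun n hn =>
    curveAbove_of_hit (hcont _) (hcont _) (hinf _) (hinf _) (fun s t => (hdis' n t s).symm)
      (fun s hs => re_le_of_le_hitTime (hcont _) (hinf _) (hc _) hs)
      (re_hitTime (hcont _) (hinf _) (hc _))
      (fun s hs => re_le_of_le_hitTime (hcont n) (hinf n) (hc n) hs)
      (re_hitTime (hcont n) (hinf n) (hc n)) hn
  refine ⟨|y 1 - y 0|, abs_pos.2 (sub_ne_zero.2 (hne 0).symm), fun n hn => ?_⟩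
  change _ ≤ |y n - y 0|
  rcases (hne 0).lt_or_gt with h0 | h0
  · have hmono : StrictMono y := strictMono_nat_of_lt_succ fun n => by
      refine (hne n).lt_of_le (not_lt.1 fun hlt => (hdown n hlt).not_swap ?_)
      have := h.curveAbove_iterate hα hαinf (h.tendsto_re_iterate hαinf 1) (hup 0 h0) n
      exact this
    have := hmono.monotone hn
    rw [abs_of_pos (by linarith), abs_of_pos (by linarith)]
    linarith
  · have hanti : StrictAnti y := strictAnti_nat_of_succ_lt fun n => by
      refine (hne n).symm.lt_of_le (not_lt.1 fun hlt => (hup n hlt).not_swap ?_)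
      have := h.curveAbove_iterate (h.continuous.comp hα) (h.tendsto_re_iterate hαinf 1) hαinf
        (hdown 0 h0) n
      exact this
    have := hanti.antitone hn
    rw [abs_of_neg (by linarith), abs_of_neg (by linarith)]
    linarith

/-- If the iterates of a left end map return close to the identity, then a curve from the
left end whose tip does not escape to the left meets its image. -/
theorem exists_eq_map (h : IsLeftEndMap C H) {α : ℝ → ℂ} (hα : Continuous α)
    (hαinf : Tendsto (fun s => (α s).re) atBot atBot)
    {c₀ : ℝ} (hc₀ : ∀ n, c₀ ≤ (H^[n] (α 0)).re)
    (hrec : ∀ M η : ℝ, 0 < η → ∃ n, 1 ≤ n ∧ (∀ w : ℂ, M ≤ w.re → ‖H^[n] w - w‖ < η) ∧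
      ∀ w : ℂ, w.re ≤ M → (H^[n] w).re ≤ M + η) :
    ∃ s t, α s = H (α t) := by
  by_contra! hdis
  obtain ⟨c, hcT, hc⟩ := ((monotone_hitTime hαinf).countable_not_continuousAt.dense_compl
    ℝ).exists_lt c₀
  have hcT' : ContinuousAt (hitTime α) c := not_not.1 hcT
  obtain ⟨ε, hε, hεn⟩ := h.exists_le_abs_im_sub hα hαinf hdis (c := c)
    fun n => hc.le.trans (hc₀ n)
  obtain ⟨ζ, hζ, hζα⟩ := Metric.continuous_iff.1 hα (hitTime α c) (ε / 2) (half_pos hε)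
  obtain ⟨δ₀, hδ₀, hδT⟩ := Metric.continuousAt_iff.1 hcT' ζ hζ
  set δ := min (δ₀ / 2) (c₀ - c) with hδ
  have hδpos : 0 < δ := lt_min (half_pos hδ₀) (sub_pos.2 hc)
  have hδδ₀ : δ < δ₀ := (min_le_left _ _).trans_lt (half_lt_self hδ₀)
  have hδc : c + δ ≤ c₀ := by linarith [min_le_right (δ₀ / 2) (c₀ - c)]
  obtain ⟨n, hn1, hnear, hleft⟩ := hrec (c - δ) (min (ε / 2) (δ / 2))
    (lt_min (half_pos hε) (half_pos hδpos))
  have hη1 := min_le_left (ε / 2) (δ / 2)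
  have hη2 := min_le_right (ε / 2) (δ / 2)
  have hcontn : Continuous (H^[n] ∘ α) := (h.continuous.iterate n).comp hα
  have hinfn := h.tendsto_re_iterate hαinf n
  set t := hitTime (H^[n] ∘ α) c with ht
  have htc : (H^[n] (α t)).re = c := re_hitTime hcontn hinfn (hc.le.trans (hc₀ n))
  have hM : c - δ ≤ (α t).re := by
    by_contra! hlt
    linarith [hleft _ hlt.le]
  have h1 : hitTime α (c - δ) ≤ t := by
    by_contra! hlt
    linarith [re_lt_of_lt_hitTime hαinf hlt]
  have h2 : t ≤ hitTime α (c + δ) := by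
    refine hitTime_le hinfn ?_
    have hre : (α (hitTime α (c + δ))).re = c + δ := re_hitTime hα hαinf (hδc.trans (hc₀ 0))
    have := hnear (α (hitTime α (c + δ))) (by rw [hre]; linarith)
    have := (abs_le.1 ((Complex.abs_re_le_norm _).trans this.le)).1
    rw [Complex.sub_re, hre] at this
    change c ≤ (H^[n] (α (hitTime α (c + δ)))).re
    linarith
  have hd1 := hδT (x := c - δ) (by rw [Real.dist_eq, abs_lt]; constructor <;> linarith)
  have hd2 := hδT (x := c + δ) (by rw [Real.dist_eq, abs_lt]; constructor <;> linarith)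
  rw [Real.dist_eq, abs_lt] at hd1 hd2
  have h3 := hζα t (by rw [Real.dist_eq, abs_lt]; constructor <;> linarith [hd1.1, hd2.2])
  rw [dist_eq_norm] at h3
  have h4 := hnear _ hM
  have h5 := hεn n hn1
  have h6 := (Complex.abs_im_le_norm _).trans h3.le
  have h7 := (Complex.abs_im_le_norm _).trans_lt h4
  rw [Complex.sub_im] at h6 h7
  have h8 := abs_sub_lt_iff.1 h7
  have h9 := abs_sub_le_iff.1 h6
  rw [← ht] at h5
  rcases le_abs.1 h5 with h5 | h5 <;> linarith [h8.1, h8.2, h9.1, h9.2]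

end IsLeftEndMap

/-- A homeomorphism onto its image of the plane fixing `0` and the exterior of a disk lifts
through the exponential to a left end map. -/
theorem exists_isLeftEndMap_lift {G : ℂ → ℂ} (hG : Continuous G) (hinj : Function.Injective G)
    (h0 : G 0 = 0) {r : ℝ} (hr : 0 < r) (hfix : ∀ x : ℂ, r ≤ ‖x‖ → G x = x) :
    ∃ H : ℂ → ℂ, IsLeftEndMap (Real.log r) H ∧
      ∀ w, Complex.exp (H w) = G (Complex.exp w) := by
  have hG0 : ∀ x, x ≠ 0 → G x ≠ 0 := fun x hx e => hx (hinj (e.trans h0.symm))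
  obtain ⟨l, hl, hle⟩ := exists_continuous_log (E := ℂ)
    (f := fun w => G (Complex.exp w) / Complex.exp w)
    (Continuous.div (by fun_prop) (by fun_prop) fun w => Complex.exp_ne_zero _)
    (fun w => div_ne_zero (hG0 _ (Complex.exp_ne_zero _)) (Complex.exp_ne_zero _))
  have hGe : ∀ w : ℂ, Real.log r ≤ w.re → G (Complex.exp w) = Complex.exp w := fun w hw =>
    hfix _ (by rwa [Complex.norm_exp, ← Real.log_le_iff_le_exp hr])
  have hl1 : ∀ w : ℂ, Real.log r ≤ w.re → Complex.exp (l w) = 1 := fun w hw => by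
    rw [hle, hGe w hw, div_self (Complex.exp_ne_zero _)]
  set b : ℂ := ((Real.log r : ℝ) : ℂ) with hb
  have hbmem : Real.log r ≤ b.re := by simp [hb]
  let H : ℂ → ℂ := fun w => w + (l w - l b)
  have hHe : ∀ w, Complex.exp (H w) = G (Complex.exp w) := fun w => by
    simp only [H, Complex.exp_add, Complex.exp_sub, hle w, hl1 b hbmem, div_one]
    exact mul_div_cancel₀ _ (Complex.exp_ne_zero _)
  have hmap : ∀ w : ℂ, Real.log r ≤ w.re → H w = w := fun w hw => by
    have := eq_of_exp_eq_of_isPreconnected (S := {w : ℂ | Real.log r ≤ w.re})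
      (convex_halfSpace_re_ge _).isPreconnected hl.continuousOn
      (continuousOn_const (c := l b))
      (fun x hx => by rw [hl1 x hx, hl1 b hbmem]) hbmem hw rfl
    simp [H, this]
  have hper : ∀ (w : ℂ) (n : ℤ), H (w + n * (2 * Real.pi * Complex.I)) =
      H w + n * (2 * Real.pi * Complex.I) := fun w n => by
    have := eq_of_exp_eq_of_isPreconnected (X := ℂ) isPreconnected_univ
      (F := fun w => l (w + n * (2 * Real.pi * Complex.I))) (G := l) (by fun_prop)
      (by fun_prop) (fun x _ => by
        rw [hle, hle, Complex.exp_add, Complex.exp_int_mul_two_pi_mul_I, mul_one])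
      (mem_univ b) (mem_univ w) (by
        have h1 := hmap (b + n * (2 * Real.pi * Complex.I)) (by simp [hb])
        simp only [H] at h1
        linear_combination h1)
    simp only [H, this]
    ring
  refine ⟨H, ⟨by fun_prop, fun w w' hww => ?_, hmap, fun M => ?_⟩, hHe⟩
  · have h1 : Complex.exp w = Complex.exp w' := hinj (by rw [← hHe, ← hHe, hww])
    obtain ⟨n, hn⟩ := Complex.exp_eq_exp_iff_exists_int.1 h1
    rw [hn, hper] at hww
    rw [hn]
    simpa using hww
  · obtain ⟨d, hd, hdG⟩ := Metric.continuous_iff.1 hG 0 (Real.exp M) (Real.exp_pos M)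
    refine ⟨Real.log (d / 2), fun w hw => ?_⟩
    have h1 : ‖Complex.exp w‖ < d := by
      rw [Complex.norm_exp]
      have := Real.exp_le_exp.2 hw
      rw [Real.exp_log (half_pos hd)] at this
      linarith
    have h2 := hdG _ (by simpa using h1)
    rw [h0, dist_zero_right, ← hHe, Complex.norm_exp, Real.exp_lt_exp] at h2
    exact h2.le

/-- In the plane, let a homeomorphism onto its image fix a point and the exterior of a disk and
have iterates returning uniformly close to the identity. A curve from the fixed point whose tip
does not return to it meets its image. -/
theorem exists_eq_map_of_recurrent {G : ℂ → ℂ} (hG : Continuous G)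
    (hinj : Function.Injective G) (h0 : G 0 = 0) {r : ℝ} (hr : 0 < r)
    (hfix : ∀ x : ℂ, r ≤ ‖x‖ → G x = x)
    (hrec : ∀ ε > 0, ∃ n, 1 ≤ n ∧ ∀ x, ‖G^[n] x - x‖ < ε)
    {γ : ℝ → ℂ} (hγ : Continuous γ) (hγ0 : ∀ t, γ t ≠ 0) (hγlim : Tendsto γ atBot (𝓝 0))
    {δ : ℝ} (hδ : 0 < δ) (htip : ∀ n, δ ≤ ‖G^[n] (γ 0)‖) :
    ∃ s t, γ s = G (γ t) := by
  obtain ⟨H, hH, hHe⟩ := exists_isLeftEndMap_lift hG hinj h0 hr hfix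
  obtain ⟨α, hα, hαe⟩ := exists_continuous_log hγ hγ0
  have hHn : ∀ n w, Complex.exp (H^[n] w) = G^[n] (Complex.exp w) := fun n w =>
    (Function.Semiconj.iterate_right (f := Complex.exp) hHe n) w
  have hre : ∀ t, (α t).re = Real.log ‖γ t‖ := fun t => by
    rw [← hαe, Complex.norm_exp, Real.log_exp]
  have hαinf : Tendsto (fun s => (α s).re) atBot atBot := by
    simp only [hre]
    refine Real.tendsto_log_nhdsNE_zero.comp (tendsto_nhdsWithin_iff.2 ⟨?_, ?_⟩)
    · simpa using hγlim.norm
    · exact Eventually.of_forall fun t => norm_ne_zero_iff.2 (hγ0 t)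
  obtain ⟨s, t, hst⟩ := hH.exists_eq_map hα hαinf (c₀ := Real.log δ) (fun n => by
    rw [Real.log_le_iff_le_exp hδ, ← Complex.norm_exp, hHn, hαe]
    exact htip n) (fun M η hη => by
    have hlog : Tendsto Complex.log (𝓝 1) (𝓝 0) := by
      have := (continuousAt_clog Complex.one_mem_slitPlane).tendsto
      rwa [Complex.log_one] at this
    obtain ⟨ρ, hρ, hρlog⟩ := Metric.eventually_nhds_iff.1
      ((hlog.eventually (Metric.ball_mem_nhds _ hη)).and
        (Complex.isOpen_slitPlane.mem_nhds Complex.one_mem_slitPlane))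
    have hMη : Real.exp M < Real.exp (M + η) := Real.exp_lt_exp.2 (by linarith)
    obtain ⟨n, hn1, hn⟩ := hrec (min (ρ * Real.exp M) (Real.exp (M + η) - Real.exp M))
      (lt_min (by positivity) (by linarith))
    refine ⟨n, hn1, fun w hw => ?_, fun w hw => ?_⟩
    · let z : ℂ → ℂ := fun w => G^[n] (Complex.exp w) / Complex.exp w
      have hz : ∀ w : ℂ, M ≤ w.re → dist (z w) 1 < ρ := fun w hw => by
        have h1 : z w - 1 = (G^[n] (Complex.exp w) - Complex.exp w) / Complex.exp w := by
          simp only [z]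
          field_simp [Complex.exp_ne_zero w]
        rw [dist_eq_norm, h1, norm_div, div_lt_iff₀ (norm_pos_iff.2 (Complex.exp_ne_zero _)),
          Complex.norm_exp]
        refine ((hn _).trans_le (min_le_left _ _)).trans_le ?_
        gcongr
      have hzc : Continuous z :=
        Continuous.div ((hG.iterate n).comp Complex.continuous_exp) Complex.continuous_exp
          fun w => Complex.exp_ne_zero _
      have hb : H^[n] ((max M (Real.log r) : ℝ) : ℂ) = ((max M (Real.log r) : ℝ) : ℂ) :=
        Function.iterate_fixed (hH.map_eq _ (by
          rw [Complex.ofReal_re]; exact le_max_right _ _)) n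
      have hexp : ∀ w, Complex.exp (H^[n] w - w) = z w := fun w => by
        rw [Complex.exp_sub, hHn]
      have key := eq_of_exp_eq_of_isPreconnected (S := {w : ℂ | M ≤ w.re})
        (F := fun w => H^[n] w - w) (G := fun w => Complex.log (z w))
        (x₀ := ((max M (Real.log r) : ℝ) : ℂ))
        (convex_halfSpace_re_ge M).isPreconnected
        (((hH.continuous.iterate n).sub continuous_id).continuousOn)
        (hzc.continuousOn.clog fun x hx => (hρlog (hz x hx)).2)
        (fun x hx => by
          rw [Complex.exp_log (Complex.slitPlane_ne_zero (hρlog (hz x hx)).2)]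
          exact hexp x)
        (by
          change M ≤ (((max M (Real.log r) : ℝ) : ℂ)).re
          rw [Complex.ofReal_re]; exact le_max_left _ _) hw (by
          rw [← hexp, hb, sub_self, Complex.exp_zero, Complex.log_one])
      rw [key]
      simpa using (hρlog (hz w hw)).1
    · rw [← Real.exp_le_exp, ← Complex.norm_exp, hHn]
      have h1 := (hn (Complex.exp w)).trans_le (min_le_right _ _)
      have h2 := norm_le_norm_add_norm_sub (Complex.exp w) (G^[n] (Complex.exp w))
      rw [norm_sub_rev, Complex.norm_exp] at h2
      linarith [Real.exp_le_exp.2 hw])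
  exact ⟨s, t, by rw [← hαe, ← hαe, hst, hHe]⟩

/-- The iterates of an isometric self-map of a compact metric space return uniformly close to
the identity. -/
theorem Isometry.exists_iterate_dist_lt {S : Type*} [MetricSpace S] [CompactSpace S]
    {ψ : S → S} (hψ : Isometry ψ) {ε : ℝ} (hε : 0 < ε) :
    ∃ n, 1 ≤ n ∧ ∀ x, dist (ψ^[n] x) x < ε := by
  have hε3 : 0 < ε / 3 := by positivity
  have hiter : ∀ n, Isometry ψ^[n] := fun n => by
    induction n with
    | zero => exact isometry_id
    | succ n ih => exact ih.comp hψ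
  obtain ⟨T, -, hT, hcov⟩ := finite_cover_balls_of_compact (isCompact_univ (X := S)) hε3
  have := hT.fintype
  obtain ⟨a, k, hk, hlim⟩ := CompactSpace.tendsto_subseq fun (n : ℕ) (x : T) => ψ^[n] (x : S)
  obtain ⟨N, hN⟩ := Metric.cauchySeq_iff'.1 hlim.cauchySeq (ε / 3) hε3
  have hlt : k N < k (N + 1) := hk (Nat.lt_succ_self N)
  refine ⟨k (N + 1) - k N, by omega, fun x => ?_⟩
  obtain ⟨y, hyT, hy⟩ := mem_iUnion₂.1 (hcov (mem_univ x))
  have h1 : dist (ψ^[k (N + 1) - k N] y) y < ε / 3 := by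
    have h2 := (dist_le_pi_dist _ _ ⟨y, hyT⟩).trans_lt (hN (N + 1) (Nat.le_succ N))
    simp only [Function.comp_apply] at h2
    rwa [← Nat.add_sub_of_le hlt.le, Function.iterate_add_apply, (hiter _).dist_eq] at h2
  have h2 := dist_triangle4 (ψ^[k (N + 1) - k N] x) (ψ^[k (N + 1) - k N] y) y x
  rw [(hiter _).dist_eq, dist_comm y x] at h2
  rw [Metric.mem_ball] at hy
  linarith

/-- The radial retraction of the plane onto the closed unit disk. -/
noncomputable def diskRetraction (x : ℂ) : Metric.closedBall (0 : ℂ) 1 :=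
  ⟨((max 1 ‖x‖)⁻¹ : ℝ) • x, by
    have : 0 < max 1 ‖x‖ := lt_max_of_lt_left one_pos
    rw [mem_closedBall_zero_iff, norm_smul, norm_inv, Real.norm_of_nonneg this.le,
      inv_mul_le_one₀ this]
    exact le_max_right _ _⟩

theorem continuous_diskRetraction : Continuous diskRetraction :=
  Continuous.subtype_mk (Continuous.smul
    (Continuous.inv₀ (continuous_const.max continuous_norm) fun _ =>
      (lt_max_of_lt_left one_pos).ne') continuous_id) _

theorem diskRetraction_of_norm_le {x : ℂ} (hx : ‖x‖ ≤ 1) : (diskRetraction x : ℂ) = x := by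
  simp [diskRetraction, max_eq_left hx]

theorem norm_diskRetraction_of_le {x : ℂ} (hx : 1 ≤ ‖x‖) : ‖(diskRetraction x : ℂ)‖ = 1 := by
  rw [diskRetraction, norm_smul, max_eq_right hx, norm_inv, norm_norm,
    inv_mul_cancel₀ (by positivity)]

/-- The extension to the plane of a self-map of the closed unit disk, by a translation along
each outward ray. -/
noncomputable def diskExtension (g : Metric.closedBall (0 : ℂ) 1 → Metric.closedBall (0 : ℂ) 1)
    (x : ℂ) : ℂ := x + ((g (diskRetraction x) : ℂ) - diskRetraction x)

section diskExtension

variable {g : Metric.closedBall (0 : ℂ) 1 → Metric.closedBall (0 : ℂ) 1}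

theorem continuous_diskExtension (hg : Continuous g) : Continuous (diskExtension g) := by
  have h := continuous_diskRetraction
  exact continuous_id.add ((continuous_subtype_val.comp (hg.comp h)).sub
    (continuous_subtype_val.comp h))

theorem diskExtension_coe (x : Metric.closedBall (0 : ℂ) 1) : diskExtension g x = g x := by
  have h : diskRetraction x = x :=
    Subtype.ext (diskRetraction_of_norm_le (mem_closedBall_zero_iff.1 x.2))
  rw [diskExtension, h]
  ring

theorem diskExtension_of_le
    (hfix : ∀ x : Metric.closedBall (0 : ℂ) 1, ‖(x : ℂ)‖ = 1 → g x = x)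
    {x : ℂ} (hx : 1 ≤ ‖x‖) : diskExtension g x = x := by
  rw [diskExtension, hfix _ (norm_diskRetraction_of_le hx), sub_self, add_zero]

theorem diskExtension_injective
    (hfix : ∀ x : Metric.closedBall (0 : ℂ) 1, ‖(x : ℂ)‖ = 1 → g x = x)
    (hg : Function.Injective g) :
    Function.Injective (diskExtension g) := by
  have key : ∀ x y : ℂ, ‖x‖ ≤ 1 → diskExtension g x = diskExtension g y → x = y := by
    intro x y hx hxy
    lift x to Metric.closedBall (0 : ℂ) 1 using mem_closedBall_zero_iff.2 hx
    rw [diskExtension_coe] at hxy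
    rcases le_or_gt ‖y‖ 1 with hy | hy
    · lift y to Metric.closedBall (0 : ℂ) 1 using mem_closedBall_zero_iff.2 hy
      rw [diskExtension_coe] at hxy
      rw [hg (Subtype.ext hxy)]
    · rw [diskExtension_of_le hfix hy.le] at hxy
      have := mem_closedBall_zero_iff.1 (g x).2
      rw [hxy] at this
      exact absurd this (not_le.2 hy)
  intro x y hxy
  rcases le_total ‖x‖ 1 with hx | hx
  · exact key x y hx hxy
  · rcases le_total ‖y‖ 1 with hy | hy
    · exact (key y x hy hxy.symm).symm
    · rwa [diskExtension_of_le hfix hx, diskExtension_of_le hfix hy] at hxy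

end diskExtension

theorem exists_curve_of_isGeodesicSpace {S : Type*} [MetricSpace S] (hgeo : IsGeodesicSpace S)
    {p z : S} (hpz : p ≠ z) :
    ∃ c : ℝ → S, Continuous c ∧ c 0 = z ∧ Tendsto c atBot (𝓝 p) ∧ (∀ t, c t ≠ p) ∧
      (∀ t, dist (c t) z < dist p z) ∧ ∀ s t, dist (c s) p = dist (c t) p → c s = c t := by
  obtain ⟨γ, hγ0, hγL, hγ⟩ := hgeo p z
  have hL : 0 < dist p z := dist_pos.2 hpz
  set L := dist p z
  let u : ℝ → ℝ := fun t => L * min (Real.exp t) 1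
  have hucont : Continuous u := by
    exact continuous_const.mul (Real.continuous_exp.min continuous_const)
  have hupos : ∀ t, 0 < u t := fun t => mul_pos hL (lt_min (Real.exp_pos t) one_pos)
  have hu : ∀ t, u t ∈ Icc 0 L := fun t =>
    ⟨(hupos t).le, mul_le_of_le_one_right hL.le (min_le_right _ _)⟩
  have hp : ∀ t, dist (γ (u t)) p = u t := fun t => by
    rw [← hγ0, hγ _ (hu t) 0 ⟨le_rfl, hL.le⟩, sub_zero, abs_of_pos (hupos t)]
  refine ⟨γ ∘ u, ?_, ?_, ?_, ?_, fun t => ?_, fun s t hst => ?_⟩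
  · refine ContinuousOn.comp_continuous (s := Icc 0 L) ?_ hucont hu
    refine LipschitzOnWith.continuousOn (K := 1) (LipschitzOnWith.of_dist_le_mul ?_)
    intro x hx y hy
    rw [hγ x hx y hy, Real.dist_eq]
    simp
  · simp [u, hγL]
  · rw [tendsto_iff_dist_tendsto_zero]
    simp only [Function.comp_apply, hp]
    have : Tendsto u atBot (𝓝 (L * min 0 1)) :=
      tendsto_const_nhds.mul (Real.tendsto_exp_atBot.min tendsto_const_nhds)
    simpa using this
  · intro t h
    have := hp t
    rw [Function.comp_apply] at h
    rw [h, dist_self] at this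
    exact (hupos t).ne this
  · rw [Function.comp_apply, ← hγL, hγ _ (hu t) L ⟨hL.le, le_rfl⟩, abs_sub_comm,
      abs_of_nonneg (by linarith [(hu t).2])]
    linarith [hupos t]
  · simp only [Function.comp_apply, hp] at hst ⊢
    rw [hst]

theorem eq_id_of_isometry_of_fixes_circle {S : Type*} [MetricSpace S] (hgeo : IsGeodesicSpace S)
    (φ : Metric.closedBall (0 : ℂ) 1 ≃ₜ S) {ψ : S → S} (hψ : Isometry ψ)
    (hfix : ∀ x : Metric.closedBall (0 : ℂ) 1, ‖(x : ℂ)‖ = 1 → ψ (φ x) = φ x) (z : S) :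
    ψ z = z := by
  by_contra hz
  have : CompactSpace S := φ.compactSpace
  -- the fixed point nearest to `z`
  have hFclosed : IsClosed {x | ψ x = x} := isClosed_eq hψ.continuous continuous_id
  obtain ⟨p, hp : ψ p = p, hpmin⟩ := hFclosed.isCompact.exists_isMinOn
    ⟨φ ⟨1, by simp⟩, hfix _ (by simp)⟩ (f := fun x => dist x z) (by fun_prop)
  have hpz : p ≠ z := fun h => hz (h ▸ hp)
  obtain ⟨c, hc, hc0, hclim, hcp, hcz, hcinj⟩ := exists_curve_of_isGeodesicSpace hgeo hpz
  have hcψ : ∀ s t, c s ≠ ψ (c t) := fun s t h => by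
    have h1 : dist (c s) p = dist (c t) p := by
      rw [h]
      nth_rewrite 1 [← hp]
      exact hψ.dist_eq _ _
    rw [hcinj s t h1] at h
    exact absurd (hpmin h.symm) (not_le.2 (hcz t))
  have hψn : ∀ n, dist (ψ^[n] z) p = dist z p := fun n => by
    induction n with
    | zero => rfl
    | succ n ih =>
      rw [Function.iterate_succ_apply', ← ih]
      nth_rewrite 1 [← hp]
      exact hψ.dist_eq _ _
  -- coordinates in the plane
  let f : S → ℂ := fun x => φ.symm x
  have hf : Continuous f := continuous_subtype_val.comp φ.symm.continuous
  have hfinj : Function.Injective f := Subtype.val_injective.comp φ.symm.injective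
  let g : Metric.closedBall (0 : ℂ) 1 → Metric.closedBall (0 : ℂ) 1 :=
    fun x => φ.symm (ψ (φ x))
  have hg : Continuous g := φ.symm.continuous.comp (hψ.continuous.comp φ.continuous)
  have hginj : Function.Injective g := φ.symm.injective.comp (hψ.injective.comp φ.injective)
  have hgfix : ∀ x : Metric.closedBall (0 : ℂ) 1, ‖(x : ℂ)‖ = 1 → g x = x := fun x hx => by
    simp [g, hfix x hx]
  have hgf : ∀ x, diskExtension g (f x) = f (ψ x) := fun x => by
    simp only [f, diskExtension_coe]
    simp [g]
  have hgfn : ∀ n x, (diskExtension g)^[n] (f x) = f (ψ^[n] x) := fun n x =>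
    ((Function.Semiconj.iterate_right (f := f) (fun x => (hgf x).symm) n) x).symm
  let G : ℂ → ℂ := fun x => diskExtension g (x + f p) - f p
  have hGn : ∀ n x, G^[n] x = (diskExtension g)^[n] (x + f p) - f p := fun n x => by
    rw [eq_sub_iff_add_eq]
    exact (Function.Semiconj.iterate_right (f := fun x => x + f p) (ga := G)
      (gb := diskExtension g) (fun x => sub_add_cancel _ _) n) x
  have hGf : ∀ x, G (f x - f p) = f (ψ x) - f p := fun x => by simp [G, hgf]
  obtain ⟨δ, hδ, hδd⟩ : ∃ δ > 0, ∀ x, dist x p = dist z p → δ ≤ ‖f x - f p‖ := by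
    obtain ⟨x, hx : dist x p = dist z p, hxmin⟩ :=
      (isClosed_eq (f := fun x => dist x p) (g := fun _ => dist z p) (by fun_prop)
        (by fun_prop)).isCompact.exists_isMinOn ⟨z, rfl⟩ (f := fun x => ‖f x - f p‖)
        (by fun_prop)
    refine ⟨‖f x - f p‖, norm_pos_iff.2 (sub_ne_zero.2 (hfinj.ne fun h => ?_)),
      fun y hy => hxmin hy⟩
    rw [h, dist_self] at hx
    exact hpz (dist_eq_zero.1 hx.symm).symm
  have hfp : ‖f p‖ ≤ 1 := mem_closedBall_zero_iff.1 (φ.symm p).2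
  obtain ⟨s, t, hst⟩ := exists_eq_map_of_recurrent (G := G) (r := 2) (δ := δ)
    (γ := fun t => f (c t) - f p)
    (((continuous_diskExtension hg).comp (continuous_add_const _)).sub continuous_const)
    (fun x y h => by
      simpa using diskExtension_injective hgfix hginj (sub_left_injective h))
    (by simp [G, hgf, hp]) two_pos
    (fun x hx => by
      have h1 := norm_le_norm_add_norm_sub' x (-f p)
      rw [norm_neg, sub_neg_eq_add] at h1
      simp only [G]
      rw [diskExtension_of_le hgfix (by linarith), add_sub_cancel_right])
    (fun ε hε => by
      obtain ⟨d, hd, hdf⟩ := Metric.uniformContinuous_iff.1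
        (CompactSpace.uniformContinuous_of_continuous hf) ε hε
      obtain ⟨n, hn1, hn⟩ := hψ.exists_iterate_dist_lt hd
      refine ⟨n, hn1, fun x => ?_⟩
      rw [hGn, sub_sub, add_comm (f p) x]
      rcases le_total ‖x + f p‖ 1 with h | h
      · have h1 : x + f p = f (φ ⟨x + f p, mem_closedBall_zero_iff.2 h⟩) := by simp [f]
        rw [h1, hgfn, ← dist_eq_norm]
        exact hdf (hn _)
      · rw [Function.iterate_fixed (diskExtension_of_le hgfix h)]
        simpa using hε)
    (by fun_prop) (fun t => sub_ne_zero.2 (hfinj.ne (hcp t)))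
    (by simpa using ((hf.tendsto p).comp hclim).sub_const (f p)) hδ
    (fun n => by
      rw [hGn, sub_add_cancel, hgfn, hc0]
      exact hδd _ (hψn n))
  rw [hGf] at hst
  exact hcψ s t (hfinj (sub_left_injective hst))

end

/-- Proposition 2.3: a geodesic metric space homeomorphic to the closed unit
disk admits no nontrivial bijective isometry fixing its boundary circle
pointwise. -/
theorem isometry_fixing_boundary_of_disk_is_id
    {S : Type*} [MetricSpace S]
    (hgeo : IsGeodesicSpace S)
    (φ : Metric.closedBall (0 : EuclideanSpace ℝ (Fin 2)) 1 ≃ₜ S)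
    (ψ : S → S)
    (hbij : Function.Bijective ψ)
    (hiso : ∀ a b : S, dist (ψ a) (ψ b) = dist a b)
    (hfix : ∀ p : Metric.closedBall (0 : EuclideanSpace ℝ (Fin 2)) 1,
      (p : EuclideanSpace ℝ (Fin 2)) ∈ Metric.sphere (0 : EuclideanSpace ℝ (Fin 2)) 1 →
      ψ (φ p) = φ p) :
    ∀ z : S, ψ z = z := by
  let e : ℂ ≃ₗᵢ[ℝ] EuclideanSpace ℝ (Fin 2) := Complex.orthonormalBasisOneI.repr
  let E : Metric.closedBall (0 : ℂ) 1 ≃ₜ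
      Metric.closedBall (0 : EuclideanSpace ℝ (Fin 2)) 1 :=
    e.toHomeomorph.subtype fun x => by simp
  refine eq_id_of_isometry_of_fixes_circle hgeo (E.trans φ) (Isometry.of_dist_eq hiso)
    fun x hx => hfix (E x) ?_
  rw [mem_sphere_zero_iff_norm]
  exact (e.norm_map x).trans hx
end
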